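/- Assume the transversality hypothesis and auxiliary hypothesis 2, and suppose that there is no real analytic solution of the functional equation, other than the identically zero solution, in any nonempty open subset of ℝ³. Then there exist κ > 0 and C < ∞ such that for every r > 0, every ε ∈ (0,1], and every triple f = (f₁,f₂,f₃) of Lebesgue measurable functions such that for some i ∈ {1,2,3}, |f_i(Φ_i(x,s))| ≥ 1 for all (x,s) ∈ B×[−r,r], the Lebesgue measure of the set {(x,s) ∈ B×[−r,r] : |Σ_{j=1}^3 f_j(Φ_j(x,s))·∇φ_j(x)| ≤ ε} is at most C ε^κ r. -/

import Mathlib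

open MeasureTheory Real Set Filter Metric
open scoped FourierTransform ENNReal NNReal Topology ComplexConjugate

noncomputable section

abbrev Vec2 : Type := ℝ × ℝ

/-- The quadrilinear form `T(f) = ∫ ∏ⱼ fⱼ(φⱼ(x)) η(x) dx`. -/
def Tform (φ : Fin 4 → Vec2 → ℝ) (η : Vec2 → ℝ) (f : Fin 4 → ℝ → ℂ) : ℂ :=
  ∫ x : Vec2, (∏ j : Fin 4, f j (φ j x)) * (η x : ℂ)
/-- `D = ∂/∂x₂`. -/
def Dder (φ : Vec2 → ℝ) (x : Vec2) : ℝ := fderiv ℝ φ x ((0, 1) : Vec2)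

/-- `Φⱼ(x,s) = (φⱼ(x), s·Dφⱼ(x))`. -/
def Φmap (φ : Vec2 → ℝ) (p : Vec2 × ℝ) : Vec2 := (φ p.1, p.2 * Dder φ p.1)


/-- Pointwise van der Corput type lemma: `2^m` separated points. -/
lemma vdc_points (m : ℕ) : ∀ (g : ℕ → ℝ → ℝ) (I : Set ℝ) (_ : I.OrdConnected)
    (_ : ∀ k < m, ∀ t ∈ I, HasDerivAt (g k) (g (k+1) t) t) (c δ ε : ℝ) (_ : 0 < δ)
    (_ : ∀ t ∈ I, c ≤ |g m t|) (x : ℕ → ℝ) (_ : ∀ i < 2^m, x i ∈ I ∧ |g 0 (x i)| ≤ ε)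
    (_ : ∀ i, i + 1 < 2^m → x i + δ ≤ x (i+1)), c * δ^m ≤ 2^m * ε := by
  induction m with
  | zero =>
    intro g I _ _ c δ ε hδ hc x hx _
    have h := hx 0 (by norm_num)
    have := hc _ h.1
    simp only [pow_zero, mul_one, one_mul]; linarith [h.2]
  | succ m ih =>
    intro g I hI hg c δ ε hδ hc x hx hsep
    have key : ∀ i, ∃ y, i < 2^m → (x (2*i) < y ∧ y < x (2*i+1) ∧ |g 1 y| ≤ 2 * ε / δ) := by
      intro i
      by_cases hi : i < 2^m
      · have h1 : 2*i+1 < 2^(m+1) := by rw [pow_succ]; omega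
        have h0 := hx (2*i) (by omega)
        have h0' := hx (2*i+1) h1
        have hs := hsep (2*i) h1
        have hlt : x (2*i) < x (2*i+1) := by linarith
        have hsub : Icc (x (2*i)) (x (2*i+1)) ⊆ I := hI.out h0.1 h0'.1
        obtain ⟨y, hy, hy'⟩ := exists_hasDerivAt_eq_slope (g 0) (g 1) hlt
          (fun t ht => (hg 0 (by omega) t (hsub ht)).continuousAt.continuousWithinAt)
          (fun t ht => hg 0 (by omega) t (hsub (Ioo_subset_Icc_self ht)))
        refine ⟨y, fun _ => ⟨hy.1, hy.2, ?_⟩⟩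
        rw [hy', abs_div, abs_of_pos (by linarith : 0 < x (2*i+1) - x (2*i))]
        have hε : 0 ≤ ε := (abs_nonneg _).trans h0.2
        gcongr
        · calc _ ≤ |g 0 (x (2*i+1))| + |g 0 (x (2*i))| := abs_sub _ _
            _ ≤ 2 * ε := by linarith [h0.2, h0'.2]
        · linarith
      · exact ⟨0, fun h => absurd h hi⟩
    choose y hy using key
    have hyI : ∀ i < 2^m, y i ∈ I := by
      intro i hi
      have h1 : 2*i+1 < 2^(m+1) := by rw [pow_succ]; omega
      exact hI.out (hx (2*i) (by omega)).1 (hx (2*i+1) h1).1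
        ⟨(hy i hi).1.le, (hy i hi).2.1.le⟩
    have := ih (fun k => g (k+1)) I hI (fun k hk t ht => hg (k+1) (by omega) t ht) c δ (2*ε/δ) hδ
      hc y (fun i hi => ⟨hyI i hi, (hy i hi).2.2⟩) (by
        intro i hi
        have h1 : 2*i+1+1 < 2^(m+1) := by rw [pow_succ]; omega
        have := hsep (2*i+1) h1
        have h2 := (hy i (by omega)).2.1
        have h3 := (hy (i+1) hi).1
        have e : 2*(i+1) = 2*i+1+1 := by ring
        rw [e] at h3
        linarith)
    calc c * δ^(m+1) = (c * δ^m) * δ := by ring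
      _ ≤ (2^m * (2*ε/δ)) * δ := by gcongr
      _ = 2^(m+1) * ε := by field_simp; ring

lemma greedy (δ : ℝ) (hδ : 0 < δ) (n : ℕ) : ∀ S : Set ℝ, BddBelow S →
    (∃ x : ℕ → ℝ, (∀ i < n, x i ∈ S) ∧ ∀ i, i + 1 < n → x i + δ ≤ x (i+1)) ∨
    volume S ≤ ENNReal.ofReal (n * (2*δ)) := by
  induction n with
  | zero => intro S _; left; exact ⟨fun _ => 0, by simp, by simp⟩
  | succ n ih =>
    intro S hS
    rcases S.eq_empty_or_nonempty with rfl | hne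
    · right; simp
    obtain ⟨x0, hx0, hlt⟩ := exists_lt_of_csInf_lt hne (by linarith : sInf S < sInf S + δ)
    have hsub : S ⊆ (S ∩ Ici (x0 + δ)) ∪ Icc (sInf S) (sInf S + 2*δ) := by
      intro t ht
      by_cases h : x0 + δ ≤ t
      · exact Or.inl ⟨ht, h⟩
      · right; push Not at h; exact ⟨csInf_le hS ht, by linarith⟩
    rcases ih (S ∩ Ici (x0+δ)) (hS.mono inter_subset_left) with ⟨x, hx, hsep⟩ | h
    · left
      refine ⟨fun i => if i = 0 then x0 else x (i-1), ?_, ?_⟩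
      · intro i hi
        by_cases h0 : i = 0
        · simp [h0, hx0]
        · simp only [h0, if_false]; exact (hx (i-1) (by omega)).1
      · intro i hi
        by_cases h0 : i = 0
        · subst h0; simpa using (hx 0 (by omega)).2
        · simp only [h0, if_false, Nat.add_eq_zero_iff, one_ne_zero, and_false]
          have := hsep (i-1) (by omega)
          have e : i - 1 + 1 = i := by omega
          rw [e] at this
          simpa using this
    · right
      calc volume S ≤ _ := measure_mono hsub
        _ ≤ _ := measure_union_le _ _
        _ ≤ ENNReal.ofReal (n*(2*δ)) + ENNReal.ofReal (2*δ) := by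
          gcongr; rw [Real.volume_Icc]; gcongr; linarith
        _ = ENNReal.ofReal ((n+1 : ℕ)*(2*δ)) := by
          rw [← ENNReal.ofReal_add (by positivity) (by positivity)]; congr 1; push_cast; ring

/-- One-dimensional sublevel bound. -/
lemma vdc_measure (m : ℕ) (hm : 0 < m) (g : ℕ → ℝ → ℝ) (a b : ℝ)
    (hg : ∀ k < m, ∀ t ∈ Icc a b, HasDerivAt (g k) (g (k+1) t) t) (c ε : ℝ) (hc : 0 < c)
    (hε : 0 < ε) (hgm : ∀ t ∈ Icc a b, c ≤ |g m t|) :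
    volume {t ∈ Icc a b | |g 0 t| ≤ ε} ≤
      ENNReal.ofReal (2^m * (2 * (3 * (ε/c)^((m:ℝ)⁻¹)))) := by
  have hpos : 0 < (ε/c)^((m:ℝ)⁻¹) := by positivity
  have hS : BddBelow {t ∈ Icc a b | |g 0 t| ≤ ε} := ⟨a, fun t ht => ht.1.1⟩
  rcases greedy (3 * (ε/c)^((m:ℝ)⁻¹)) (by positivity) (2^m) _ hS with ⟨x, hx, hsep⟩ | h
  · exfalso
    have := vdc_points m g (Icc a b) ordConnected_Icc hg c _ ε
      (by positivity : 0 < 3 * (ε/c)^((m:ℝ)⁻¹)) hgm x hx hsep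
    have e : ((ε/c)^((m:ℝ)⁻¹))^m = ε/c := Real.rpow_inv_natCast_pow (by positivity) hm.ne'
    rw [mul_pow, e] at this
    have e2 : c * (3^m * (ε/c)) = 3^m * ε := by field_simp
    rw [e2] at this
    have h3 : (2:ℝ)^m < 3^m := pow_lt_pow_left₀ (by norm_num) (by norm_num) hm.ne'
    nlinarith
  · simpa using h


/-- iterated directional derivative -/
def dirD {V : Type*} [NormedAddCommGroup V] [NormedSpace ℝ V] (v : V) (f : V → ℝ) : ℕ → V → ℝ
  | 0 => f
  | (k+1) => fun x => fderiv ℝ (dirD v f k) x v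

lemma dirD_analytic {V : Type*} [NormedAddCommGroup V] [NormedSpace ℝ V] (v : V) (f : V → ℝ)
    (x : V) (hf : AnalyticAt ℝ f x) (k : ℕ) : AnalyticAt ℝ (dirD v f k) x := by
  induction k with
  | zero => exact hf
  | succ k ih => exact ((ContinuousLinearMap.apply ℝ ℝ v).analyticAt _).comp ih.fderiv

lemma dirD_hasDerivAt {V : Type*} [NormedAddCommGroup V] [NormedSpace ℝ V] (v : V) (f : V → ℝ)
    (x : V) (t : ℝ) (hf : AnalyticAt ℝ f (x + t • v)) (k : ℕ) :
    HasDerivAt (fun t : ℝ => dirD v f k (x + t • v)) (dirD v f (k+1) (x + t • v)) t := by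
  have h1 := (dirD_analytic v f _ hf k).differentiableAt.hasFDerivAt
  have h2 : HasDerivAt (fun t : ℝ => x + t • v) v t := by
    simpa using ((hasDerivAt_id t).smul_const v).const_add x
  exact h1.comp_hasDerivAt t h2

lemma exists_dirD_ne {V : Type*} [NormedAddCommGroup V] [NormedSpace ℝ V] (f : V → ℝ)
    (x0 : V) (hf : AnalyticAt ℝ f x0) (hne : ¬ ∀ᶠ x in 𝓝 x0, f x = 0) :
    ∃ v k, dirD v f k x0 ≠ 0 := by
  by_contra! hcon
  apply hne
  obtain ⟨r, hr, hball⟩ := Metric.eventually_nhds_iff_ball.1 hf.eventually_analyticAt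
  filter_upwards [ball_mem_nhds x0 hr] with y hy
  set v := y - x0 with hv
  set g : ℝ → ℝ := fun t => f (x0 + t • v) with hg
  set U : Set ℝ := (fun t : ℝ => x0 + t • v) ⁻¹' ball x0 r with hU
  have hUo : IsOpen U := isOpen_ball.preimage (by fun_prop)
  have hUc : Convex ℝ U := by
    intro t ht s hs a b ha hb hab
    have := (convex_ball x0 r) ht hs ha hb hab
    have e : a • (x0 + t • v) + b • (x0 + s • v) = x0 + (a • t + b • s) • v := by
      have : (a + b) • x0 = x0 := by rw [hab, one_smul]
      nth_rewrite 3 [← this]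
      simp only [smul_eq_mul]; module
    simp only [e] at this
    exact this
  have h0 : (0:ℝ) ∈ U := by simp [hU, hr]
  have h1 : (1:ℝ) ∈ U := by
    simp only [hU, mem_preimage, one_smul, hv, add_sub_cancel]; exact hy
  have hgan : AnalyticOnNhd ℝ g U := by
    intro t ht
    have : AnalyticAt ℝ (fun t : ℝ => x0 + t • v) t := by fun_prop
    exact AnalyticAt.fun_comp (hball _ ht) this
  have hit : ∀ k, ∀ t ∈ U, iteratedDeriv k g t = dirD v f k (x0 + t • v) := by
    intro k
    induction k with
    | zero => intro t _; simp [hg, dirD]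
    | succ k ih =>
      intro t ht
      rw [iteratedDeriv_succ]
      have : iteratedDeriv k g =ᶠ[𝓝 t] fun t => dirD v f k (x0 + t • v) := by
        filter_upwards [hUo.mem_nhds ht] with s hs using ih s hs
      rw [this.deriv_eq]
      exact (dirD_hasDerivAt v f x0 t (hball _ ht) k).deriv
  have htop : analyticOrderAt g 0 = ⊤ := by
    apply ENat.eq_top_iff_forall_ge.2
    intro n
    rw [natCast_le_analyticOrderAt_iff_iteratedDeriv_eq_zero (hgan 0 h0)]
    intro i _
    rw [hit i 0 h0]; simpa using hcon v i
  rw [analyticOrderAt_eq_top] at htop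
  have := hgan.eqOn_zero_of_preconnected_of_eventuallyEq_zero hUc.isPreconnected h0 htop h1
  simpa [hg, hv] using this

lemma analytic_sublevel {V : Type*} [NormedAddCommGroup V] [NormedSpace ℝ V]
    [FiniteDimensional ℝ V] [MeasurableSpace V] [BorelSpace V] (μ : Measure V)
    [μ.IsAddHaarMeasure] (f : V → ℝ)
    (x0 : V) (hf : AnalyticAt ℝ f x0) (hne : ¬ ∀ᶠ x in 𝓝 x0, f x = 0) :
    ∃ N ∈ 𝓝 x0, ∃ C κ : ℝ, 0 < κ ∧ 0 ≤ C ∧ ∀ ε : ℝ, 0 < ε →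
      μ (N ∩ {x | |f x| ≤ ε}) ≤ ENNReal.ofReal (C * ε ^ κ) := by
  obtain ⟨v, m, hm⟩ := exists_dirD_ne f x0 hf hne
  set c := |dirD v f m x0| / 2 with hc
  have hcpos : 0 < c := by have := abs_pos.2 hm; positivity
  have hev : ∀ᶠ x in 𝓝 x0, c < |dirD v f m x| := by
    have := (dirD_analytic v f x0 hf m).continuousAt.abs
    refine this.eventually_const_lt ?_
    have := abs_pos.2 hm
    simp only [hc]; linarith
  obtain ⟨R, hR, hball⟩ := Metric.eventually_nhds_iff_ball.1 (hf.eventually_analyticAt.and hev)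
  rcases Nat.eq_zero_or_pos m with hm0 | hmpos
  · subst hm0
    refine ⟨ball x0 R, ball_mem_nhds _ hR, (μ (ball x0 R)).toReal / c, 1, one_pos, by positivity,
      fun ε hε => ?_⟩
    by_cases h : ε < c
    · have : ball x0 R ∩ {x | |f x| ≤ ε} = ∅ := by
        ext x; simp only [mem_inter_iff, mem_ofPred_eq, mem_empty_iff_false, iff_false, not_and,
          not_le]
        intro hx; have := (hball x hx).2; simp only [dirD] at this; linarith
      rw [this]; simp
    · calc _ ≤ μ (ball x0 R) := measure_mono inter_subset_left
        _ = ENNReal.ofReal ((μ (ball x0 R)).toReal) := by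
          rw [ENNReal.ofReal_toReal measure_ball_lt_top.ne]
        _ ≤ _ := by
          apply ENNReal.ofReal_le_ofReal
          rw [rpow_one, div_mul_eq_mul_div, le_div_iff₀ hcpos]
          push Not at h
          gcongr
  · set T := R / (8 * (‖v‖ + 1)) with hT
    have hTpos : 0 < T := by positivity
    have hTv : T * ‖v‖ ≤ R / 8 := by
      rw [hT, div_mul_eq_mul_div, div_le_div_iff₀ (by positivity) (by norm_num)]
      nlinarith [norm_nonneg v]
    set A := (2:ℝ)^m * (2 * (3 * (1/c)^((m:ℝ)⁻¹))) with hA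
    have hApos : 0 < A := by positivity
    refine ⟨ball x0 (R/2), ball_mem_nhds _ (by positivity),
      (μ (ball x0 R)).toReal * A / T, (m:ℝ)⁻¹, by positivity, by positivity, fun ε hε => ?_⟩
    set S := ball x0 (R/2) ∩ {x | |f x| ≤ ε} with hS
    have hSm : MeasurableSet S := by
      have hcont : ContinuousOn (fun x => |f x|) (ball x0 (R/2)) := fun x hx =>
        ((hball x (ball_subset_ball (by linarith) hx)).1.continuousAt.abs).continuousWithinAt
      have ho := hcont.isOpen_inter_preimage isOpen_ball (isOpen_Ioi (a := ε))
      have : S = ball x0 (R/2) \ (ball x0 (R/2) ∩ (fun x => |f x|) ⁻¹' Ioi ε) := by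
        ext x; simp [hS]
      rw [this]
      exact measurableSet_ball.diff ho.measurableSet
    set Z : Set (V × ℝ) := {q | q.2 ∈ Icc 0 T ∧ q.1 + q.2 • v ∈ S} with hZ
    have hZm : MeasurableSet Z := by
      apply MeasurableSet.inter
      · exact measurable_snd measurableSet_Icc
      · have : Measurable fun q : V × ℝ => q.1 + q.2 • v := by
          apply Continuous.measurable; fun_prop
        exact this hSm
    have e1 : (μ.prod volume) Z = ENNReal.ofReal T * μ S := by
      rw [Measure.prod_apply_symm hZm]
      have : ∀ t : ℝ, μ ((fun x => (x, t)) ⁻¹' Z) = (Icc 0 T).indicator (fun _ => μ S) t := by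
        intro t
        by_cases ht : t ∈ Icc 0 T
        · have : ((fun x => (x, t)) ⁻¹' Z) = (fun x => x + t • v) ⁻¹' S := by
            ext x; simp only [hZ, mem_preimage, mem_ofPred_eq, ht, true_and]
          rw [this, measure_preimage_add_right, indicator_of_mem ht]
        · have : ((fun x => (x, t)) ⁻¹' Z) = ∅ := by
            ext x; simp only [hZ, mem_preimage, mem_ofPred_eq, ht, false_and, mem_empty_iff_false]
          rw [this, indicator_of_notMem ht]; simp
      simp_rw [this]
      rw [lintegral_indicator measurableSet_Icc, setLIntegral_const, Real.volume_Icc, mul_comm]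
      simp
    have e2 : (μ.prod volume) Z ≤ μ (ball x0 R) * ENNReal.ofReal (A * ε^((m:ℝ)⁻¹)) := by
      rw [Measure.prod_apply hZm]
      have : ∀ x : V, volume (Prod.mk x ⁻¹' Z) ≤
          (ball x0 R).indicator (fun _ => ENNReal.ofReal (A * ε^((m:ℝ)⁻¹))) x := by
        intro x
        by_cases hx : x ∈ ball x0 (3*R/4)
        · have hx' : x ∈ ball x0 R := ball_subset_ball (by linarith) hx
          rw [indicator_of_mem hx']
          have hin : ∀ t ∈ Icc 0 T, x + t • v ∈ ball x0 R := by
            intro t ht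
            rw [mem_ball_iff_norm] at hx ⊢
            calc ‖x + t • v - x0‖ = ‖(x - x0) + t • v‖ := by congr 1; abel
              _ ≤ ‖x - x0‖ + ‖t • v‖ := norm_add_le _ _
              _ ≤ ‖x - x0‖ + T * ‖v‖ := by
                rw [norm_smul, Real.norm_eq_abs, abs_of_nonneg ht.1]; gcongr; exact ht.2
              _ < R := by linarith
          have := vdc_measure m hmpos (fun k t => dirD v f k (x + t • v)) 0 T
            (fun k _ t ht => dirD_hasDerivAt v f x t (hball _ (hin t ht)).1 k) c ε hcpos hε
            (fun t ht => (hball _ (hin t ht)).2.le)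
          refine (measure_mono ?_).trans (this.trans (le_of_eq ?_))
          · intro t ht
            exact ⟨ht.1, ht.2.2⟩
          · congr 1
            rw [hA, div_eq_mul_one_div ε c, Real.mul_rpow hε.le (by positivity)]; ring
        · have : Prod.mk x ⁻¹' Z = ∅ := by
            ext t
            simp only [hZ, mem_preimage, mem_ofPred_eq, mem_empty_iff_false, iff_false, not_and]
            intro ht hS'
            apply hx
            have h2 := hS'.1
            rw [mem_ball_iff_norm] at h2 ⊢
            calc ‖x - x0‖ = ‖(x + t • v - x0) - t • v‖ := by congr 1; abel
              _ ≤ ‖x + t • v - x0‖ + ‖t • v‖ := norm_sub_le _ _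
              _ ≤ ‖x + t • v - x0‖ + T * ‖v‖ := by
                rw [norm_smul t v, Real.norm_eq_abs, abs_of_nonneg ht.1]; gcongr; exact ht.2
              _ < _ := by linarith
          rw [this]; simp
      refine (lintegral_mono this).trans (le_of_eq ?_)
      rw [lintegral_indicator measurableSet_ball, setLIntegral_const, mul_comm]
    rw [e1] at e2
    have hT0 : ENNReal.ofReal T ≠ 0 := by simpa using hTpos
    have e3 : μ S ≤ μ (ball x0 R) * ENNReal.ofReal (A * ε^((m:ℝ)⁻¹)) / ENNReal.ofReal T := by
      rw [ENNReal.le_div_iff_mul_le (Or.inl hT0) (Or.inl ENNReal.ofReal_ne_top), mul_comm]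
      exact e2
    refine e3.trans (le_of_eq ?_)
    rw [← ENNReal.ofReal_toReal (measure_ball_lt_top (μ := μ) (x := x0) (r := R)).ne,
      ← ENNReal.ofReal_mul (by positivity), ← ENNReal.ofReal_div_of_pos hTpos,
      ENNReal.toReal_ofReal (by positivity)]
    congr 1; ring


abbrev X3 : Type := Vec2 × ℝ

instance X3_haar : (volume : Measure X3).IsAddHaarMeasure :=
  Measure.prod.instIsAddHaarMeasure _ _

lemma image_measure_le {V : Type*} [NormedAddCommGroup V] [NormedSpace ℝ V]
    [FiniteDimensional ℝ V] [MeasurableSpace V] [BorelSpace V] (μ : Measure V)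
    [μ.IsAddHaarMeasure] (f : V → V) (A : V →L[ℝ] V) (x0 : V) (hf : HasStrictFDerivAt f A x0) :
    ∃ N ∈ 𝓝 x0, ∃ C : ℝ≥0, ∀ S ⊆ N, μ (f '' S) ≤ C * μ S := by
  set m : ℝ≥0 := Real.toNNReal |A.det| + 1
  have hm : ENNReal.ofReal |A.det| < m := by
    rw [ENNReal.ofReal]; exact_mod_cast lt_add_one _
  have h := addHaar_image_le_mul_of_det_lt μ A hm
  obtain ⟨δ, hδ, hδpos⟩ := (h.and self_mem_nhdsWithin).exists
  obtain ⟨N, hN, happ⟩ := hf.approximates_deriv_on_nhds (Or.inr hδpos)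
  exact ⟨N, hN, m, fun S hS => hδ S f (happ.mono_set hS)⟩

lemma meas_version {V W : Type*} [NormedAddCommGroup V] [NormedSpace ℝ V] [MeasurableSpace V]
    [BorelSpace V] [NormedAddCommGroup W] [NormedSpace ℝ W] [MeasurableSpace W]
    [BorelSpace W] [CompleteSpace W] (f : V → W) (x0 : V) (hf : AnalyticAt ℝ f x0) :
    ∃ g : V → W, Measurable g ∧ g =ᶠ[𝓝 x0] f := by
  classical
  obtain ⟨r, hr, hball⟩ := Metric.eventually_nhds_iff_ball.1 hf.eventually_analyticAt
  refine ⟨(ball x0 r).piecewise f (fun _ => 0), ?_, ?_⟩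
  · apply ContinuousOn.measurable_piecewise
    · exact fun x hx => (hball x hx).continuousAt.continuousWithinAt
    · exact continuousOn_const
    · exact measurableSet_ball
  · filter_upwards [ball_mem_nhds x0 hr] with x hx
    exact piecewise_eq_of_mem _ _ _ hx

lemma exists_equiv_of_surj (L : X3 →L[ℝ] Vec2) (hL : Function.Surjective L) (w : X3) (hw0 : w ≠ 0)
    (hw : L w = 0) : ∃ (ℓ : X3 →L[ℝ] ℝ) (A : X3 ≃L[ℝ] X3), ℓ w = 1 ∧
      (A : X3 →L[ℝ] X3) = L.prod ℓ := by
  obtain ⟨ℓ, hℓ⟩ := SeparatingDual.exists_eq_one (R := ℝ) hw0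
  have hker : Module.finrank ℝ (LinearMap.ker (L : X3 →ₗ[ℝ] Vec2)) = 1 := by
    have h := LinearMap.finrank_range_add_finrank_ker (L : X3 →ₗ[ℝ] Vec2)
    rw [LinearMap.range_eq_top.2 hL] at h
    simp at h
    omega
  have hinj : Function.Injective (L.prod ℓ : X3 →ₗ[ℝ] X3) := by
    rw [← LinearMap.ker_eq_bot, LinearMap.ker_eq_bot']
    intro v hv
    have hv' : L v = 0 ∧ ℓ v = 0 := by simpa [Prod.ext_iff] using hv
    have hwk : w ∈ LinearMap.ker (L : X3 →ₗ[ℝ] Vec2) := hw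
    have hvk : v ∈ LinearMap.ker (L : X3 →ₗ[ℝ] Vec2) := hv'.1
    obtain ⟨c, hc⟩ := (finrank_eq_one_iff_of_nonzero' (⟨w, hwk⟩ : LinearMap.ker (L : X3 →ₗ[ℝ] Vec2))
      (by simpa [Subtype.ext_iff] using hw0)).1 hker ⟨v, hvk⟩
    have hc' : c • w = v := by simpa [Subtype.ext_iff] using hc
    have : c = 0 := by
      have h := hv'.2; rw [← hc', map_smul, hℓ] at h; simpa using h
    rw [← hc', this, zero_smul]
  refine ⟨ℓ, (LinearEquiv.ofInjectiveEndo _ hinj).toContinuousLinearEquiv, hℓ, ?_⟩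
  ext v <;> rfl

lemma coord (ps : X3) (Q : X3 → Vec2) (hQ : AnalyticAt ℝ Q ps)
    (hs : Function.Surjective (fderiv ℝ Q ps)) (w : X3) (hw0 : w ≠ 0)
    (hw : fderiv ℝ Q ps w = 0) :
    ∃ (G : X3 × ℝ → X3) (ℓ : X3 →L[ℝ] ℝ), Measurable G ∧ AnalyticAt ℝ G (ps, 0) ∧
      (∀ᶠ p in 𝓝 ps, G (p, 0) = p) ∧ (∀ᶠ z in 𝓝 (ps, (0:ℝ)), Q (G z) = Q z.1) ∧
      HasDerivAt (fun t => G (ps, t)) w 0 ∧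
      (∀ᶠ z in 𝓝 (ps, ps), Q z.1 = Q z.2 → z.2 = G (z.1, ℓ z.2 - ℓ z.1)) ∧
      (∀ ρ : ℝ, 0 < ρ → ∃ N ∈ 𝓝 ps, ∃ C : ℝ≥0, ∀ S ⊆ N, MeasurableSet S → ∀ θ : ℝ≥0∞,
        volume {p | p ∈ S ∧ volume {t : ℝ | |t| < ρ ∧ G (p, t) ∈ S} < θ} ≤ C * θ) := by
  obtain ⟨ℓ, A, hℓ, hA⟩ := exists_equiv_of_surj _ hs w hw0 hw
  set Ψ : X3 → X3 := fun p => (Q p, ℓ p) with hΨ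
  have hΨan : AnalyticAt ℝ Ψ ps := hQ.prod (ℓ.analyticAt ps)
  have hΨd : HasStrictFDerivAt Ψ (A : X3 →L[ℝ] X3) ps := by
    rw [hA]; exact hQ.hasStrictFDerivAt.prodMk ℓ.hasStrictFDerivAt
  set e := hΨd.toOpenPartialHomeomorph with he
  have hecoe : ⇑e = Ψ := hΨd.toOpenPartialHomeomorph_coe
  have hsrc : ps ∈ e.source := hΨd.mem_toOpenPartialHomeomorph_source
  have hχan : AnalyticAt ℝ e.symm (Ψ ps) := by
    have := e.analyticAt_symm' hsrc (by rw [hecoe]; exact hΨan) (i := A)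
      (by rw [hecoe]; exact hΨd.hasFDerivAt.fderiv)
    rwa [hecoe] at this
  have hχd : HasStrictFDerivAt e.symm (A.symm : X3 →L[ℝ] X3) (Ψ ps) := hΨd.to_localInverse
  have hleft : ∀ᶠ p in 𝓝 ps, e.symm (Ψ p) = p := by
    have := e.eventually_left_inverse hsrc; rwa [hecoe] at this
  have hright : ∀ᶠ q in 𝓝 (Ψ ps), Ψ (e.symm q) = q := by
    have h := e.eventually_right_inverse (x := Ψ ps) (by rw [← hecoe]; exact e.map_source hsrc)
    rwa [hecoe] at h
  set H : X3 × ℝ → X3 := fun z => Ψ z.1 + ((0:Vec2), z.2) with hH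
  have hHan : AnalyticAt ℝ H (ps, 0) := by
    apply AnalyticAt.add
    · exact AnalyticAt.fun_comp (g := Ψ) (f := Prod.fst) hΨan analyticAt_fst
    · exact analyticAt_const.prod analyticAt_snd
  have hH0 : H (ps, 0) = Ψ ps := by simp [hH]
  set G0 : X3 × ℝ → X3 := fun z => e.symm (H z) with hG0
  have hG0an : AnalyticAt ℝ G0 (ps, 0) := by
    apply AnalyticAt.fun_comp (g := e.symm) (f := H) _ hHan
    rw [hH0]; exact hχan
  have hG0ps : G0 (ps, 0) = ps := by
    simp only [hG0, hH0]; exact hleft.self_of_nhds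
  obtain ⟨G, hGm, hGeq⟩ := meas_version G0 (ps, 0) hG0an
  have hHt : Tendsto H (𝓝 (ps, 0)) (𝓝 (Ψ ps)) := by
    have := hHan.continuousAt.tendsto; rwa [hH0] at this
  refine ⟨G, ℓ, hGm, hG0an.congr hGeq.symm, ?_, ?_, ?_, ?_, ?_⟩
  · have h1 : Tendsto (fun p : X3 => (p, (0:ℝ))) (𝓝 ps) (𝓝 (ps, 0)) :=
      (Continuous.prodMk_left 0).tendsto ps
    filter_upwards [h1.eventually hGeq, hleft] with p h2 h3
    rw [h2]; simp only [hG0, hH]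
    rw [← Prod.zero_eq_mk, add_zero, h3]
  · filter_upwards [hGeq, hHt.eventually hright] with z h1 h2
    rw [h1]; simp only [hG0]
    have := congrArg Prod.fst h2
    simpa [hΨ, hH] using this
  · have h1 : HasDerivAt (fun t : ℝ => G0 (ps, t)) w 0 := by
      have h2 : HasDerivAt (fun t : ℝ => H (ps, t)) ((0:Vec2), (1:ℝ)) 0 := by
        simp only [hH]
        apply HasDerivAt.const_add
        exact (hasDerivAt_const (0:ℝ) (0:Vec2)).prodMk (hasDerivAt_id (0:ℝ))
      have h3 : HasFDerivAt e.symm (A.symm : X3 →L[ℝ] X3) (H (ps, 0)) := by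
        rw [hH0]; exact hχd.hasFDerivAt
      have h4 := h3.comp_hasDerivAt (0:ℝ) h2
      have h5 : A.symm ((0:Vec2), (1:ℝ)) = w := by
        rw [ContinuousLinearEquiv.symm_apply_eq]
        have : A w = (A : X3 →L[ℝ] X3) w := rfl
        rw [this, hA]; simp [hw, hℓ]
      have h6 : (A.symm : X3 →L[ℝ] X3) ((0:Vec2), (1:ℝ)) = w := h5
      rw [h6] at h4
      exact h4
    have h7 : Tendsto (fun t : ℝ => (ps, t)) (𝓝 0) (𝓝 (ps, 0)) :=
      (Continuous.prodMk_right ps).tendsto 0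
    exact h1.congr_of_eventuallyEq (h7.eventually hGeq)
  · have h1 : Tendsto (fun z : X3 × X3 => (z.1, ℓ z.2 - ℓ z.1)) (𝓝 (ps, ps)) (𝓝 (ps, 0)) := by
      have : Continuous fun z : X3 × X3 => (z.1, ℓ z.2 - ℓ z.1) := by fun_prop
      simpa using this.tendsto (ps, ps)
    have h2 : Tendsto (fun z : X3 × X3 => z.2) (𝓝 (ps, ps)) (𝓝 ps) :=
      continuous_snd.tendsto (ps, ps)
    filter_upwards [h1.eventually hGeq, h2.eventually hleft] with z h3 h4 h5
    rw [h3]; simp only [hG0, hH, hΨ]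
    rw [Prod.mk_add_mk, add_zero, add_sub_cancel, h5]
    exact h4.symm
  · intro ρ hρ
    obtain ⟨Nχ, hNχ, Cχ, hCχ⟩ := image_measure_le volume e.symm _ _ hχd
    obtain ⟨N1, hN1, N2, hN2, hprod⟩ := mem_nhds_prod_iff.1 hGeq
    obtain ⟨ρ1, hρ1, hball⟩ := Metric.mem_nhds_iff.1 hN2
    set ρ2 := min ρ ρ1 with hρ2
    have hrho_pos : 0 < ρ2 := lt_min hρ hρ1
    have c1 : ∀ᶠ p in 𝓝 ps, |ℓ p - ℓ ps| < ρ2/2 := by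
      have : Continuous fun p => |ℓ p - ℓ ps| := by fun_prop
      exact this.continuousAt.eventually_lt_const (by simpa using hrho_pos)
    have c2 : ∀ᶠ p in 𝓝 ps, Q p ∈ ball (Q ps) 1 :=
      hQ.continuousAt.eventually (ball_mem_nhds _ one_pos)
    have c3 : ∀ᶠ p in 𝓝 ps, Ψ p ∈ Nχ := hΨan.continuousAt.eventually hNχ
    have c4 : ∀ᶠ p in 𝓝 ps, p ∈ e.source := e.open_source.mem_nhds hsrc
    refine ⟨{p | (|ℓ p - ℓ ps| < ρ2/2 ∧ Q p ∈ ball (Q ps) 1) ∧ (Ψ p ∈ Nχ ∧ p ∈ e.source) ∧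
      p ∈ N1}, ((c1.and c2).and ((c3.and c4).and hN1)), Cχ * (volume (ball (Q ps) 1)).toNNReal,
      fun S hSN hSm θ => ?_⟩
    have hSsrc : S ⊆ e.source := fun p hp => (hSN hp).2.1.2
    set T : Set X3 := Ψ '' S with hT
    have hTm : MeasurableSet T := by
      rw [hT, ← hecoe]
      exact hSm.image_of_continuousOn_injOn (e.continuousOn.mono hSsrc) (e.injOn.mono hSsrc)
    set Tb : Set X3 := {q | q ∈ T ∧ volume (Prod.mk q.1 ⁻¹' T) < θ} with hTb
    have hTbm : MeasurableSet Tb := by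
      apply hTm.inter
      have : Measurable fun q : X3 => volume (Prod.mk q.1 ⁻¹' T) :=
        (measurable_measure_prodMk_left hTm).comp measurable_fst
      exact this measurableSet_Iio
    have hTbvol : volume Tb ≤ volume (ball (Q ps) 1) * θ := by
      rw [Measure.volume_eq_prod, Measure.prod_apply hTbm]
      have : ∀ y : Vec2, volume (Prod.mk y ⁻¹' Tb) ≤ (ball (Q ps) 1).indicator (fun _ => θ) y := by
        intro y
        by_cases hy : y ∈ ball (Q ps) 1
        · rw [indicator_of_mem hy]
          by_cases hv : volume (Prod.mk y ⁻¹' T) < θ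
          · exact (measure_mono fun z hz => hz.1).trans hv.le
          · have : Prod.mk y ⁻¹' Tb = ∅ := by
              ext z; simp only [mem_preimage, mem_empty_iff_false, iff_false]
              intro h; exact hv h.2
            rw [this]; simp
        · have : Prod.mk y ⁻¹' Tb = ∅ := by
            ext z; simp only [mem_preimage, mem_empty_iff_false, iff_false]
            rintro ⟨⟨p, hp, hpe⟩, _⟩
            apply hy
            have := (hSN hp).1.2
            rw [show y = Q p from (congrArg Prod.fst hpe).symm]; exact this
          rw [this]; simp
      refine (lintegral_mono this).trans (le_of_eq ?_)
      rw [lintegral_indicator measurableSet_ball, setLIntegral_const, mul_comm]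
    have hTbN : Tb ⊆ Nχ := by
      rintro q ⟨⟨p, hp, rfl⟩, _⟩; exact (hSN hp).2.1.1
    have hsub : {p | p ∈ S ∧ volume {t : ℝ | |t| < ρ ∧ G (p, t) ∈ S} < θ} ⊆ e.symm '' Tb := by
      rintro p ⟨hp, hpv⟩
      refine ⟨Ψ p, ⟨⟨p, hp, rfl⟩, lt_of_le_of_lt ?_ hpv⟩, ?_⟩
      · have : (Prod.mk (Ψ p).1 ⁻¹' T) ⊆
            (fun z => z + (-ℓ p)) ⁻¹' {t : ℝ | |t| < ρ ∧ G (p, t) ∈ S} := by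
          rintro z ⟨p', hp', hpe⟩
          have hQ' : Q p' = Q p := congrArg Prod.fst hpe
          have hz : ℓ p' = z := congrArg Prod.snd hpe
          have a1 := (hSN hp).1.1
          have a2 := (hSN hp').1.1
          have a3 : |z + (-ℓ p)| < ρ2 := by
            rw [← hz]; rw [abs_lt] at *; constructor <;> linarith
          refine ⟨a3.trans_le (min_le_left _ _), ?_⟩
          have a4 : G (p, z + (-ℓ p)) = G0 (p, z + (-ℓ p)) := by
            apply hprod
            refine ⟨(hSN hp).2.2, hball ?_⟩
            simp only [mem_ball, dist_zero_right, Real.norm_eq_abs]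
            exact a3.trans_le (min_le_right _ _)
          rw [a4]; simp only [hG0, hH, hΨ]
          rw [Prod.mk_add_mk, add_zero, ← hz, show ℓ p + (ℓ p' + -ℓ p) = ℓ p' by ring, ← hQ']
          have : e.symm (Ψ p') = p' := by
            rw [← hecoe]; exact e.left_inv (hSsrc hp')
          rw [show ((Q p', ℓ p') : X3) = Ψ p' from rfl, this]; exact hp'
        refine (measure_mono this).trans (le_of_eq ?_)
        rw [measure_preimage_add_right]
      · rw [← hecoe]; exact e.left_inv (hSsrc hp)
    calc _ ≤ _ := measure_mono hsub
      _ ≤ Cχ * volume Tb := hCχ Tb hTbN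
      _ ≤ Cχ * (volume (ball (Q ps) 1) * θ) := by gcongr
      _ = _ := by
        rw [ENNReal.coe_mul, ENNReal.coe_toNNReal measure_ball_lt_top.ne, mul_assoc]


lemma meas_abs_lt {α : Type*} [MeasurableSpace α] (g : α → ℝ) (hg : Measurable g) (ρ : ℝ) :
    MeasurableSet {a | |g a| < ρ} :=
  measurableSet_lt (by fun_prop) measurable_const

lemma slice_lower {α β : Type*} [MeasurableSpace α] [MeasurableSpace β] (μ : Measure α)
    (ν : Measure β) [SFinite ν] (B : Set α) (hB : MeasurableSet B) (Z : Set (α × β))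
    (hZ : MeasurableSet Z) (θ : ℝ≥0∞) (h : ∀ a ∈ B, θ ≤ ν (Prod.mk a ⁻¹' Z)) :
    θ * μ B ≤ (μ.prod ν) Z := by
  rw [Measure.prod_apply hZ]
  calc θ * μ B = ∫⁻ a in B, θ ∂μ := by rw [setLIntegral_const]
    _ ≤ ∫⁻ a in B, ν (Prod.mk a ⁻¹' Z) ∂μ := setLIntegral_mono' hB h
    _ ≤ _ := setLIntegral_le_lintegral _ _

/-- measurability of the good set -/
lemma meas_slice (G : X3 × ℝ → X3) (hG : Measurable G) (S : Set X3) (hS : MeasurableSet S) (ρ : ℝ) :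
    Measurable fun p => volume {t : ℝ | |t| < ρ ∧ G (p, t) ∈ S} := by
  have : MeasurableSet {z : X3 × ℝ | |z.2| < ρ ∧ G z ∈ S} := by
    apply MeasurableSet.inter
    · exact meas_abs_lt (fun z : X3 × ℝ => z.2) (by fun_prop) ρ
    · exact hG hS
  exact measurable_measure_prodMk_left this

lemma count1 (G : X3 × ℝ → X3) (hG : Measurable G) (ρ : ℝ) (C : ℝ≥0) (S : Set X3)
    (hS : MeasurableSet S)
    (h : ∀ θ : ℝ≥0∞, volume {p | p ∈ S ∧ volume {t : ℝ | |t| < ρ ∧ G (p, t) ∈ S} < θ} ≤ C * θ)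
    (θ : ℝ≥0∞) :
    θ * volume S ≤ C * θ ^ 2 + volume {z : X3 × ℝ | z.1 ∈ S ∧ |z.2| < ρ ∧ G z ∈ S} := by
  have hm := meas_slice G hG S hS ρ
  set S1 := {p | p ∈ S ∧ θ ≤ volume {t : ℝ | |t| < ρ ∧ G (p, t) ∈ S}} with hS1
  have hS1m : MeasurableSet S1 := hS.inter (hm measurableSet_Ici)
  have h1 : volume S ≤ C * θ + volume S1 := by
    calc volume S ≤ volume ({p | p ∈ S ∧ volume {t : ℝ | |t| < ρ ∧ G (p, t) ∈ S} < θ} ∪ S1) := by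
          apply measure_mono
          intro p hp
          rcases lt_or_ge (volume {t : ℝ | |t| < ρ ∧ G (p, t) ∈ S}) θ with h | h
          · exact Or.inl ⟨hp, h⟩
          · exact Or.inr ⟨hp, h⟩
      _ ≤ _ := (measure_union_le _ _).trans (by gcongr; exact h θ)
  have hZ : MeasurableSet {z : X3 × ℝ | z.1 ∈ S ∧ |z.2| < ρ ∧ G z ∈ S} := by
    apply MeasurableSet.inter (measurable_fst hS)
    apply MeasurableSet.inter
    · exact meas_abs_lt (fun z : X3 × ℝ => z.2) (by fun_prop) ρ
    · exact hG hS
  have h2 : θ * volume S1 ≤ volume {z : X3 × ℝ | z.1 ∈ S ∧ |z.2| < ρ ∧ G z ∈ S} := by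
    rw [Measure.volume_eq_prod]
    apply slice_lower _ _ _ hS1m _ hZ
    intro a ha
    refine ha.2.trans (measure_mono ?_)
    intro t ht; exact ⟨ha.1, ht⟩
  calc θ * volume S ≤ θ * (C * θ + volume S1) := by gcongr
    _ = C * θ ^ 2 + θ * volume S1 := by ring
    _ ≤ _ := by gcongr

lemma path_count (G : Fin 3 → X3 × ℝ → X3) (hG : ∀ j, Measurable (G j)) (ρ : ℝ) (C : ℝ≥0)
    (E : Set X3) (hE : MeasurableSet E)
    (h : ∀ j, ∀ S ⊆ E, MeasurableSet S → ∀ θ : ℝ≥0∞,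
      volume {p | p ∈ S ∧ volume {t : ℝ | |t| < ρ ∧ G j (p, t) ∈ S} < θ} ≤ C * θ)
    (θ : ℝ≥0∞) :
    θ ^ 3 * volume E ≤ 3 * C * θ ^ 4 + volume {z : X3 × X3 | z.1 ∈ E ∧
      (|z.2.1.1| < ρ ∧ |z.2.1.2| < ρ ∧ |z.2.2| < ρ) ∧ G 0 (z.1, z.2.1.1) ∈ E ∧
      G 1 (G 0 (z.1, z.2.1.1), z.2.1.2) ∈ E ∧
      G 2 (G 1 (G 0 (z.1, z.2.1.1), z.2.1.2), z.2.2) ∈ E} := by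
  have step : ∀ j, ∀ S ⊆ E, MeasurableSet S →
      ∃ S1 ⊆ S, MeasurableSet S1 ∧ volume S ≤ C * θ + volume S1 ∧
        ∀ p ∈ S1, θ ≤ volume {t : ℝ | |t| < ρ ∧ G j (p, t) ∈ S} := by
    intro j S hSE hS
    refine ⟨{p | p ∈ S ∧ θ ≤ volume {t : ℝ | |t| < ρ ∧ G j (p, t) ∈ S}}, fun p hp => hp.1,
      hS.inter (meas_slice (G j) (hG j) S hS ρ measurableSet_Ici), ?_, fun p hp => hp.2⟩
    calc volume S ≤ volume ({p | p ∈ S ∧ volume {t : ℝ | |t| < ρ ∧ G j (p, t) ∈ S} < θ} ∪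
          {p | p ∈ S ∧ θ ≤ volume {t : ℝ | |t| < ρ ∧ G j (p, t) ∈ S}}) := by
          apply measure_mono
          intro p hp
          rcases lt_or_ge (volume {t : ℝ | |t| < ρ ∧ G j (p, t) ∈ S}) θ with h | h
          · exact Or.inl ⟨hp, h⟩
          · exact Or.inr ⟨hp, h⟩
      _ ≤ _ := (measure_union_le _ _).trans (by gcongr; exact h j S hSE hS θ)
  obtain ⟨E2, hE2s, hE2m, hE2v, hE2⟩ := step 2 E subset_rfl hE
  obtain ⟨E1, hE1s, hE1m, hE1v, hE1⟩ := step 1 E2 hE2s hE2m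
  obtain ⟨E0, hE0s, hE0m, hE0v, hE0⟩ := step 0 E1 (hE1s.trans hE2s) hE1m
  have hG0 := hG 0
  have hG1 := hG 1
  have hG2 := hG 2
  have key : ∀ p0 ∈ E0, θ ^ 3 ≤ volume {t : X3 | (|t.1.1| < ρ ∧ G 0 (p0, t.1.1) ∈ E1) ∧
      (|t.1.2| < ρ ∧ G 1 (G 0 (p0, t.1.1), t.1.2) ∈ E2) ∧ |t.2| < ρ ∧
      G 2 (G 1 (G 0 (p0, t.1.1), t.1.2), t.2) ∈ E} := by
    intro p0 hp0
    set Z0 := {t : ℝ | |t| < ρ ∧ G 0 (p0, t) ∈ E1} with hZ0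
    have mZ0 : MeasurableSet Z0 := by
      apply MeasurableSet.inter
      · exact meas_abs_lt (fun t : ℝ => t) (by fun_prop) ρ
      · exact (show Measurable fun t => G 0 (p0, t) by fun_prop) hE1m
    set Z1 := {t : ℝ × ℝ | (|t.1| < ρ ∧ G 0 (p0, t.1) ∈ E1) ∧
      (|t.2| < ρ ∧ G 1 (G 0 (p0, t.1), t.2) ∈ E2)} with hZ1
    have mZ1 : MeasurableSet Z1 := by
      apply MeasurableSet.inter (measurable_fst mZ0)
      apply MeasurableSet.inter
      · exact meas_abs_lt (fun t : ℝ × ℝ => t.2) (by fun_prop) ρ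
      · exact (show Measurable fun t : ℝ × ℝ => G 1 (G 0 (p0, t.1), t.2) by fun_prop) hE2m
    set Z2 := {t : X3 | (|t.1.1| < ρ ∧ G 0 (p0, t.1.1) ∈ E1) ∧
      (|t.1.2| < ρ ∧ G 1 (G 0 (p0, t.1.1), t.1.2) ∈ E2) ∧ |t.2| < ρ ∧
      G 2 (G 1 (G 0 (p0, t.1.1), t.1.2), t.2) ∈ E} with hZ2
    have mZ2 : MeasurableSet Z2 := by
      have : Z2 = (Prod.fst ⁻¹' Z1) ∩ ({t : X3 | |t.2| < ρ} ∩
          (fun t : X3 => G 2 (G 1 (G 0 (p0, t.1.1), t.1.2), t.2)) ⁻¹' E) := by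
        ext t; simp only [hZ2, hZ1, mem_ofPred_eq, mem_inter_iff, mem_preimage]; tauto
      rw [this]
      apply MeasurableSet.inter (measurable_fst mZ1)
      apply MeasurableSet.inter
      · exact meas_abs_lt (fun t : X3 => t.2) (by fun_prop) ρ
      · exact (show Measurable fun t : X3 => G 2 (G 1 (G 0 (p0, t.1.1), t.1.2), t.2) by
          fun_prop) hE
    have a0 : θ ≤ volume Z0 := hE0 p0 hp0
    have a1 : θ * volume Z0 ≤ volume Z1 := by
      rw [Measure.volume_eq_prod]
      refine slice_lower _ _ _ mZ0 _ mZ1 θ ?_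
      intro t0 ht0
      refine (hE1 _ ht0.2).trans (measure_mono ?_)
      intro t1 ht1; exact ⟨ht0, ht1⟩
    have a2 : θ * volume Z1 ≤ volume Z2 := by
      rw [Measure.volume_eq_prod Vec2 ℝ]
      refine slice_lower _ _ _ mZ1 _ mZ2 θ ?_
      intro t1 ht1
      refine (hE2 _ ht1.2.2).trans (measure_mono ?_)
      intro t2 ht2; exact ⟨ht1.1, ht1.2, ht2⟩
    calc θ ^ 3 = θ * (θ * θ) := by ring
      _ ≤ θ * (θ * volume Z0) := by gcongr
      _ ≤ θ * volume Z1 := by gcongr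
      _ ≤ _ := a2
  have hfin : θ ^ 3 * volume E0 ≤ volume {z : X3 × X3 | z.1 ∈ E ∧
      (|z.2.1.1| < ρ ∧ |z.2.1.2| < ρ ∧ |z.2.2| < ρ) ∧ G 0 (z.1, z.2.1.1) ∈ E ∧
      G 1 (G 0 (z.1, z.2.1.1), z.2.1.2) ∈ E ∧
      G 2 (G 1 (G 0 (z.1, z.2.1.1), z.2.1.2), z.2.2) ∈ E} := by
    rw [Measure.volume_eq_prod X3 X3]
    refine slice_lower _ _ _ hE0m _ ?_ _ ?_
    · apply MeasurableSet.inter (measurable_fst hE)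
      apply MeasurableSet.inter
      · apply MeasurableSet.inter
        · exact meas_abs_lt (fun z : X3 × X3 => z.2.1.1) (by fun_prop) ρ
        apply MeasurableSet.inter
        · exact meas_abs_lt (fun z : X3 × X3 => z.2.1.2) (by fun_prop) ρ
        · exact meas_abs_lt (fun z : X3 × X3 => z.2.2) (by fun_prop) ρ
      apply MeasurableSet.inter
      · exact (show Measurable fun z : X3 × X3 => G 0 (z.1, z.2.1.1) by fun_prop) hE
      apply MeasurableSet.inter
      · exact (show Measurable fun z : X3 × X3 => G 1 (G 0 (z.1, z.2.1.1), z.2.1.2) by fun_prop) hE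
      · exact (show Measurable fun z : X3 × X3 =>
          G 2 (G 1 (G 0 (z.1, z.2.1.1), z.2.1.2), z.2.2) by fun_prop) hE
    · intro p0 hp0
      refine (key p0 hp0).trans (measure_mono ?_)
      rintro t ⟨⟨b1, b2⟩, ⟨b3, b4⟩, b5, b6⟩
      exact ⟨hE2s (hE1s (hE0s hp0)), ⟨b1, b3, b5⟩, hE2s (hE1s b2), hE2s b4, b6⟩
  calc θ ^ 3 * volume E ≤ θ ^ 3 * (C * θ + (C * θ + (C * θ + volume E0))) := by
        gcongr
        exact hE2v.trans (by gcongr; exact hE1v.trans (by gcongr))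
    _ = 3 * C * θ ^ 4 + θ ^ 3 * volume E0 := by ring
    _ ≤ _ := by gcongr


instance X33_haar : (volume : Measure (X3 × X3)).IsAddHaarMeasure :=
  Measure.prod.instIsAddHaarMeasure _ _

instance X31_haar : (volume : Measure (X3 × ℝ)).IsAddHaarMeasure :=
  Measure.prod.instIsAddHaarMeasure _ _

instance X331_haar : (volume : Measure (X3 × (X3 × ℝ))).IsAddHaarMeasure :=
  Measure.prod.instIsAddHaarMeasure _ _

lemma paths (ps : X3) (Q : Fin 3 → X3 → Vec2) (w : Fin 3 → X3) (hli : LinearIndependent ℝ w)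
    (G : Fin 3 → X3 × ℝ → X3) (hGm : ∀ j, Measurable (G j))
    (hGan : ∀ j, AnalyticAt ℝ (G j) (ps, 0)) (hG0 : ∀ j, ∀ᶠ p in 𝓝 ps, G j (p, 0) = p)
    (hGQ : ∀ j, ∀ᶠ z in 𝓝 (ps, (0:ℝ)), Q j (G j z) = Q j z.1)
    (hGd : ∀ j, HasDerivAt (fun t => G j (ps, t)) (w j) 0)
    (hcount : ∀ j, ∀ ρ : ℝ, 0 < ρ → ∃ N ∈ 𝓝 ps, ∃ C : ℝ≥0, ∀ S ⊆ N, MeasurableSet S →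
      ∀ θ : ℝ≥0∞, volume {p | p ∈ S ∧ volume {t : ℝ | |t| < ρ ∧ G j (p, t) ∈ S} < θ} ≤ C * θ) :
    ∃ q1 q2 : X3 × X3 → X3, Measurable q1 ∧ Measurable q2 ∧ AnalyticAt ℝ q1 (ps, ps) ∧
      AnalyticAt ℝ q2 (ps, ps) ∧ (∀ᶠ p in 𝓝 ps, q1 (p, p) = p ∧ q2 (p, p) = p) ∧
      (∀ᶠ z in 𝓝 (ps, ps), Q 0 (q1 z) = Q 0 z.1 ∧ Q 1 (q2 z) = Q 1 (q1 z) ∧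
        Q 2 z.2 = Q 2 (q2 z)) ∧
      ∃ N ∈ 𝓝 ps, ∃ C : ℝ≥0, ∀ E ⊆ N, MeasurableSet E → ∀ θ : ℝ≥0∞,
        θ ^ 3 * volume E ≤ C * θ ^ 4 +
          C * volume {z : X3 × X3 | z.1 ∈ E ∧ q1 z ∈ E ∧ q2 z ∈ E ∧ z.2 ∈ E} := by
  have hps0 : ∀ j, G j (ps, 0) = ps := fun j => (hG0 j).self_of_nhds
  set Y1 : X3 × X3 → X3 := fun z => G 0 (z.1, z.2.1.1) with hY1
  set Y2 : X3 × X3 → X3 := fun z => G 1 (Y1 z, z.2.1.2) with hY2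
  set Y3 : X3 × X3 → X3 := fun z => G 2 (Y2 z, z.2.2) with hY3
  have mY1 : Measurable Y1 := by have := hGm 0; fun_prop
  have mY2 : Measurable Y2 := by have := hGm 1; fun_prop
  have eY1 : Y1 (ps, 0) = ps := hps0 0
  have eY2 : Y2 (ps, 0) = ps := by simp only [hY2]; rw [eY1]; exact hps0 1
  have eY3 : Y3 (ps, 0) = ps := by simp only [hY3]; rw [eY2]; exact hps0 2
  have a11 : AnalyticAt ℝ (fun z : X3 × X3 => z.2.1.1) (ps, 0) :=
    analyticAt_fst.fun_comp (analyticAt_fst.fun_comp analyticAt_snd)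
  have a12 : AnalyticAt ℝ (fun z : X3 × X3 => z.2.1.2) (ps, 0) :=
    analyticAt_snd.fun_comp (analyticAt_fst.fun_comp analyticAt_snd)
  have a13 : AnalyticAt ℝ (fun z : X3 × X3 => z.2.2) (ps, 0) :=
    analyticAt_snd.fun_comp analyticAt_snd
  have i1 : AnalyticAt ℝ (fun z : X3 × X3 => (z.1, z.2.1.1)) (ps, 0) := analyticAt_fst.prod a11
  have aY1 : AnalyticAt ℝ Y1 (ps, 0) := AnalyticAt.fun_comp (g := G 0) (hGan 0) i1
  have i2 : AnalyticAt ℝ (fun z : X3 × X3 => (Y1 z, z.2.1.2)) (ps, 0) := aY1.prod a12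
  have aY2 : AnalyticAt ℝ Y2 (ps, 0) := by
    apply AnalyticAt.fun_comp (g := G 1) _ i2
    rw [eY1]; exact hGan 1
  have i3 : AnalyticAt ℝ (fun z : X3 × X3 => (Y2 z, z.2.2)) (ps, 0) := aY2.prod a13
  have aY3 : AnalyticAt ℝ Y3 (ps, 0) := by
    apply AnalyticAt.fun_comp (g := G 2) _ i3
    rw [eY2]; exact hGan 2
  have ti1 : Tendsto (fun z : X3 × X3 => (z.1, z.2.1.1)) (𝓝 (ps, 0)) (𝓝 (ps, 0)) :=
    i1.continuousAt.tendsto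
  have ti2 : Tendsto (fun z : X3 × X3 => (Y1 z, z.2.1.2)) (𝓝 (ps, 0)) (𝓝 (ps, 0)) := by
    have := i2.continuousAt.tendsto; rw [eY1] at this; exact this
  have ti3 : Tendsto (fun z : X3 × X3 => (Y2 z, z.2.2)) (𝓝 (ps, 0)) (𝓝 (ps, 0)) := by
    have := i3.continuousAt.tendsto; rw [eY2] at this; exact this
  -- derivative
  set T' := fderiv ℝ Y3 (ps, 0) with hT'
  have hT : HasStrictFDerivAt Y3 T' (ps, 0) := aY3.hasStrictFDerivAt
  have dline : ∀ (e : X3) (v : X3), HasDerivAt (fun s : ℝ => Y3 (ps, s • e)) v 0 →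
      T' (0, e) = v := by
    intro e v hv
    have h1 : HasDerivAt (fun s : ℝ => ((ps, s • e) : X3 × X3)) (0, e) 0 := by
      have := (hasDerivAt_const (0:ℝ) ps).prodMk ((hasDerivAt_id (0:ℝ)).smul_const e)
      simpa using this
    have h2 : HasFDerivAt Y3 T' (ps, (0:ℝ) • e) := by rw [zero_smul]; exact hT.hasFDerivAt
    have h3 := h2.comp_hasDerivAt (0:ℝ) h1
    exact HasDerivAt.unique h3 hv
  have tG : ∀ j, Tendsto (fun t : ℝ => G j (ps, t)) (𝓝 0) (𝓝 ps) := by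
    intro j
    have := (hGd j).continuousAt.tendsto; rwa [hps0 j] at this
  have d0 : T' (0, ((1, 0), 0)) = w 0 := by
    apply dline
    apply (hGd 0).congr_of_eventuallyEq
    filter_upwards [(tG 0).eventually (hG0 1), (tG 0).eventually (hG0 2)] with t h1 h2
    simp only [hY3, hY2, hY1, Prod.smul_mk, smul_eq_mul, mul_one, mul_zero]
    rw [h1, h2]
  have d1 : T' (0, ((0, 1), 0)) = w 1 := by
    apply dline
    apply (hGd 1).congr_of_eventuallyEq
    filter_upwards [(tG 1).eventually (hG0 2)] with t h2
    simp only [hY3, hY2, hY1, Prod.smul_mk, smul_eq_mul, mul_one, mul_zero]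
    rw [hps0, h2]
  have d2 : T' (0, ((0, 0), 1)) = w 2 := by
    apply dline
    apply (hGd 2).congr_of_eventuallyEq
    filter_upwards with t
    simp only [hY3, hY2, hY1, Prod.smul_mk, smul_eq_mul, mul_one, mul_zero]
    rw [hps0, hps0]
  have hinj : Function.Injective ((ContinuousLinearMap.fst ℝ X3 X3).prod T' :
      X3 × X3 →ₗ[ℝ] X3 × X3) := by
    rw [← LinearMap.ker_eq_bot, LinearMap.ker_eq_bot']
    rintro ⟨u, ⟨t0, t1⟩, t2⟩ hv
    have hv' : u = 0 ∧ T' (u, ((t0, t1), t2)) = 0 := by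
      simpa only [ContinuousLinearMap.coe_coe, ContinuousLinearMap.prod_apply,
        ContinuousLinearMap.coe_fst', Prod.mk_eq_zero] using hv
    obtain ⟨rfl, h0⟩ := hv'
    have h1 : ((0:X3), (((t0, t1), t2) : X3)) = t0 • ((0:X3), (((1, 0), 0) : X3)) +
        t1 • ((0:X3), (((0, 1), 0) : X3)) + t2 • ((0:X3), (((0, 0), 1) : X3)) := by
      simp
    rw [h1, map_add, map_add, map_smul, map_smul, map_smul, d0, d1, d2] at h0
    have h2 := Fintype.linearIndependent_iff.1 hli ![t0, t1, t2] (by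
      simpa [Fin.sum_univ_three] using h0)
    have e0 := h2 0
    have e1 := h2 1
    have e2 := h2 2
    simp only [Matrix.cons_val] at e0 e1 e2
    subst e0 e1 e2; rfl
  set A : (X3 × X3) ≃L[ℝ] (X3 × X3) :=
    (LinearEquiv.ofInjectiveEndo _ hinj).toContinuousLinearEquiv with hAdef
  have hA : (A : X3 × X3 →L[ℝ] X3 × X3) = (ContinuousLinearMap.fst ℝ X3 X3).prod T' := by
    ext <;> rfl
  set R : X3 × X3 → X3 × X3 := fun z => (z.1, Y3 z) with hR
  have hRan : AnalyticAt ℝ R (ps, 0) := analyticAt_fst.prod aY3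
  have hRd : HasStrictFDerivAt R (A : X3 × X3 →L[ℝ] X3 × X3) (ps, 0) := by
    rw [hA]; exact hasStrictFDerivAt_fst.prodMk hT
  have eR : R (ps, 0) = (ps, ps) := by simp only [hR]; rw [eY3]
  set e := hRd.toOpenPartialHomeomorph with he
  have hecoe : ⇑e = R := hRd.toOpenPartialHomeomorph_coe
  have hsrc : (ps, (0:X3)) ∈ e.source := hRd.mem_toOpenPartialHomeomorph_source
  have hχan : AnalyticAt ℝ e.symm (ps, ps) := by
    have := e.analyticAt_symm' hsrc (by rw [hecoe]; exact hRan) (i := A)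
      (by rw [hecoe]; exact hRd.hasFDerivAt.fderiv)
    rwa [hecoe, eR] at this
  have hχd : HasStrictFDerivAt e.symm (A.symm : X3 × X3 →L[ℝ] X3 × X3) (ps, ps) := by
    have := hRd.to_localInverse; rwa [eR] at this
  have hleft : ∀ᶠ p in 𝓝 (ps, (0:X3)), e.symm (R p) = p := by
    have := e.eventually_left_inverse hsrc; rwa [hecoe] at this
  have hright : ∀ᶠ q in 𝓝 (ps, ps), R (e.symm q) = q := by
    have h := e.eventually_right_inverse (x := R (ps, 0))
      (by rw [← hecoe]; exact e.map_source hsrc)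
    rwa [hecoe, eR] at h
  have hRt : Tendsto R (𝓝 (ps, 0)) (𝓝 (ps, ps)) := by
    have := hRan.continuousAt.tendsto; rwa [eR] at this
  have eS : e.symm (ps, ps) = (ps, 0) := by
    have := hleft.self_of_nhds; rwa [eR] at this
  obtain ⟨ι, mι, hι⟩ := meas_version e.symm (ps, ps) hχan
  have aι : AnalyticAt ℝ ι (ps, ps) := hχan.congr hι.symm
  have eι : ι (ps, ps) = (ps, 0) := by rw [hι.self_of_nhds, eS]
  have tι : Tendsto ι (𝓝 (ps, ps)) (𝓝 (ps, 0)) := by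
    have := aι.continuousAt.tendsto; rwa [eι] at this
  have hleft' : ∀ᶠ p in 𝓝 (ps, (0:X3)), ι (R p) = p := by
    filter_upwards [hleft, hRt.eventually hι] with p h1 h2
    rw [h2, h1]
  have hright' : ∀ᶠ q in 𝓝 (ps, ps), R (ι q) = q := by
    filter_upwards [hright, hι] with p h1 h2
    rw [h2, h1]
  refine ⟨fun z => Y1 (ι z), fun z => Y2 (ι z), mY1.comp mι, mY2.comp mι, ?_, ?_, ?_, ?_, ?_⟩
  · apply AnalyticAt.fun_comp (g := Y1) _ aι; rw [eι]; exact aY1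
  · apply AnalyticAt.fun_comp (g := Y2) _ aι; rw [eι]; exact aY2
  · have t1 : Tendsto (fun p : X3 => (p, (0:X3))) (𝓝 ps) (𝓝 (ps, 0)) :=
      (Continuous.prodMk_left 0).tendsto ps
    filter_upwards [t1.eventually hleft', hG0 0, hG0 1, hG0 2] with p h h0 h1 h2
    have y1 : Y1 (p, 0) = p := h0
    have y2 : Y2 (p, 0) = p := by simp only [hY2]; rw [y1]; exact h1
    have y3 : Y3 (p, 0) = p := by simp only [hY3]; rw [y2]; exact h2
    have r : R (p, 0) = (p, p) := by simp only [hR]; rw [y3]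
    rw [r] at h
    rw [h]; exact ⟨y1, y2⟩
  · filter_upwards [hright', tι.eventually (ti1.eventually (hGQ 0)),
      tι.eventually (ti2.eventually (hGQ 1)), tι.eventually (ti3.eventually (hGQ 2))]
      with z h h0 h1 h2
    have z1 : (ι z).1 = z.1 := by
      have := congrArg (fun u : X3 × X3 => u.1) h
      exact this
    have z2 : Y3 (ι z) = z.2 := congrArg (fun u : X3 × X3 => u.2) h
    refine ⟨?_, h1, ?_⟩
    · rw [← z1]; exact h0
    · rw [← z2]; exact h2
  · obtain ⟨Nχ, hNχ, Cχ, hCχ⟩ := image_measure_le volume e.symm _ _ hχd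
    obtain ⟨Na, hNa, Nb, hNb, hprod⟩ := mem_nhds_prod_iff.1 (hleft.and hleft')
    obtain ⟨ρ, hρ, hball⟩ := Metric.mem_nhds_iff.1 hNb
    obtain ⟨Nc, hNc, Nd, hNd, hprod2⟩ := mem_nhds_prod_iff.1 hNχ
    choose N hN C hC using fun j => hcount j ρ hρ
    refine ⟨(⋂ j, N j) ∩ Na ∩ (Nc ∩ Nd), ?_, 3 * (C 0 + C 1 + C 2) + Cχ, ?_⟩
    · exact inter_mem (inter_mem (Filter.iInter_mem.2 hN) hNa) (inter_mem hNc hNd)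
    intro E hEN hE θ
    have hp := path_count G hGm ρ (C 0 + C 1 + C 2) E hE (by
      intro j S hSE hS θ
      refine (hC j S (fun p hp => mem_iInter.1 (hEN (hSE hp)).1.1 j) hS θ).trans ?_
      gcongr
      fin_cases j
      · simp only [Fin.zero_eta]; rw [add_assoc]; exact le_self_add
      · simp only [Fin.mk_one]; rw [add_comm (C 0), add_assoc]; exact le_self_add
      · exact le_add_self) θ
    refine hp.trans ?_
    set P := {z : X3 × X3 | z.1 ∈ E ∧ Y1 (ι z) ∈ E ∧ Y2 (ι z) ∈ E ∧ z.2 ∈ E} with hP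
    have hPN : P ⊆ Nχ := fun z hz => hprod2 ⟨(hEN hz.1).2.1, (hEN hz.2.2.2).2.2⟩
    gcongr
    · push_cast; exact le_self_add
    · refine le_trans (measure_mono (t := e.symm '' P) ?_) ((hCχ P hPN).trans ?_)
      · rintro ⟨p0, t⟩ ⟨b1, ⟨b2, b3, b4⟩, b5, b6, b7⟩
        have hb := @hprod (p0, t) ⟨(hEN b1).1.2, hball (by
          simp only [mem_ball, dist_zero_right, Prod.norm_def, Real.norm_eq_abs]
          exact max_lt (max_lt b2 b3) b4)⟩
        refine ⟨R (p0, t), ⟨b1, ?_, ?_, b7⟩, hb.1⟩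
        · rw [hb.2]; exact b5
        · rw [hb.2]; exact b6
      · gcongr
        push_cast; exact le_add_self


lemma near_mul {c c' a b a' b' : ℝ} (hc : 0 ≤ c) (h : |a - b| ≤ c * |b|)
    (h' : |a' - b'| ≤ c' * |b'|) :
    |a * a' - b * b'| ≤ (c + c' + c * c') * |b * b'| := by
  have e : a * a' - b * b' = (a - b) * (a' - b') + (a - b) * b' + b * (a' - b') := by ring
  have h1 : |(a - b) * (a' - b')| ≤ (c * |b|) * (c' * |b'|) := by
    rw [abs_mul]; gcongr
  have h2 : |(a - b) * b'| ≤ (c * |b|) * |b'| := by rw [abs_mul]; gcongr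
  have h3 : |b * (a' - b')| ≤ |b| * (c' * |b'|) := by rw [abs_mul]; gcongr
  calc |a * a' - b * b'| ≤ |(a - b) * (a' - b')| + |(a - b) * b'| + |b * (a' - b')| := by
        rw [e]; exact abs_add_three _ _ _
    _ ≤ _ := by rw [abs_mul b b']; nlinarith

lemma near_step {n ε a b a' b' : ℝ} (hn : 0 ≤ n) (hε : 0 < ε) (hε1 : ε ≤ 1)
    (h : |a - b| ≤ (n * ε) * |b|) (h' : |a' - b'| ≤ ε * |b'|) :
    |a * a' - b * b'| ≤ ((2 * n + 1) * ε) * |b * b'| := by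
  refine (near_mul (by positivity) h h').trans ?_
  gcongr
  nlinarith [mul_nonneg hn hε.le]

lemma chain7 {ε : ℝ} (hε : 0 < ε) (hε1 : ε ≤ 1) {K0 K1 K2 K K1' K2' K' : ℝ} (h0 : K0 ≠ 0)
    (h1 : K1 ≠ 0) (h2 : K2 ≠ 0) (h : K ≠ 0) (h1' : K1' ≠ 0) (h2' : K2' ≠ 0) (h' : K' ≠ 0)
    {m0p0 m0q1 m1q1 m1q2 m2q2 m2p m0q1' m1q1' m1q2' m2q2' m2p' m m' : ℝ}
    (r0 : |K0 * m0p0 - K1 * m0q1| ≤ ε * |K1 * m0q1|)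
    (r1 : |K1 * m1q1 - K2 * m1q2| ≤ ε * |K2 * m1q2|)
    (r2 : |K2 * m2q2 - K * m2p| ≤ ε * |K * m2p|)
    (s0 : |K1' * m0q1' - K0 * m0p0| ≤ ε * |K0 * m0p0|)
    (s1 : |K2' * m1q2' - K1' * m1q1'| ≤ ε * |K1' * m1q1'|)
    (s2 : |K' * m2p' - K2' * m2q2'| ≤ ε * |K2' * m2q2'|)
    (t : |K * m - K' * m'| ≤ ε * |K' * m'|) :
    |(m0p0 * m1q1' * m2q2') * (m0q1 * m1q2 * m2p) * m' -
      (m0p0 * m1q1 * m2q2) * (m0q1' * m1q2' * m2p') * m| ≤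
      127 * ε * |(m0p0 * m1q1' * m2q2') * (m0q1 * m1q2 * m2p) * m'| := by
  have a1 : |K0 * m0p0 - K1 * m0q1| ≤ (1 * ε) * |K1 * m0q1| := by rwa [one_mul]
  have a2 := near_step (by norm_num) hε hε1 a1 r1
  have a3 := near_step (by norm_num) hε hε1 a2 r2
  have a4 := near_step (by norm_num) hε hε1 a3 s0
  have a5 := near_step (by norm_num) hε hε1 a4 s1
  have a6 := near_step (by norm_num) hε hε1 a5 s2
  have a7 := near_step (by norm_num) hε hε1 a6 t
  set X := K0 * K1 * K2 * K * K1' * K2' * K' with hX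
  have hXpos : 0 < |X| := by rw [hX]; positivity
  have e1 : |(m0p0 * m1q1' * m2q2') * (m0q1 * m1q2 * m2p) * m' -
      (m0p0 * m1q1 * m2q2) * (m0q1' * m1q2' * m2p') * m| * |X| =
      |K0 * m0p0 * (K1 * m1q1) * (K2 * m2q2) * (K1' * m0q1') * (K2' * m1q2') * (K' * m2p') * (K * m) -
        K1 * m0q1 * (K2 * m1q2) * (K * m2p) * (K0 * m0p0) * (K1' * m1q1') * (K2' * m2q2') *
          (K' * m')| := by
    rw [← abs_mul, abs_sub_comm]
    rw [show (m0p0 * m1q1' * m2q2' * (m0q1 * m1q2 * m2p) * m' -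
      m0p0 * m1q1 * m2q2 * (m0q1' * m1q2' * m2p') * m) * X = - (X * m0p0 * m1q1 * m2q2 * (m0q1' * m1q2' * m2p') * m
      - X * m0p0 * m1q1' * m2q2' * (m0q1 * m1q2 * m2p) * m') by ring, abs_neg, abs_sub_comm]
    congr 1; rw [hX]; ring
  have e2 : |(m0p0 * m1q1' * m2q2') * (m0q1 * m1q2 * m2p) * m'| * |X| =
      |K1 * m0q1 * (K2 * m1q2) * (K * m2p) * (K0 * m0p0) * (K1' * m1q1') * (K2' * m2q2') *
          (K' * m')| := by
    rw [← abs_mul]; congr 1; rw [hX]; ring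
  rw [← e1, ← e2] at a7
  have := le_of_mul_le_mul_right (a7.trans_eq (mul_assoc _ _ _).symm) hXpos
  refine this.trans (le_of_eq ?_)
  norm_num

lemma enn_cancel (a x : ℝ≥0∞) (c : ℝ≥0∞) (h0 : a ≠ 0) (ht : a ≠ ⊤) (h : a ^ 7 * x ≤ c * a ^ 8) :
    x ≤ c * a := by
  have : a ^ 7 * x ≤ a ^ 7 * (c * a) := h.trans_eq (by ring)
  exact (ENNReal.mul_le_mul_iff_right (pow_ne_zero _ h0) (ENNReal.pow_ne_top ht)).1 this


theorem thmA (ps : X3) (Q : Fin 3 → X3 → Vec2) (hQ : ∀ j, AnalyticAt ℝ (Q j) ps)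
    (hs : ∀ j, Function.Surjective (fderiv ℝ (Q j) ps)) (w : Fin 3 → X3)
    (hw : ∀ j, fderiv ℝ (Q j) ps (w j) = 0) (hli : LinearIndependent ℝ w)
    (m : Fin 3 → X3 → ℝ) (hm : ∀ j, AnalyticAt ℝ (m j) ps) (O : Set X3) (hO : ps ∈ closure O)
    (hmO : ∀ᶠ p in 𝓝 ps, p ∈ O → ∀ j, m j p ≠ 0)
    (hno : ∀ᶠ p1 in 𝓝 ps, p1 ∈ O → ∀ K : X3 → ℝ, AnalyticAt ℝ K p1 → K p1 ≠ 0 →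
      ¬ ∀ j, ∀ᶠ pp in 𝓝 (p1, p1), Q j pp.1 = Q j pp.2 → K pp.1 * m j pp.1 = K pp.2 * m j pp.2) :
    ∃ N ∈ 𝓝 ps, ∃ C κ : ℝ, 0 < κ ∧ 0 ≤ C ∧ ∀ ε : ℝ, 0 < ε → ε ≤ 1 → ∀ E ⊆ N, MeasurableSet E →
      ∀ K : X3 → ℝ, (∀ p ∈ E, K p ≠ 0) → (∀ j, ∀ p ∈ E, ∀ p' ∈ E, Q j p = Q j p' →
        |K p * m j p - K p' * m j p'| ≤ ε * |K p' * m j p'|) →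
      volume E ≤ ENNReal.ofReal (C * ε ^ κ) := by
  choose G ℓ hGm hGan hG0 hGQ hGd hGℓ hGc using fun j =>
    coord ps (Q j) (hQ j) (hs j) (w j) (hli.ne_zero j) (hw j)
  obtain ⟨q1, q2, mq1, mq2, aq1, aq2, hqd, hqQ, Np, hNp, Cp, hCp⟩ :=
    paths ps Q w hli G hGm hGan hG0 hGQ hGd hGc
  have hps0 : ∀ j, G j (ps, 0) = ps := fun j => (hG0 j).self_of_nhds
  have eq1 : q1 (ps, ps) = ps := hqd.self_of_nhds.1
  have eq2 : q2 (ps, ps) = ps := hqd.self_of_nhds.2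
  set Af : X3 × X3 → ℝ := fun u => m 0 u.1 * m 1 (q1 u) * m 2 (q2 u) with hAf
  set Bf : X3 × X3 → ℝ := fun u => m 0 (q1 u) * m 1 (q2 u) * m 2 u.2 with hBf
  have mq1a : ∀ j, AnalyticAt ℝ (fun u => m j (q1 u)) (ps, ps) := fun j =>
    AnalyticAt.fun_comp (g := m j) (by rw [eq1]; exact hm j) aq1
  have mq2a : ∀ j, AnalyticAt ℝ (fun u => m j (q2 u)) (ps, ps) := fun j =>
    AnalyticAt.fun_comp (g := m j) (by rw [eq2]; exact hm j) aq2
  have m1a : ∀ j, AnalyticAt ℝ (fun u : X3 × X3 => m j u.1) (ps, ps) := fun j =>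
    AnalyticAt.fun_comp (g := m j) (hm j) analyticAt_fst
  have m2a : ∀ j, AnalyticAt ℝ (fun u : X3 × X3 => m j u.2) (ps, ps) := fun j =>
    AnalyticAt.fun_comp (g := m j) (hm j) analyticAt_snd
  have aA : AnalyticAt ℝ Af (ps, ps) := ((m1a 0).mul (mq1a 1)).mul (mq2a 2)
  have aB : AnalyticAt ℝ Bf (ps, ps) := ((mq1a 0).mul (mq2a 1)).mul (m2a 2)
  set F : Fin 3 → X3 × (X3 × ℝ) → ℝ := fun j z =>
    Af (z.1, G j z.2) * Bf (z.1, z.2.1) * m j (G j z.2) -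
      Af (z.1, z.2.1) * Bf (z.1, G j z.2) * m j z.2.1 with hF
  have aF : ∀ j, AnalyticAt ℝ (F j) (ps, (ps, 0)) := by
    intro j
    have g1 : AnalyticAt ℝ (fun z : X3 × (X3 × ℝ) => G j z.2) (ps, (ps, 0)) :=
      AnalyticAt.fun_comp (g := G j) (hGan j) analyticAt_snd
    have g2 : AnalyticAt ℝ (fun z : X3 × (X3 × ℝ) => (z.1, G j z.2)) (ps, (ps, 0)) :=
      analyticAt_fst.prod g1
    have g3 : AnalyticAt ℝ (fun z : X3 × (X3 × ℝ) => z.2.1) (ps, (ps, 0)) :=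
      analyticAt_fst.fun_comp analyticAt_snd
    have g4 : AnalyticAt ℝ (fun z : X3 × (X3 × ℝ) => (z.1, z.2.1)) (ps, (ps, 0)) :=
      analyticAt_fst.prod g3
    have b1 := AnalyticAt.fun_comp (g := Af) (by simpa [hps0] using aA) g2
    have b2 := AnalyticAt.fun_comp (g := Bf) (by simpa [hps0] using aB) g2
    have b3 := AnalyticAt.fun_comp (g := Af) (by simpa using aA) g4
    have b4 := AnalyticAt.fun_comp (g := Bf) (by simpa using aB) g4
    have b5 := AnalyticAt.fun_comp (g := m j) (by simpa [hps0] using hm j) g1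
    have b6 := AnalyticAt.fun_comp (g := m j) (hm j) g3
    exact ((b1.mul b4).mul b5).sub ((b3.mul b2).mul b6)
  have hex : ∃ j, ¬ ∀ᶠ z in 𝓝 (ps, (ps, (0:ℝ))), F j z = 0 := by
    by_contra hcon
    push Not at hcon
    have tdiag : Tendsto (fun p : X3 => (p, p)) (𝓝 ps) (𝓝 (ps, ps)) :=
      (continuous_id.prodMk continuous_id).tendsto ps
    have tdiag2 : Tendsto (fun p : X3 => (p, (p, (0:ℝ)))) (𝓝 ps) (𝓝 (ps, (ps, 0))) :=
      (show Continuous fun p : X3 => (p, (p, (0:ℝ))) by fun_prop).tendsto ps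
    have hall : ∀ᶠ p1 in 𝓝 ps, p1 ∈ O → False := by
      have c1 := tdiag.eventually (aA.eventually_analyticAt)
      have c2 := tdiag.eventually (aB.eventually_analyticAt)
      have c3 : ∀ᶠ p in 𝓝 ps, ∀ j, ∀ᶠ z in 𝓝 (p, (p, (0:ℝ))), F j z = 0 :=
        eventually_all.2 fun j => tdiag2.eventually (hcon j).eventually_nhds
      have c4 : ∀ᶠ p in 𝓝 ps, ∀ j, ∀ᶠ z in 𝓝 (p, p), Q j z.1 = Q j z.2 →
          z.2 = G j (z.1, ℓ j z.2 - ℓ j z.1) :=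
        eventually_all.2 fun j => tdiag.eventually (hGℓ j).eventually_nhds
      filter_upwards [c1, c2, c3, c4, hmO, hno, hqd] with p1 d1 d2 d3 d4 d5 d6 d7 hp1
      have mne := d5 hp1
      have Bne : Bf (p1, p1) ≠ 0 := by
        simp only [hBf]; rw [d7.1, d7.2]
        exact mul_ne_zero (mul_ne_zero (mne 0) (mne 1)) (mne 2)
      have Ane : Af (p1, p1) ≠ 0 := by
        simp only [hAf]; rw [d7.1, d7.2]
        exact mul_ne_zero (mul_ne_zero (mne 0) (mne 1)) (mne 2)
      have ins : AnalyticAt ℝ (fun p : X3 => (p1, p)) p1 := analyticAt_const.prod analyticAt_id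
      refine d6 hp1 (fun p => Af (p1, p) / Bf (p1, p)) ?_ ?_ ?_
      · exact (AnalyticAt.fun_comp (g := Af) d1 ins).div (AnalyticAt.fun_comp (g := Bf) d2 ins) Bne
      · exact div_ne_zero Ane Bne
      · intro j
        have Bev : ∀ᶠ p in 𝓝 p1, Bf (p1, p) ≠ 0 :=
          (AnalyticAt.fun_comp (g := Bf) d2 ins).continuousAt.eventually_ne Bne
        have t1 : Tendsto (fun z : X3 × X3 => z.1) (𝓝 (p1, p1)) (𝓝 p1) :=
          continuous_fst.tendsto (p1, p1)
        have t2 : Tendsto (fun z : X3 × X3 => z.2) (𝓝 (p1, p1)) (𝓝 p1) :=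
          continuous_snd.tendsto (p1, p1)
        have t3 : Tendsto (fun z : X3 × X3 => (p1, (z.1, ℓ j z.2 - ℓ j z.1))) (𝓝 (p1, p1))
            (𝓝 (p1, (p1, 0))) := by
          have : Continuous fun z : X3 × X3 => (p1, (z.1, ℓ j z.2 - ℓ j z.1)) := by fun_prop
          simpa using this.tendsto (p1, p1)
        filter_upwards [t1.eventually Bev, t2.eventually Bev, t3.eventually (d3 j), d4 j]
          with z e1 e2 e3 e4 hQz
        simp only [hF] at e3
        rw [← e4 hQz] at e3
        field_simp
        linarith
    exact (mem_closure_iff_frequently.1 hO) hall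
  obtain ⟨j, hj⟩ := hex
  obtain ⟨NF, hNF, CF, κ, hκ, hCF, hsub⟩ := analytic_sublevel volume (F j) _ (aF j) hj
  obtain ⟨Na, hNa, Nbρ, hNbρ, hp1⟩ := mem_nhds_prod_iff.1 hNF
  obtain ⟨Nb, hNb, Nρ, hNρ, hp2⟩ := mem_nhds_prod_iff.1 (inter_mem hNbρ (hGQ j))
  obtain ⟨ρ, hρ, hball⟩ := Metric.mem_nhds_iff.1 hNρ
  obtain ⟨Nc, hNc, Cc, hCc⟩ := hGc j ρ hρ
  obtain ⟨Nd, hNd, Ne, hNe, hp3⟩ := mem_nhds_prod_iff.1 hqQ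
  obtain ⟨M, hM1, hM⟩ : ∃ M : ℝ, 1 ≤ M ∧ ∀ᶠ p in 𝓝 ps, ∀ k, |m k p| ≤ M := by
    refine ⟨1 + ∑ k, |m k ps|, le_add_of_nonneg_right (Finset.sum_nonneg fun _ _ => abs_nonneg _),
      eventually_all.2 fun k => ?_⟩
    have h1 : |m k ps| < 1 + ∑ k, |m k ps| := by
      have := Finset.single_le_sum (f := fun k => |m k ps|) (fun _ _ => abs_nonneg _)
        (Finset.mem_univ k)
      linarith
    exact ((hm k).continuousAt.abs.eventually_lt_const h1).mono fun p hp => hp.le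
  set Nball := ball ps 1 with hNball
  set N := Np ∩ Na ∩ Nb ∩ Nc ∩ Nd ∩ Ne ∩ {p | ∀ k, |m k p| ≤ M} ∩ Nball with hN
  have hNmem : N ∈ 𝓝 ps := inter_mem (inter_mem (inter_mem (inter_mem (inter_mem (inter_mem
    (inter_mem hNp hNa) hNb) hNc) hNd) hNe) hM) (ball_mem_nhds _ one_pos)
  set Cb : ℝ≥0 := (CF * (127 * M ^ 7) ^ κ).toNNReal with hCb
  set vN : ℝ≥0 := (volume Nball).toNNReal with hvN
  set C3 : ℝ≥0 := Cp + Cp * (Cc * vN + Cb) with hC3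
  refine ⟨N, hNmem, C3, κ / 8, by positivity, C3.2, ?_⟩
  intro ε hε hε1 E hEN hE K hK hrel
  have hM0 : 0 < M := by linarith
  set P := {z : X3 × X3 | z.1 ∈ E ∧ q1 z ∈ E ∧ q2 z ∈ E ∧ z.2 ∈ E} with hP
  have mP : MeasurableSet P :=
    (measurable_fst hE).inter ((mq1 hE).inter ((mq2 hE).inter (measurable_snd hE)))
  set BB := {z : X3 × (X3 × ℝ) | (z.1, z.2.1) ∈ P ∧ |z.2.2| < ρ ∧ (z.1, G j z.2) ∈ P} with hBB
  have mBB : MeasurableSet BB := by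
    have hGj := hGm j
    refine MeasurableSet.inter ?_ (MeasurableSet.inter ?_ ?_)
    · exact (show Measurable fun z : X3 × (X3 × ℝ) => (z.1, z.2.1) by fun_prop) mP
    · exact meas_abs_lt (fun z : X3 × (X3 × ℝ) => z.2.2) (by fun_prop) ρ
    · exact (show Measurable fun z : X3 × (X3 × ℝ) => (z.1, G j z.2) by fun_prop) mP
  set a : ℝ≥0∞ := ENNReal.ofReal (ε ^ (κ / 8)) with ha
  have ha0 : a ≠ 0 := by
    rw [ha]; simp only [ne_eq, ENNReal.ofReal_eq_zero, not_le]; positivity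
  have hat : a ≠ ⊤ := ENNReal.ofReal_ne_top
  have ha8 : ENNReal.ofReal (ε ^ κ) = a ^ 8 := by
    rw [ha, ← ENNReal.ofReal_pow (by positivity), ← Real.rpow_natCast, ← Real.rpow_mul hε.le]
    congr 2; push_cast; ring
  have hBBsub : BB ⊆ NF ∩ {z | |F j z| ≤ (127 * M ^ 7) * ε} := by
    rintro ⟨p0, p, σ⟩ ⟨⟨u0, u1, u2, u3⟩, hσ, ⟨_, v1, v2, v3⟩⟩
    simp only at u0 u1 u2 u3 hσ v1 v2 v3
    have hσN : σ ∈ Nρ := hball (by simpa using hσ)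
    have hNE : ∀ q ∈ E, q ∈ N := fun q hq => hEN hq
    have pb := @hp2 (p, σ) ⟨(hNE p u3).1.1.1.1.1.2, hσN⟩
    refine ⟨hp1 ⟨(hNE p0 u0).1.1.1.1.1.1.2, pb.1⟩, ?_⟩
    have hQj : Q j (G j (p, σ)) = Q j p := pb.2
    obtain ⟨x0, x1, x2⟩ := @hp3 (p0, p) ⟨(hNE p0 u0).1.1.1.2, (hNE p u3).1.1.2⟩
    obtain ⟨y0, y1, y2⟩ := @hp3 (p0, G j (p, σ)) ⟨(hNE p0 u0).1.1.1.2, (hNE _ v3).1.1.2⟩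
    simp only at x0 x1 x2 y0 y1 y2
    have hch := chain7 hε hε1 (hK _ u0) (hK _ u1) (hK _ u2) (hK _ u3) (hK _ v1) (hK _ v2)
      (hK _ v3) (hrel 0 _ u0 _ u1 x0.symm) (hrel 1 _ u1 _ u2 x1.symm) (hrel 2 _ u2 _ u3 x2.symm)
      (hrel 0 _ v1 _ u0 y0) (hrel 1 _ v2 _ v1 y1) (hrel 2 _ v3 _ v2 y2)
      (hrel j _ u3 _ v3 hQj.symm)
    have hb : ∀ q ∈ E, ∀ k, |m k q| ≤ M := fun q hq => (hNE q hq).1.2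
    show |F j (p0, p, σ)| ≤ 127 * M ^ 7 * ε
    simp only [hF, hAf, hBf]
    refine hch.trans ?_
    have : |m 0 p0 * m 1 (q1 (p0, G j (p, σ))) * m 2 (q2 (p0, G j (p, σ))) *
        (m 0 (q1 (p0, p)) * m 1 (q2 (p0, p)) * m 2 p) * m j (G j (p, σ))| ≤
        M * M * M * (M * M * M) * M := by
      simp only [abs_mul]
      gcongr <;> apply hb <;> assumption
    calc _ ≤ 127 * ε * (M * M * M * (M * M * M) * M) := by gcongr
      _ = _ := by ring
  have hBBvol : volume BB ≤ Cb * a ^ 8 := by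
    calc volume BB ≤ volume (NF ∩ {z | |F j z| ≤ (127 * M ^ 7) * ε}) := measure_mono hBBsub
      _ ≤ ENNReal.ofReal (CF * ((127 * M ^ 7) * ε) ^ κ) := hsub _ (by positivity)
      _ = Cb * a ^ 8 := by
        rw [Real.mul_rpow (by positivity) hε.le, ← mul_assoc, ENNReal.ofReal_mul (by positivity),
          ha8]; rfl
  have hPvol : a ^ 4 * volume P ≤ (Cc * vN + Cb) * a ^ 8 := by
    have hsl : ∀ p0 : X3, a ^ 4 * volume (Prod.mk p0 ⁻¹' P) ≤
        Nball.indicator (fun _ => Cc * (a ^ 4) ^ 2) p0 + volume (Prod.mk p0 ⁻¹' BB) := by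
      intro p0
      by_cases hp0 : p0 ∈ Nball
      · rw [indicator_of_mem hp0]
        have hSE : Prod.mk p0 ⁻¹' P ⊆ E := fun p hp => hp.2.2.2
        exact count1 (G j) (hGm j) ρ Cc (Prod.mk p0 ⁻¹' P) (measurable_prodMk_left mP)
          (fun θ => hCc _ (hSE.trans fun p hp => (hEN hp).1.1.1.1.2)
            (measurable_prodMk_left mP) θ) (a ^ 4)
      · have : Prod.mk p0 ⁻¹' P = ∅ := by
          ext p; simp only [mem_preimage, mem_empty_iff_false, iff_false]
          intro h; exact hp0 (hEN h.1).2
        rw [this]; simp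
    calc a ^ 4 * volume P = ∫⁻ p0, a ^ 4 * volume (Prod.mk p0 ⁻¹' P) := by
          rw [Measure.volume_eq_prod X3 X3, Measure.prod_apply mP,
            lintegral_const_mul _ (measurable_measure_prodMk_left mP)]
      _ ≤ ∫⁻ p0, (Nball.indicator (fun _ => Cc * (a ^ 4) ^ 2) p0 +
            volume (Prod.mk p0 ⁻¹' BB)) := lintegral_mono hsl
      _ = Cc * (a ^ 4) ^ 2 * volume Nball + volume BB := by
          rw [lintegral_add_left (measurable_const.indicator measurableSet_ball),
            lintegral_indicator measurableSet_ball, setLIntegral_const,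
            Measure.volume_eq_prod X3 (X3 × ℝ), Measure.prod_apply mBB]
      _ ≤ Cc * (a ^ 4) ^ 2 * vN + Cb * a ^ 8 := by
          rw [hvN, ENNReal.coe_toNNReal measure_ball_lt_top.ne]; gcongr
      _ = _ := by ring
  have hEvol := hCp E (fun p hp => (hEN hp).1.1.1.1.1.1.1) hE a
  have hE7 : a ^ 7 * volume E ≤ C3 * a ^ 8 := by
    calc a ^ 7 * volume E = a ^ 4 * (a ^ 3 * volume E) := by ring
      _ ≤ a ^ 4 * (Cp * a ^ 4 + Cp * volume P) := by gcongr
      _ = Cp * a ^ 8 + Cp * (a ^ 4 * volume P) := by ring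
      _ ≤ Cp * a ^ 8 + Cp * ((Cc * vN + Cb) * a ^ 8) := by gcongr
      _ = C3 * a ^ 8 := by rw [hC3]; push_cast; ring
  have := enn_cancel a (volume E) C3 ha0 hat hE7
  rw [ENNReal.ofReal_mul (NNReal.coe_nonneg C3), ENNReal.ofReal_coe_nnreal]
  exact this


lemma multilin_telescope {V : Type*} [NormedAddCommGroup V] [NormedSpace ℝ V] (n : ℕ)
    (f : ContinuousMultilinearMap ℝ (fun _ : Fin (n + 1) => V) ℝ) (y z : V) :
    f (fun _ => y) - f (fun _ => z) =
      ∑ i : Fin (n + 1), f (i.insertNth (y - z) (fun k : Fin n => if k.castSucc < i then z else y)) := by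
  set h : ℕ → ℝ := fun t => f (fun k : Fin (n + 1) => if k.val < t then z else y) with hh
  have h0 : h 0 = f (fun _ => y) := by simp [hh]
  have h1 : h (n + 1) = f (fun _ => z) := by
    simp only [hh]
    congr 1
    ext k
    rw [if_pos k.isLt]
  rw [← h0, ← h1, ← Finset.sum_range_sub' h (n + 1), ← Fin.sum_univ_eq_sum_range]
  · apply Finset.sum_congr rfl
    intro i _
    set u : Fin (n + 1) → V := fun k => if k.val < i.val then z else y with hu
    have a1 : (i.insertNth (y - z) (fun k : Fin n => if k.castSucc < i then z else y) :
        Fin (n + 1) → V) = Function.update u i (y - z) := by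
      ext k
      rcases Fin.eq_self_or_eq_succAbove i k with rfl | ⟨k', rfl⟩
      · simp
      · rw [Fin.insertNth_apply_succAbove, Function.update_of_ne (Fin.succAbove_ne i k')]
        simp only [hu]
        have : (i.succAbove k').val < i.val ↔ k'.castSucc < i := by
          rw [← Fin.lt_def, Fin.succAbove_lt_iff_castSucc_lt]
        simp only [this]
    have a2 : (fun k : Fin (n + 1) => if k.val < i.val then z else y) = Function.update u i y := by
      ext k
      by_cases hk : k = i
      · subst hk; simp
      · rw [Function.update_of_ne hk]
    have a3 : (fun k : Fin (n + 1) => if k.val < i.val + 1 then z else y) =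
        Function.update u i z := by
      ext k
      by_cases hk : k = i
      · subst hk; simp
      · rw [Function.update_of_ne hk]
        have : k.val ≠ i.val := fun h => hk (Fin.ext h)
        have h2 : k.val < i.val + 1 ↔ k.val < i.val := by omega
        simp only [hu, h2]
    simp only [hh]
    rw [a1, a2, a3, ← f.map_update_sub]

def projY : Vec2 →L[ℝ] Vec2 := (0 : Vec2 →L[ℝ] ℝ).prod (ContinuousLinearMap.snd ℝ ℝ ℝ)

lemma projY_apply (y : Vec2) : projY y = (0, y.2) := rfl

lemma projY_norm : ‖projY‖ ≤ 1 := by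
  apply ContinuousLinearMap.opNorm_le_bound _ zero_le_one
  intro y
  rw [projY_apply, one_mul, Prod.norm_def, Prod.norm_def]
  simp

def divSeries (p : FormalMultilinearSeries ℝ Vec2 ℝ) : FormalMultilinearSeries ℝ Vec2 ℝ :=
  fun n => ∑ i : Fin (n + 1), (((p (n + 1)).curryMid i ((1, 0) : Vec2) :
    ContinuousMultilinearMap ℝ (fun _ : Fin n => Vec2) ℝ)).compContinuousLinearMap
      (fun k => if k.castSucc < i then projY else ContinuousLinearMap.id ℝ Vec2)

lemma divSeries_norm (p : FormalMultilinearSeries ℝ Vec2 ℝ) (n : ℕ) :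
    ‖divSeries p n‖ ≤ (n + 1) * ‖p (n + 1)‖ := by
  unfold divSeries
  refine (norm_sum_le _ _).trans ?_
  have : ∀ i : Fin (n + 1), ‖(((p (n + 1)).curryMid i ((1, 0) : Vec2) :
    ContinuousMultilinearMap ℝ (fun _ : Fin n => Vec2) ℝ)).compContinuousLinearMap
      (fun k => if k.castSucc < i then projY else ContinuousLinearMap.id ℝ Vec2)‖ ≤
      ‖p (n + 1)‖ := by
    intro i
    refine (ContinuousMultilinearMap.norm_compContinuousLinearMap_le _ _).trans ?_
    have h1 : ‖(p (n + 1)).curryMid i ((1, 0) : Vec2)‖ ≤ ‖p (n + 1)‖ := by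
      refine (ContinuousLinearMap.le_opNorm _ _).trans ?_
      rw [ContinuousMultilinearMap.norm_curryMid]
      simp [Prod.norm_def]
    have h2 : ∏ k : Fin n, ‖(if k.castSucc < i then projY else ContinuousLinearMap.id ℝ Vec2)‖ ≤ 1 := by
      apply Finset.prod_le_one
      · intros; positivity
      · intro k _
        split_ifs
        · exact projY_norm
        · exact ContinuousLinearMap.norm_id_le
    calc _ ≤ ‖p (n + 1)‖ * 1 := by gcongr
      _ = _ := mul_one _
  refine (Finset.sum_le_sum fun i _ => this i).trans ?_
  simp

lemma divSeries_apply (p : FormalMultilinearSeries ℝ Vec2 ℝ) (n : ℕ) (y : Vec2) :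
    y.1 * divSeries p n (fun _ => y) = p (n + 1) (fun _ => y) - p (n + 1) (fun _ => projY y) := by
  rw [multilin_telescope]
  unfold divSeries
  rw [ContinuousMultilinearMap.sum_apply, Finset.mul_sum]
  apply Finset.sum_congr rfl
  intro i _
  rw [ContinuousMultilinearMap.compContinuousLinearMap_apply]
  have e1 : y - projY y = y.1 • ((1, 0) : Vec2) := by
    rw [projY_apply]; ext <;> simp
  rw [e1]
  have e2 := (p (n + 1)).curryMid_apply i (y.1 • ((1, 0) : Vec2))
    (fun k : Fin n => if k.castSucc < i then projY y else y)
  rw [← e2, map_smul, ContinuousMultilinearMap.smul_apply, smul_eq_mul]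
  congr 2
  ext k
  · split_ifs <;> rfl
  · split_ifs <;> rfl

lemma analytic_division (g : Vec2 → ℝ) (x0 : Vec2) (hg : AnalyticAt ℝ g x0)
    (h0 : ∀ᶠ x in 𝓝 x0, x.1 = x0.1 → g x = 0) :
    ∃ e : Vec2 → ℝ, AnalyticAt ℝ e x0 ∧ ∀ᶠ x in 𝓝 x0, g x = (x.1 - x0.1) * e x := by
  obtain ⟨p, R, hp⟩ := hg
  have hrad : 0 < p.radius := hp.r_pos.trans_le hp.r_le
  obtain ⟨r, hr0, hr⟩ := ENNReal.lt_iff_exists_nnreal_btwn.1 hrad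
  have hr0' : 0 < (r:ℝ) := by exact_mod_cast hr0
  obtain ⟨C, hC, hb⟩ := p.norm_mul_pow_le_of_lt_radius hr
  have hq : 0 < (divSeries p).radius := by
    have : ((r / 2 : ℝ≥0) : ℝ≥0∞) ≤ (divSeries p).radius := by
      apply FormalMultilinearSeries.le_radius_of_bound _ (C / r)
      intro n
      have h1 := divSeries_norm p n
      have h2 := hb (n + 1)
      have h3 : ((n:ℝ) + 1) ≤ 2 ^ n := by
        exact_mod_cast Nat.lt_two_pow_self (n := n)
      rw [le_div_iff₀ hr0']
      push_cast
      calc ‖divSeries p n‖ * ((r:ℝ) / 2) ^ n * r ≤ ((n + 1) * ‖p (n + 1)‖) * ((r:ℝ) / 2) ^ n * r := by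
            gcongr
        _ = ((n + 1) / 2 ^ n) * (‖p (n + 1)‖ * (r:ℝ) ^ (n + 1)) := by
            rw [div_pow]; ring
        _ ≤ 1 * C := by
            gcongr
            rw [div_le_one (by positivity)]; exact h3
        _ = C := one_mul C
    refine lt_of_lt_of_le ?_ this
    have : 0 < r / 2 := by
      have : 0 < r := by exact_mod_cast hr0
      positivity
    exact_mod_cast this
  have hqs := (divSeries p).hasFPowerSeriesOnBall hq
  refine ⟨fun x => (divSeries p).sum (x - x0), ?_, ?_⟩
  · have h1 : AnalyticAt ℝ (divSeries p).sum (x0 - x0) := by rw [sub_self]; exact hqs.analyticAt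
    exact AnalyticAt.fun_comp (g := (divSeries p).sum) h1 (analyticAt_id.sub analyticAt_const)
  · have t0 : Tendsto (fun x : Vec2 => x - x0) (𝓝 x0) (𝓝 0) := by
      have : Continuous fun x : Vec2 => x - x0 := by fun_prop
      simpa using this.tendsto x0
    have t1 : Tendsto (fun x : Vec2 => projY (x - x0)) (𝓝 x0) (𝓝 0) := by
      have : Continuous fun x : Vec2 => projY (x - x0) := by fun_prop
      simpa using this.tendsto x0
    have t2 : Tendsto (fun x : Vec2 => x0 + projY (x - x0)) (𝓝 x0) (𝓝 x0) := by
      simpa using t1.const_add x0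
    filter_upwards [t0.eventually (Metric.eball_mem_nhds 0 hp.r_pos),
      t1.eventually (Metric.eball_mem_nhds 0 hp.r_pos),
      t0.eventually (Metric.eball_mem_nhds 0 hq), t2.eventually h0] with x b1 b2 b3 b4
    have s1 := hp.hasSum b1
    have s2 := hp.hasSum b2
    have s3 := hqs.hasSum b3
    rw [b4 (by simp [projY_apply])] at s2
    have s4 := s1.sub s2
    rw [← hasSum_nat_add_iff' 1] at s4
    have s5 := s3.mul_left (x.1 - x0.1)
    have e0 : ∀ n, p (n + 1) (fun _ => x - x0) - p (n + 1) (fun _ => projY (x - x0)) =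
        (x.1 - x0.1) * divSeries p n (fun _ => x - x0) := fun n =>
      (divSeries_apply p n (x - x0)).symm
    simp only [e0] at s4
    have := s4.unique s5
    have z : p 0 (fun _ => x - x0) = p 0 (fun _ => projY (x - x0)) := by
      congr 1; ext k; exact k.elim0
      exact k.elim0
    simpa [z] using this


structure Geo (c₀ : Vec2) (r₀ : ℝ) (B Bt : Set Vec2) (φ : Fin 4 → Vec2 → ℝ)
    (V : Fin 4 → Vec2 → Vec2) (W : Fin 4 → Fin 4 → (Vec2 × ℝ) → (Vec2 × ℝ)) : Prop where
  hr₀ : 0 < r₀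
  hB : B = Metric.ball c₀ r₀
  hBt_open : IsOpen Bt
  hBt_conn : IsConnected Bt
  hBBt : closure B ⊆ Bt
  hφ_an : ∀ j, AnalyticOnNhd ℝ (φ j) Bt
  hφ_sub : ∀ j, ∀ x ∈ Bt, fderiv ℝ (φ j) x ≠ 0
  htrans : ∀ x ∈ B, ∀ j k : Fin 4, j ≠ k →
      LinearIndependent ℝ ![fderiv ℝ (φ j) x, fderiv ℝ (φ k) x]
  hV_an : ∀ j, AnalyticOnNhd ℝ (V j) Bt
  hV_ne : ∀ j, ∀ x ∈ Bt, V j x ≠ 0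
  hV_ker : ∀ j, ∀ x ∈ Bt, fderiv ℝ (φ j) x (V j x) = 0
  hW_an : ∀ j k, AnalyticOnNhd ℝ (W j k) (Bt ×ˢ (univ : Set ℝ))
  hW_ne : ∀ j k, ∀ p ∈ Bt ×ˢ (univ : Set ℝ), W j k p ≠ 0
  hW_ker : ∀ j k, ∀ p ∈ Bt ×ˢ (univ : Set ℝ),
      fderiv ℝ (fun q : Vec2 × ℝ => ((φ j q.1, q.2 * fderiv ℝ (φ j) q.1 (V k q.1)) : Vec2))
        p (W j k p) = 0
  haux2 : ∀ k : Fin 4, ∀ p : Vec2 × ℝ, p.1 ∈ Bt → p.2 ≠ 0 →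
      LinearIndependent ℝ (fun j : {j : Fin 4 // j ≠ k} => W j.1 k p)
  hφ4 : ∀ x ∈ B, φ 3 x = x.1

lemma clm_vec2 (L : Vec2 →L[ℝ] ℝ) (v : Vec2) : L v = v.1 * L (1,0) + v.2 * L (0,1) := by
  have : v = v.1 • ((1,0) : Vec2) + v.2 • ((0,1) : Vec2) := by ext <;> simp
  conv_lhs => rw [this]
  rw [map_add, map_smul, map_smul]; simp

lemma fderiv_dir_analytic (f : Vec2 → ℝ) (v x : Vec2) (hf : AnalyticAt ℝ f x) :
    AnalyticAt ℝ (fun x => fderiv ℝ f x v) x :=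
  dirD_analytic v f x hf 1

lemma Dder_analytic (f : Vec2 → ℝ) (x : Vec2) (hf : AnalyticAt ℝ f x) :
    AnalyticAt ℝ (Dder f) x := fderiv_dir_analytic f (0,1) x hf

lemma fderiv_field_analytic (f : Vec2 → ℝ) (V : Vec2 → Vec2) (x : Vec2) (hf : AnalyticAt ℝ f x)
    (hV : AnalyticAt ℝ V x) : AnalyticAt ℝ (fun x => fderiv ℝ f x (V x)) x := by
  have : (fun x => fderiv ℝ f x (V x)) =
      fun x => (V x).1 * fderiv ℝ f x (1,0) + (V x).2 * fderiv ℝ f x (0,1) := by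
    funext x; exact clm_vec2 _ _
  rw [this]
  exact ((analyticAt_fst.fun_comp hV).fun_mul (fderiv_dir_analytic f _ x hf)).fun_add
    ((analyticAt_snd.fun_comp hV).fun_mul (fderiv_dir_analytic f _ x hf))

lemma pair_hasFDerivAt (φ h : Vec2 → ℝ) (p : X3) (hφ : DifferentiableAt ℝ φ p.1)
    (hh : DifferentiableAt ℝ h p.1) :
    ∃ L : X3 →L[ℝ] Vec2, HasFDerivAt (fun q : X3 => ((φ q.1, q.2 * h q.1) : Vec2)) L p ∧
      ∀ v : X3, L v = (fderiv ℝ φ p.1 v.1, v.2 * h p.1 + p.2 * fderiv ℝ h p.1 v.1) := by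
  have h1 : HasFDerivAt (fun q : X3 => φ q.1) ((fderiv ℝ φ p.1).comp (ContinuousLinearMap.fst ℝ Vec2 ℝ)) p :=
    hφ.hasFDerivAt.comp p hasFDerivAt_fst
  have h2 : HasFDerivAt (fun q : X3 => h q.1) ((fderiv ℝ h p.1).comp (ContinuousLinearMap.fst ℝ Vec2 ℝ)) p :=
    hh.hasFDerivAt.comp p hasFDerivAt_fst
  have h3 : HasFDerivAt (fun q : X3 => q.2) (ContinuousLinearMap.snd ℝ Vec2 ℝ) p := hasFDerivAt_snd
  refine ⟨_, h1.prodMk (h3.fun_mul h2), ?_⟩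
  intro v
  simp
  ring

lemma fderiv_pair (φ h : Vec2 → ℝ) (p : X3) (hφ : DifferentiableAt ℝ φ p.1)
    (hh : DifferentiableAt ℝ h p.1) (v : X3) :
    fderiv ℝ (fun q : X3 => ((φ q.1, q.2 * h q.1) : Vec2)) p v =
      (fderiv ℝ φ p.1 v.1, v.2 * h p.1 + p.2 * fderiv ℝ h p.1 v.1) := by
  obtain ⟨L, hL, hv⟩ := pair_hasFDerivAt φ h p hφ hh
  rw [hL.fderiv, hv]

lemma pair_surj (φ h : Vec2 → ℝ) (p : X3) (hφ : DifferentiableAt ℝ φ p.1)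
    (hh : DifferentiableAt ℝ h p.1) (h0 : fderiv ℝ φ p.1 ≠ 0) (h1 : h p.1 ≠ 0) :
    Function.Surjective (fderiv ℝ (fun q : X3 => ((φ q.1, q.2 * h q.1) : Vec2)) p) := by
  intro y
  obtain ⟨u, hu⟩ : ∃ u, fderiv ℝ φ p.1 u ≠ 0 := by
    by_contra! hc; exact h0 (by ext <;> simp [hc])
  refine ⟨((y.1 / fderiv ℝ φ p.1 u) • u,
    (y.2 - p.2 * fderiv ℝ h p.1 ((y.1 / fderiv ℝ φ p.1 u) • u)) / h p.1), ?_⟩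
  rw [fderiv_pair φ h p hφ hh]
  ext
  · simp [hu]
  · simp only; field_simp; ring

lemma pair_analytic (φ h : Vec2 → ℝ) (p : X3) (hφ : AnalyticAt ℝ φ p.1)
    (hh : AnalyticAt ℝ h p.1) :
    AnalyticAt ℝ (fun q : X3 => ((φ q.1, q.2 * h q.1) : Vec2)) p :=
  (hφ.fun_comp analyticAt_fst).prod (analyticAt_snd.fun_mul (hh.fun_comp analyticAt_fst))

namespace Geo
variable {c₀ : Vec2} {r₀ : ℝ} {B Bt : Set Vec2} {φ : Fin 4 → Vec2 → ℝ}
    {V : Fin 4 → Vec2 → Vec2} {W : Fin 4 → Fin 4 → (Vec2 × ℝ) → (Vec2 × ℝ)}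

lemma B_open (G : Geo c₀ r₀ B Bt φ V W) : IsOpen B := by rw [G.hB]; exact isOpen_ball

lemma BBt (G : Geo c₀ r₀ B Bt φ V W) {x} (hx : x ∈ B) : x ∈ Bt := G.hBBt (subset_closure hx)

lemma phi3 (G : Geo c₀ r₀ B Bt φ V W) : ∀ x ∈ Bt, φ 3 x = x.1 := by
  have hc : c₀ ∈ B := by rw [G.hB]; exact mem_ball_self G.hr₀
  exact (G.hφ_an 3).eqOn_of_preconnected_of_eventuallyEq (g := fun x => x.1)
    (fun x _ => analyticAt_fst) G.hBt_conn.isPreconnected (G.BBt hc)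
    (by filter_upwards [G.B_open.mem_nhds hc] with x hx using G.hφ4 x hx)

lemma fderiv_phi3 (G : Geo c₀ r₀ B Bt φ V W) (x) (hx : x ∈ Bt) (v : Vec2) :
    fderiv ℝ (φ 3) x v = v.1 := by
  have : φ 3 =ᶠ[𝓝 x] fun x => x.1 := by
    filter_upwards [G.hBt_open.mem_nhds hx] with y hy using G.phi3 y hy
  rw [this.fderiv_eq]
  have : HasFDerivAt (fun x : Vec2 => x.1) (ContinuousLinearMap.fst ℝ ℝ ℝ) x := hasFDerivAt_fst
  rw [this.fderiv]; rfl

lemma Dne (G : Geo c₀ r₀ B Bt φ V W) (x) (hx : x ∈ B) (j : Fin 4) (hj : j ≠ 3) :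
    Dder (φ j) x ≠ 0 := by
  intro h0
  have h1 := LinearIndependent.pair_iff.1 (G.htrans x hx j 3 hj) 1 (-(fderiv ℝ (φ j) x (1,0))) ?_
  · exact one_ne_zero h1.1
  · ext
    · simp [G.fderiv_phi3 x (G.BBt hx)]
    · simp [G.fderiv_phi3 x (G.BBt hx)]; exact h0

lemma kerW (G : Geo c₀ r₀ B Bt φ V W) (j k : Fin 4) (p : X3) (hp : p.1 ∈ Bt) :
    fderiv ℝ (φ j) p.1 (W j k p).1 = 0 ∧
    (W j k p).2 * fderiv ℝ (φ j) p.1 (V k p.1) +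
      p.2 * fderiv ℝ (fun x => fderiv ℝ (φ j) x (V k x)) p.1 (W j k p).1 = 0 := by
  have h := G.hW_ker j k p ⟨hp, mem_univ _⟩
  rw [fderiv_pair (φ j) (fun x => fderiv ℝ (φ j) x (V k x)) p (G.hφ_an j _ hp).differentiableAt
    (fderiv_field_analytic _ _ _ (G.hφ_an j _ hp) (G.hV_an k _ hp)).differentiableAt] at h
  exact ⟨congrArg Prod.fst h, congrArg Prod.snd h⟩

/-- the kernel for `j = 3` -/
lemma kerW3 (G : Geo c₀ r₀ B Bt φ V W) (k : Fin 4) (p : X3) (hp : p.1 ∈ Bt) :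
    (W 3 k p).1.1 = 0 ∧
    (W 3 k p).2 * (V k p.1).1 + p.2 * ((W 3 k p).1.2 * Dder (fun x => (V k x).1) p.1) = 0 := by
  obtain ⟨h1, h2⟩ := G.kerW 3 k p hp
  rw [G.fderiv_phi3 _ hp] at h1
  rw [G.fderiv_phi3 _ hp] at h2
  have : (fun x => fderiv ℝ (φ 3) x (V k x)) =ᶠ[𝓝 p.1] fun x => (V k x).1 := by
    filter_upwards [G.hBt_open.mem_nhds hp] with y hy using G.fderiv_phi3 y hy _
  rw [this.fderiv_eq, clm_vec2, h1, zero_mul, zero_add] at h2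
  exact ⟨h1, h2⟩

/-- `V_k` has nonzero first component iff `Dφ_k ≠ 0`. -/
lemma V1_iff (G : Geo c₀ r₀ B Bt φ V W) (k : Fin 4) (x) (hx : x ∈ Bt) :
    (V k x).1 = 0 ↔ Dder (φ k) x = 0 := by
  have h := G.hV_ker k x hx
  rw [clm_vec2] at h
  change _ + _ * Dder (φ k) x = 0 at h
  constructor
  · intro h0
    rw [h0, zero_mul, zero_add, mul_eq_zero] at h
    rcases h with h | h
    · exact absurd (Prod.ext h0 h) (G.hV_ne k x hx)
    · exact h
  · intro h0
    rw [h0, mul_zero, add_zero, mul_eq_zero] at h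
    rcases h with h | h
    · exact h
    · refine absurd ?_ (G.hφ_sub k x hx)
      ext
      · simpa using h
      · simpa [Dder] using h0

end Geo


lemma ode_zero (y : ℝ → ℝ) (hy : AnalyticAt ℝ y 0) (h0 : y 0 = 0) (M : ℝ)
    (hM : ∀ᶠ t in 𝓝 (0:ℝ), |deriv y t| ≤ M * |y t|) : ∀ᶠ t in 𝓝 (0:ℝ), y t = 0 := by
  obtain ⟨δ, hδ, hb⟩ := Metric.eventually_nhds_iff_ball.1 (hM.and hy.eventually_analyticAt)
  have hin : ∀ t ∈ Icc (0:ℝ) (δ/2), t ∈ ball (0:ℝ) δ := by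
    intro t ht
    rw [mem_ball, Real.dist_eq, sub_zero, abs_of_nonneg ht.1]; linarith [ht.2]
  have hz := eq_zero_of_abs_deriv_le_mul_abs_self_of_eq_zero_right (f := y) (f' := deriv y)
    (K := M) (a := 0) (b := δ/2)
    (fun t ht => (hb t (hin t ht)).2.continuousAt.continuousWithinAt)
    (fun t ht => (hb t (hin t ⟨ht.1, ht.2.le⟩)).2.differentiableAt.hasDerivAt.hasDerivWithinAt)
    h0 (fun t ht => by simpa using (hb t (hin t ⟨ht.1, ht.2.le⟩)).1)
  rw [← hy.frequently_zero_iff_eventually_zero]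
  have : ∃ᶠ t in 𝓝[>] (0:ℝ), y t = 0 := by
    apply Eventually.frequently
    filter_upwards [Ioo_mem_nhdsGT (show (0:ℝ) < δ/2 by positivity)] with t ht
    exact hz t ⟨ht.1.le, ht.2.le⟩
  exact this.filter_mono (nhdsWithin_mono _ (fun t ht => ne_of_gt ht))

lemma vert_hasDerivAt (f : Vec2 → ℝ) (x : Vec2) (t : ℝ) (hf : AnalyticAt ℝ f (x + t • (0,1))) :
    HasDerivAt (fun t : ℝ => f (x + t • ((0,1) : Vec2))) (Dder f (x + t • (0,1))) t :=
  dirD_hasDerivAt (0,1) f x t hf 0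

lemma vert_tendsto (x : Vec2) : Tendsto (fun t : ℝ => x + t • ((0,1) : Vec2)) (𝓝 0) (𝓝 x) := by
  have : Continuous (fun t : ℝ => x + t • ((0,1) : Vec2)) := by fun_prop
  simpa using this.tendsto 0

lemma vert_zero (f : Vec2 → ℝ) (x : Vec2) (hf : AnalyticAt ℝ f x) (h0 : f x = 0) (M : ℝ)
    (hM : ∀ᶠ t in 𝓝 (0:ℝ), |Dder f (x + t • (0,1))| ≤ M * |f (x + t • (0,1))|) :
    ∀ᶠ t in 𝓝 (0:ℝ), f (x + t • (0,1)) = 0 := by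
  have hx : x + (0:ℝ) • ((0,1):Vec2) = x := by simp
  apply ode_zero (fun t : ℝ => f (x + t • (0,1))) _ (by simpa using h0) M
  · filter_upwards [hM, (vert_tendsto x).eventually hf.eventually_analyticAt] with t h1 h2
    rw [(vert_hasDerivAt f x t h2).deriv]; exact h1
  · have h1 : AnalyticAt ℝ (fun t : ℝ => x + t • ((0,1) : Vec2)) 0 := by fun_prop
    exact AnalyticAt.fun_comp (g := f) (by simpa using hf) h1

lemma vert_const (f : Vec2 → ℝ) (x : Vec2) (hf : AnalyticAt ℝ f x)
    (hM : ∀ᶠ t in 𝓝 (0:ℝ), Dder f (x + t • (0,1)) = 0) :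
    ∀ᶠ y in 𝓝 x, y.1 = x.1 → f y - f x = 0 := by
  have h := vert_zero (fun y => f y - f x) x (hf.fun_sub analyticAt_const) (by simp) 0 (by
    filter_upwards [hM] with t ht
    simp only [Dder] at ht ⊢
    rw [fderiv_sub_const, ht]; simp)
  have h2 : Tendsto (fun y : Vec2 => y.2 - x.2) (𝓝 x) (𝓝 0) := by
    have : Continuous (fun y : Vec2 => y.2 - x.2) := by fun_prop
    simpa using this.tendsto x
  filter_upwards [h2.eventually h] with y hy h1
  have : x + (y.2 - x.2) • ((0,1):Vec2) = y := by ext <;> simp [h1]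
  rwa [this] at hy

namespace Geo
variable {c₀ : Vec2} {r₀ : ℝ} {B Bt : Set Vec2} {φ : Fin 4 → Vec2 → ℝ}
    {V : Fin 4 → Vec2 → Vec2} {W : Fin 4 → Fin 4 → (Vec2 × ℝ) → (Vec2 × ℝ)}

lemma W_cont (G : Geo c₀ r₀ B Bt φ V W) (j k : Fin 4) (p : X3) (hp : p.1 ∈ Bt) :
    ContinuousAt (W j k) p := (G.hW_an j k p ⟨hp, mem_univ _⟩).continuousAt

lemma W3_zero (G : Geo c₀ r₀ B Bt φ V W) (j : Fin 4) (hj : j ≠ 3) (x) (hx : x ∈ closure B) :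
    (W 3 j (x, 0)).2 = 0 := by
  have hc : ContinuousAt (fun y : Vec2 => (W 3 j (y, 0)).2) x :=
    continuousAt_snd.comp ((ContinuousAt.comp (f := fun y : Vec2 => (y, (0:ℝ)))
      (G.W_cont 3 j (x,0) (G.hBBt hx)) (by fun_prop)))
  have hB : ∀ y ∈ B, (W 3 j (y, 0)).2 = 0 := by
    intro y hy
    have h := (G.kerW3 j (y,0) (G.BBt hy)).2
    simp only [zero_mul, add_zero, mul_eq_zero] at h
    rcases h with h | h
    · exact h
    · exact absurd ((G.V1_iff j y (G.BBt hy)).1 h) (G.Dne y hy j hj)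
  have : MapsTo (fun y : Vec2 => (W 3 j (y, 0)).2) B {0} := hB
  have h2 := hc.continuousWithinAt.mem_closure hx this
  simpa using h2

lemma vert_line (G : Geo c₀ r₀ B Bt φ V W) (j : Fin 4) (hj : j ≠ 3) (x) (hx : x ∈ closure B)
    (h0 : Dder (φ j) x = 0) : ∀ᶠ y in 𝓝 x, y.1 = x.1 → φ j y - φ j x = 0 := by
  have hxt := G.hBBt hx
  have hw0 : (W 3 j (x,0)).1.2 ≠ 0 := by
    intro h
    apply G.hW_ne 3 j (x,0) ⟨hxt, mem_univ _⟩
    exact Prod.ext (Prod.ext (G.kerW3 j (x,0) hxt).1 h) (G.W3_zero j hj x hx)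
  obtain ⟨s, hs, hws⟩ : ∃ s : ℝ, s ≠ 0 ∧ (W 3 j (x,s)).1.2 ≠ 0 := by
    have hc : ContinuousAt (fun s : ℝ => (W 3 j (x, s)).1.2) 0 :=
      continuousAt_snd.comp (continuousAt_fst.comp ((ContinuousAt.comp (f := fun s : ℝ => (x, s))
        (G.W_cont 3 j (x,0) hxt) (by fun_prop))))
    have h1 : ∀ᶠ s in 𝓝[≠] (0:ℝ), (W 3 j (x,s)).1.2 ≠ 0 :=
      (hc.eventually_ne hw0).filter_mono nhdsWithin_le_nhds
    obtain ⟨s, hs1, hs2⟩ := (h1.and self_mem_nhdsWithin).exists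
    exact ⟨s, hs2, hs1⟩
  have hV1 : AnalyticAt ℝ (fun y => (V j y).1) x := analyticAt_fst.fun_comp (G.hV_an j x hxt)
  have hcW : ContinuousAt (fun y : Vec2 => W 3 j (y, s)) x :=
    ContinuousAt.comp (f := fun y : Vec2 => (y, s)) (G.W_cont 3 j (x,s) hxt) (by fun_prop)
  set γ : Vec2 → ℝ := fun y => (W 3 j (y,s)).2 / (s * (W 3 j (y,s)).1.2) with hγ
  have hγc : ContinuousAt γ x :=
    (continuousAt_snd.comp hcW).div (continuousAt_const.mul
      (continuousAt_snd.comp (continuousAt_fst.comp hcW))) (mul_ne_zero hs hws)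
  have hbd : ∀ᶠ y in 𝓝 x, |γ y| ≤ |γ x| + 1 := by
    have := hγc.abs.eventually_lt (continuousAt_const (y := |γ x| + 1)) (by linarith)
    exact this.mono fun _ h => h.le
  have hne : ∀ᶠ y in 𝓝 x, (W 3 j (y,s)).1.2 ≠ 0 :=
    (continuousAt_snd.comp (continuousAt_fst.comp hcW)).eventually_ne hws
  have hz := vert_zero (fun y => (V j y).1) x hV1 ((G.V1_iff j x hxt).2 h0) (|γ x| + 1) (by
    filter_upwards [(vert_tendsto x).eventually hbd, (vert_tendsto x).eventually hne,
      (vert_tendsto x).eventually (G.hBt_open.mem_nhds hxt)] with t h1 h2 h3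
    set y := x + t • ((0,1):Vec2) with hy
    have hk := (G.kerW3 j (y,s) h3).2
    simp only at hk
    have : Dder (fun x => (V j x).1) y = - (γ y * (V j y).1) := by
      simp only [hγ]; field_simp; linarith
    rw [this, abs_neg, abs_mul]
    exact mul_le_mul_of_nonneg_right h1 (abs_nonneg _))
  apply vert_const _ _ (G.hφ_an j x hxt)
  filter_upwards [hz, (vert_tendsto x).eventually (G.hBt_open.mem_nhds hxt)] with t h1 h2
  exact (G.V1_iff j _ h2).1 h1

lemma exists_k (G : Geo c₀ r₀ B Bt φ V W) (x) (hx : x ∈ Bt) :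
    ∃ k : Fin 4, k ≠ 3 ∧ Dder (φ k) x ≠ 0 := by
  by_contra! hc
  have hli := G.haux2 3 (x,1) hx one_ne_zero
  have hcard : Fintype.card {j : Fin 4 // j ≠ 3} = Module.finrank ℝ X3 := by
    simp
  have hspan := hli.span_eq_top_of_card_eq_finrank' hcard
  have hle : Submodule.span ℝ (range fun j : {j : Fin 4 // j ≠ 3} => W j.1 3 (x,1)) ≤
      LinearMap.ker ((ContinuousLinearMap.fst ℝ ℝ ℝ).comp (ContinuousLinearMap.fst ℝ Vec2 ℝ) : X3 →L[ℝ] ℝ).toLinearMap := by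
    rw [Submodule.span_le]
    rintro _ ⟨j, rfl⟩
    have h := (G.kerW j.1 3 (x,1) hx).1
    rw [clm_vec2] at h
    have hD := hc j.1 j.2
    simp only [Dder] at hD
    simp only [hD, mul_zero, add_zero, mul_eq_zero] at h
    rcases h with h | h
    · simpa using h
    · refine absurd ?_ (G.hφ_sub j.1 x hx)
      ext
      · simpa using h
      · simpa using hD
  rw [hspan] at hle
  have : (((1,0),0) : X3) ∈ LinearMap.ker ((ContinuousLinearMap.fst ℝ ℝ ℝ).comp (ContinuousLinearMap.fst ℝ Vec2 ℝ) : X3 →L[ℝ] ℝ).toLinearMap := hle trivial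
  simp at this

end Geo


namespace Geo
variable {c₀ : Vec2} {r₀ : ℝ} {B Bt : Set Vec2} {φ : Fin 4 → Vec2 → ℝ}
    {V : Fin 4 → Vec2 → Vec2} {W : Fin 4 → Fin 4 → (Vec2 × ℝ) → (Vec2 × ℝ)}

lemma key_h (G : Geo c₀ r₀ B Bt φ V W) (j : Fin 4) (hj : j ≠ 3) (x) (hx : x ∈ closure B) :
    ∃ (h : Vec2 → ℝ) (c0 c1 : ℝ), AnalyticAt ℝ h x ∧ h x ≠ 0 ∧
      ∀ᶠ y in 𝓝 x, Dder (φ j) y = h y * (c0 + c1 * φ j y) := by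
  have hxt := G.hBBt hx
  have hφa := G.hφ_an j x hxt
  by_cases h0 : Dder (φ j) x = 0
  swap
  · exact ⟨Dder (φ j), 1, 0, Dder_analytic _ _ hφa, h0, by simp⟩
  obtain ⟨e, hea, he⟩ := analytic_division (fun y => φ j y - φ j x) x
    (hφa.fun_sub analyticAt_const) (G.vert_line j hj x hx h0)
  have hder : ∀ᶠ y in 𝓝 x, ∀ v, fderiv ℝ (φ j) y v = v.1 * e y + (y.1 - x.1) * fderiv ℝ e y v := by
    filter_upwards [he.eventually_nhds, hea.eventually_analyticAt] with y h1 h2 v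
    have h3 : φ j =ᶠ[𝓝 y] fun z => (z.1 - x.1) * e z + φ j x := by
      filter_upwards [h1] with z hz; linarith
    have h4 : HasFDerivAt (fun z : Vec2 => z.1 - x.1) (ContinuousLinearMap.fst ℝ ℝ ℝ) y :=
      hasFDerivAt_fst.sub_const _
    rw [h3.fderiv_eq, ((h4.fun_mul h2.differentiableAt.hasFDerivAt).add_const (φ j x)).fderiv]
    simp; ring
  have hex : e x ≠ 0 := by
    intro h
    apply G.hφ_sub j x hxt
    ext <;> simp [hder.self_of_nhds, h]
  have hDe : Dder e x ≠ 0 := by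
    intro hDe
    obtain ⟨k, hk3, hkD⟩ := G.exists_k x hxt
    have hkj : k ≠ j := by rintro rfl; exact hkD h0
    have hV1 : (V k x).1 ≠ 0 := fun h => hkD ((G.V1_iff k x hxt).1 h)
    obtain ⟨a1, a2⟩ := G.kerW3 k (x,1) hxt
    obtain ⟨b1, b2⟩ := G.kerW j k (x,1) hxt
    simp only at a1 a2 b1 b2
    have b1' : (W j k (x,1)).1.1 = 0 := by
      rw [hder.self_of_nhds] at b1; simpa [hex] using b1
    rw [hder.self_of_nhds] at b2
    have hVa : AnalyticAt ℝ (fun y => (V k y).1) x := analyticAt_fst.fun_comp (G.hV_an k x hxt)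
    have hea2 := fderiv_field_analytic e (V k) x hea (G.hV_an k x hxt)
    have h5 : Dder (fun y => fderiv ℝ (φ j) y (V k y)) x = Dder (fun y => (V k y).1) x * e x := by
      have h3 : (fun y => fderiv ℝ (φ j) y (V k y)) =ᶠ[𝓝 x]
          fun y => (V k y).1 * e y + (y.1 - x.1) * fderiv ℝ e y (V k y) := by
        filter_upwards [hder] with y hy using hy _
      have h4 : HasFDerivAt (fun z : Vec2 => z.1 - x.1) (ContinuousLinearMap.fst ℝ ℝ ℝ) x :=
        hasFDerivAt_fst.sub_const _
      simp only [Dder] at hDe ⊢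
      rw [h3.fderiv_eq, ((hVa.differentiableAt.hasFDerivAt.fun_mul
        hea.differentiableAt.hasFDerivAt).fun_add (h4.fun_mul
        hea2.differentiableAt.hasFDerivAt)).fderiv]
      simp [hDe]; ring
    rw [clm_vec2 (fderiv ℝ (fun x => fderiv ℝ (φ j) x (V k x)) x), b1', zero_mul, zero_add] at b2
    change _ + 1 * (_ * Dder _ x) = 0 at b2
    rw [h5] at b2
    simp only [sub_self, zero_mul, add_zero, one_mul] at b2 a2
    have b3 : (W j k (x,1)).2 * (V k x).1 + (W j k (x,1)).1.2 * Dder (fun y => (V k y).1) x = 0 := by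
      apply mul_right_cancel₀ hex; linarith
    have hli := G.haux2 k (x,1) hxt one_ne_zero
    have hpair := LinearIndependent.pair_iff.1 ((LinearIndependent.pair_iff.2
      ((LinearIndepOn.pair_iff (i := (⟨j, hkj.symm⟩ : {j : Fin 4 // j ≠ k})) (j := ⟨3, hk3.symm⟩)
      _ (by intro h; exact hj (congrArg Subtype.val h))).1 (hli.linearIndepOn _))))
    have := hpair (W 3 k (x,1)).1.2 (-(W j k (x,1)).1.2) (by
      refine Prod.ext (Prod.ext ?_ ?_) ?_
      · simp [a1, b1']
      · simp; ring
      · simp only [Prod.snd_add, Prod.smul_snd, smul_eq_mul, Prod.snd_zero]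
        apply mul_right_cancel₀ hV1
        linear_combination (W 3 k (x,1)).1.2 * b3 - (W j k (x,1)).1.2 * a2)
    apply G.hW_ne 3 k (x,1) ⟨hxt, mem_univ _⟩
    refine Prod.ext (Prod.ext a1 this.1) ?_
    rw [this.1, zero_mul, add_zero, mul_eq_zero] at a2
    exact a2.resolve_right hV1
  refine ⟨fun y => Dder e y / e y, -φ j x, 1, (Dder_analytic e x hea).fun_div hea hex,
    div_ne_zero hDe hex, ?_⟩
  filter_upwards [hder, he, hea.continuousAt.eventually_ne hex] with y h1 h2 h3
  have h4 : Dder (φ j) y = (y.1 - x.1) * Dder e y := by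
    simp only [Dder]; rw [h1]; simp
  rw [h4]; field_simp
  linear_combination -Dder e y * h2

end Geo


/-- the linear map `DΘ` -/
def dTheta (v0 t : ℝ) (L : Vec2 →L[ℝ] ℝ) : X3 →L[ℝ] X3 :=
  (ContinuousLinearMap.fst ℝ Vec2 ℝ).prod
    (v0 • ContinuousLinearMap.snd ℝ Vec2 ℝ + t • L.comp (ContinuousLinearMap.fst ℝ Vec2 ℝ))

lemma dTheta_apply (v0 t : ℝ) (L : Vec2 →L[ℝ] ℝ) (p : X3) :
    dTheta v0 t L p = (p.1, v0 * p.2 + t * L p.1) := by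
  simp [dTheta]

lemma dTheta_ker (v0 t : ℝ) (L : Vec2 →L[ℝ] ℝ) (h : v0 ≠ 0) :
    LinearMap.ker (dTheta v0 t L).toLinearMap = ⊥ := by
  rw [LinearMap.ker_eq_bot']
  intro p hp
  have h1 : dTheta v0 t L p = 0 := hp
  rw [dTheta_apply] at h1
  have h2 : p.1 = 0 := congrArg Prod.fst h1
  have h3 : v0 * p.2 + t * L p.1 = 0 := congrArg Prod.snd h1
  rw [h2] at h3
  simp [h] at h3
  exact Prod.ext h2 h3

namespace Geo
variable {c₀ : Vec2} {r₀ : ℝ} {B Bt : Set Vec2} {φ : Fin 4 → Vec2 → ℝ}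
    {V : Fin 4 → Vec2 → Vec2} {W : Fin 4 → Fin 4 → (Vec2 × ℝ) → (Vec2 × ℝ)}

lemma V3_1 (G : Geo c₀ r₀ B Bt φ V W) (x) (hx : x ∈ Bt) : (V 3 x).1 = 0 := by
  have := G.hV_ker 3 x hx
  rwa [G.fderiv_phi3 x hx] at this

lemma V3_2 (G : Geo c₀ r₀ B Bt φ V W) (x) (hx : x ∈ Bt) : (V 3 x).2 ≠ 0 := by
  intro h
  exact G.hV_ne 3 x hx (Prod.ext (G.V3_1 x hx) h)

lemma local_j (G : Geo c₀ r₀ B Bt φ V W) (j : Fin 4) (hj : j ≠ 3) (x) (hx : x ∈ closure B)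
    (t : ℝ) :
    ∃ Q : X3 → Vec2, AnalyticAt ℝ Q (x, t * (V 3 x).2) ∧
      Function.Surjective (fderiv ℝ Q (x, t * (V 3 x).2)) ∧
      fderiv ℝ Q (x, t * (V 3 x).2)
        (dTheta (V 3 x).2 t (fderiv ℝ (fun y => (V 3 y).2) x) (W j 3 (x,t))) = 0 ∧
      ∀ᶠ pp in 𝓝 (((x, t * (V 3 x).2), (x, t * (V 3 x).2)) : X3 × X3), pp.1.1 ∈ B → pp.2.1 ∈ B →
        (Q pp.1 = Q pp.2 ↔ Φmap (φ j) pp.1 = Φmap (φ j) pp.2) := by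
  have hxt := G.hBBt hx
  obtain ⟨h, c0, c1, hha, hh0, hh⟩ := G.key_h j hj x hx
  have hφa := G.hφ_an j x hxt
  set v : Vec2 → ℝ := fun y => (V 3 y).2 with hv
  have hva : AnalyticAt ℝ v x := analyticAt_snd.fun_comp (G.hV_an 3 x hxt)
  refine ⟨fun q => (φ j q.1, q.2 * h q.1), pair_analytic _ _ _ hφa hha,
    pair_surj _ _ _ hφa.differentiableAt hha.differentiableAt (G.hφ_sub j x hxt) hh0, ?_, ?_⟩
  · rw [dTheta_apply, fderiv_pair _ _ _ hφa.differentiableAt hha.differentiableAt]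
    simp only
    set F : Vec2 → ℝ := fun y => (W j 3 (y,t)).2 * v y * h y +
      t * (h y * fderiv ℝ v y (W j 3 (y,t)).1 + v y * fderiv ℝ h y (W j 3 (y,t)).1) with hF
    have hWa : AnalyticAt ℝ (fun y : Vec2 => W j 3 (y,t)) x :=
      AnalyticAt.fun_comp (g := W j 3) (G.hW_an j 3 (x,t) ⟨hxt, mem_univ _⟩)
        (analyticAt_id.prod analyticAt_const)
    have hW1 : AnalyticAt ℝ (fun y : Vec2 => (W j 3 (y,t)).1) x := analyticAt_fst.fun_comp hWa
    have hW2 : AnalyticAt ℝ (fun y : Vec2 => (W j 3 (y,t)).2) x := analyticAt_snd.fun_comp hWa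
    have hFa : AnalyticAt ℝ F x :=
      ((hW2.fun_mul hva).fun_mul hha).fun_add (analyticAt_const.fun_mul
        ((hha.fun_mul (fderiv_field_analytic v _ x hva hW1)).fun_add
          (hva.fun_mul (fderiv_field_analytic h _ x hha hW1))))
    have hk := G.kerW j 3 (x,t) hxt
    have hloc : ∀ᶠ y in 𝓝 x, y ∈ B → F y = 0 := by
      filter_upwards [hh.eventually_nhds, hha.eventually_analyticAt, hva.eventually_analyticAt,
        hh] with y h1 h2 h3 h4 hyB
      have hyt := G.BBt hyB
      obtain ⟨k1, k2⟩ := G.kerW j 3 (y,t) hyt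
      simp only at k1 k2
      have hχ : c0 + c1 * φ j y ≠ 0 := by
        intro h0; rw [h0, mul_zero] at h4; exact G.Dne y hyB j hj h4
      have he : (fun z => fderiv ℝ (φ j) z (V 3 z)) =ᶠ[𝓝 y]
          fun z => (v z * h z) * (c0 + c1 * φ j z) := by
        filter_upwards [h1, G.hBt_open.mem_nhds hyt] with z hz1 hz2
        rw [clm_vec2, G.V3_1 z hz2, zero_mul, zero_add]
        change v z * Dder (φ j) z = _
        rw [hz1]; ring
      have hφy := (G.hφ_an j y hyt).differentiableAt.hasFDerivAt
      rw [he.eq_of_nhds, he.fderiv_eq, ((h3.differentiableAt.hasFDerivAt.fun_mul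
        h2.differentiableAt.hasFDerivAt).fun_mul ((hφy.const_mul c1).const_add c0)).fderiv] at k2
      simp [k1] at k2
      apply mul_left_cancel₀ hχ
      simp only [hF]
      rw [mul_zero, ← k2]; ring
    have hF0 : F x = 0 := by
      have hc := hFa.continuousAt
      by_contra hne
      have h1 := hc.eventually_ne hne
      obtain ⟨y, hy, hyB⟩ := mem_closure_iff_nhds.1 hx _ (hloc.and h1)
      exact hy.2 (hy.1 hyB)
    rw [hk.1]
    refine Prod.ext rfl ?_
    simp only [Prod.snd_zero]
    rw [← hF0]; simp only [hF]; ring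
  · have e1 : Tendsto (fun pp : X3 × X3 => pp.1.1) (𝓝 (((x, t * (V 3 x).2), (x, t * (V 3 x).2)) : X3 × X3)) (𝓝 x) :=
      Continuous.tendsto (by fun_prop) _
    have e2 : Tendsto (fun pp : X3 × X3 => pp.2.1) (𝓝 (((x, t * (V 3 x).2), (x, t * (V 3 x).2)) : X3 × X3)) (𝓝 x) :=
      Continuous.tendsto (by fun_prop) _
    filter_upwards [e1.eventually hh, e2.eventually hh] with pp h1 h2 b1 b2
    have hχ : c0 + c1 * φ j pp.1.1 ≠ 0 := by
      intro h0; rw [h0, mul_zero] at h1; exact G.Dne _ b1 j hj h1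
    simp only [Φmap, Prod.mk.injEq]
    refine and_congr_right fun heq => ?_
    rw [h1, h2, ← heq, ← mul_assoc, ← mul_assoc]
    exact (mul_left_inj' hχ).symm

lemma local_geo (G : Geo c₀ r₀ B Bt φ V W) (x) (hx : x ∈ closure B) (s : ℝ) (hs : s ≠ 0) :
    ∃ (Q : Fin 3 → X3 → Vec2) (w : Fin 3 → X3), (∀ j, AnalyticAt ℝ (Q j) (x, s)) ∧
      (∀ j, Function.Surjective (fderiv ℝ (Q j) (x, s))) ∧
      (∀ j, fderiv ℝ (Q j) (x, s) (w j) = 0) ∧ LinearIndependent ℝ w ∧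
      ∀ j, ∀ᶠ pp in 𝓝 (((x, s), (x, s)) : X3 × X3), pp.1.1 ∈ B → pp.2.1 ∈ B →
        (Q j pp.1 = Q j pp.2 ↔ Φmap (φ j.castSucc) pp.1 = Φmap (φ j.castSucc) pp.2) := by
  have hxt := G.hBBt hx
  have hv0 := G.V3_2 x hxt
  have hst : s / (V 3 x).2 * (V 3 x).2 = s := div_mul_cancel₀ _ hv0
  have hj3 : ∀ j : Fin 3, j.castSucc ≠ 3 := by decide
  have h := fun j : Fin 3 => G.local_j j.castSucc (hj3 j) x hx (s / (V 3 x).2)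
  rw [hst] at h
  choose Q h1 h2 h3 h4 using h
  refine ⟨Q, _, h1, h2, h3, ?_, h4⟩
  have hli := G.haux2 3 (x, s / (V 3 x).2) hxt (div_ne_zero hs hv0)
  have hli2 := hli.comp (fun j : Fin 3 => (⟨j.castSucc, hj3 j⟩ : {j : Fin 4 // j ≠ 3}))
    (by intro a b hab; exact Fin.castSucc_injective _ (congrArg Subtype.val hab))
  exact hli2.map' (dTheta (V 3 x).2 (s / (V 3 x).2) (fderiv ℝ (fun y => (V 3 y).2) x)).toLinearMap
    (dTheta_ker _ _ _ hv0)

end Geo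


lemma exists_section (p1 : X3) (Q : X3 → Vec2) (hQ : AnalyticAt ℝ Q p1)
    (hs : Function.Surjective (fderiv ℝ Q p1)) :
    ∃ σ : Vec2 → X3, AnalyticAt ℝ σ (Q p1) ∧ σ (Q p1) = p1 ∧ ∀ᶠ y in 𝓝 (Q p1), Q (σ y) = y := by
  obtain ⟨w, hw0, hw⟩ : ∃ w : X3, w ≠ 0 ∧ fderiv ℝ Q p1 w = 0 := by
    have h := LinearMap.ker_ne_bot_of_finrank_lt (f := (fderiv ℝ Q p1 : X3 →ₗ[ℝ] Vec2)) (by simp)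
    obtain ⟨w, hw, hw0⟩ := Submodule.exists_mem_ne_zero_of_ne_bot h
    exact ⟨w, hw0, hw⟩
  obtain ⟨ℓ, A, hℓ, hA⟩ := exists_equiv_of_surj _ hs w hw0 hw
  set Ψ : X3 → X3 := fun p => (Q p, ℓ p) with hΨ
  have hΨan : AnalyticAt ℝ Ψ p1 := hQ.prod (ℓ.analyticAt p1)
  have hΨd : HasStrictFDerivAt Ψ (A : X3 →L[ℝ] X3) p1 := by
    rw [hA]; exact hQ.hasStrictFDerivAt.prodMk ℓ.hasStrictFDerivAt
  set e := hΨd.toOpenPartialHomeomorph with he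
  have hecoe : ⇑e = Ψ := hΨd.toOpenPartialHomeomorph_coe
  have hsrc : p1 ∈ e.source := hΨd.mem_toOpenPartialHomeomorph_source
  have hχan : AnalyticAt ℝ e.symm (Ψ p1) := by
    have := e.analyticAt_symm' hsrc (by rw [hecoe]; exact hΨan) (i := A)
      (by rw [hecoe]; exact hΨd.hasFDerivAt.fderiv)
    rwa [hecoe] at this
  have hleft : ∀ᶠ p in 𝓝 p1, e.symm (Ψ p) = p := by
    have := e.eventually_left_inverse hsrc; rwa [hecoe] at this
  have hright : ∀ᶠ q in 𝓝 (Ψ p1), Ψ (e.symm q) = q := by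
    have h := e.eventually_right_inverse (x := Ψ p1) (by rw [← hecoe]; exact e.map_source hsrc)
    rwa [hecoe] at h
  refine ⟨fun y => e.symm (y, ℓ p1), AnalyticAt.fun_comp (g := e.symm) hχan
    (analyticAt_id.prod analyticAt_const), hleft.self_of_nhds, ?_⟩
  have ht : Tendsto (fun y : Vec2 => (y, ℓ p1)) (𝓝 (Q p1)) (𝓝 (Ψ p1)) :=
    Continuous.tendsto (by fun_prop) _
  filter_upwards [ht.eventually hright] with y hy
  exact congrArg Prod.fst hy

def dd (φ : Fin 4 → Vec2 → ℝ) (j k : Fin 4) (x : Vec2) : ℝ :=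
  fderiv ℝ (φ j) x (1,0) * fderiv ℝ (φ k) x (0,1) - fderiv ℝ (φ j) x (0,1) * fderiv ℝ (φ k) x (1,0)

def mfun (φ : Fin 4 → Vec2 → ℝ) (j : Fin 3) (p : X3) : ℝ :=
  dd φ (j+1).castSucc (j+2).castSucc p.1

lemma mfun_sum (φ : Fin 4 → Vec2 → ℝ) (p : X3) :
    ∑ j : Fin 3, mfun φ j p • fderiv ℝ (φ j.castSucc) p.1 = 0 := by
  ext <;> simp [Fin.sum_univ_three, mfun, dd] <;> ring

namespace Geo
variable {c₀ : Vec2} {r₀ : ℝ} {B Bt : Set Vec2} {φ : Fin 4 → Vec2 → ℝ}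
    {V : Fin 4 → Vec2 → Vec2} {W : Fin 4 → Fin 4 → (Vec2 × ℝ) → (Vec2 × ℝ)}

lemma dd_analytic (G : Geo c₀ r₀ B Bt φ V W) (j k : Fin 4) (x) (hx : x ∈ Bt) :
    AnalyticAt ℝ (dd φ j k) x := by
  have h := fun j v => fderiv_dir_analytic (φ j) v x (G.hφ_an j x hx)
  exact ((h j _).fun_mul (h k _)).fun_sub ((h j _).fun_mul (h k _))

lemma mfun_analytic (G : Geo c₀ r₀ B Bt φ V W) (j : Fin 3) (p : X3) (hp : p.1 ∈ Bt) :
    AnalyticAt ℝ (mfun φ j) p :=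
  AnalyticAt.fun_comp (g := dd φ (j+1).castSucc (j+2).castSucc) (f := Prod.fst) (G.dd_analytic _ _ _ hp) analyticAt_fst

lemma dd_ne (G : Geo c₀ r₀ B Bt φ V W) (j k : Fin 4) (hjk : j ≠ k) (x) (hx : x ∈ B) :
    dd φ j k x ≠ 0 := by
  intro h0
  simp only [dd] at h0
  have hli := LinearIndependent.pair_iff.1 (G.htrans x hx j k hjk)
  have h1 := hli (fderiv ℝ (φ k) x (1,0)) (-fderiv ℝ (φ j) x (1,0)) (by
    ext
    · simp; ring
    · simp; linarith)
  have h2 := hli (fderiv ℝ (φ k) x (0,1)) (-fderiv ℝ (φ j) x (0,1)) (by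
    ext
    · simp; linarith
    · simp; ring)
  apply G.hφ_sub k x (G.BBt hx)
  ext
  · simpa using h1.1
  · simpa using h2.1

lemma mfun_ne (G : Geo c₀ r₀ B Bt φ V W) (j : Fin 3) (p : X3) (hp : p.1 ∈ B) :
    mfun φ j p ≠ 0 := by
  apply G.dd_ne _ _ _ _ hp
  revert j; decide

lemma Phi_analytic (G : Geo c₀ r₀ B Bt φ V W) (j : Fin 4) (p : X3) (hp : p.1 ∈ Bt) :
    AnalyticAt ℝ (Φmap (φ j)) p :=
  pair_analytic _ _ _ (G.hφ_an j _ hp) (Dder_analytic _ _ (G.hφ_an j _ hp))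

lemma Phi_surj (G : Geo c₀ r₀ B Bt φ V W) (j : Fin 4) (hj : j ≠ 3) (p : X3) (hp : p.1 ∈ B) :
    Function.Surjective (fderiv ℝ (Φmap (φ j)) p) :=
  have ha := G.hφ_an j _ (G.BBt hp)
  pair_surj _ _ _ ha.differentiableAt (Dder_analytic _ _ ha).differentiableAt
    (G.hφ_sub j _ (G.BBt hp)) (G.Dne _ hp j hj)

lemma no_sol (G : Geo c₀ r₀ B Bt φ V W)
    (hnosol : ∀ U : Set (Vec2 × ℝ), IsOpen U → U.Nonempty → U ⊆ {p : Vec2 × ℝ | p.1 ∈ B} →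
      ∀ g : Fin 3 → Vec2 → ℝ,
      (∀ j : Fin 3, AnalyticOnNhd ℝ (g j) (Φmap (φ j.castSucc) '' U)) →
      (∀ p ∈ U, ∑ j : Fin 3, g j (Φmap (φ j.castSucc) p) • fderiv ℝ (φ j.castSucc) p.1 = 0) →
      ∀ j : Fin 3, ∀ p ∈ U, g j (Φmap (φ j.castSucc) p) = 0)
    (p1 : X3) (hp1 : p1.1 ∈ B) (K : X3 → ℝ) (hK : AnalyticAt ℝ K p1) (hK0 : K p1 ≠ 0) :
    ¬ ∀ j : Fin 3, ∀ᶠ pp in 𝓝 (p1, p1), Φmap (φ j.castSucc) pp.1 = Φmap (φ j.castSucc) pp.2 →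
      K pp.1 * mfun φ j pp.1 = K pp.2 * mfun φ j pp.2 := by
  intro hcon
  have hj3 : ∀ j : Fin 3, j.castSucc ≠ 3 := by decide
  have hsec := fun j : Fin 3 => exists_section p1 (Φmap (φ j.castSucc))
    (G.Phi_analytic _ p1 (G.BBt hp1)) (G.Phi_surj _ (hj3 j) p1 hp1)
  choose σ hσa hσ1 hσ using hsec
  set g : Fin 3 → Vec2 → ℝ := fun j y => K (σ j y) * mfun φ j (σ j y) with hg
  have hga : ∀ j, AnalyticAt ℝ (g j) (Φmap (φ j.castSucc) p1) := by
    intro j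
    have h1 : AnalyticAt ℝ (fun p => K p * mfun φ j p) (σ j (Φmap (φ j.castSucc) p1)) := by
      rw [hσ1]; exact hK.fun_mul (G.mfun_analytic j p1 (G.BBt hp1))
    exact AnalyticAt.fun_comp (g := fun p => K p * mfun φ j p) h1 (hσa j)
  have hΦc : ∀ j : Fin 3, Tendsto (Φmap (φ j.castSucc)) (𝓝 p1) (𝓝 (Φmap (φ j.castSucc) p1)) :=
    fun j => (G.Phi_analytic _ p1 (G.BBt hp1)).continuousAt
  have hgK : ∀ j : Fin 3, ∀ᶠ p in 𝓝 p1, g j (Φmap (φ j.castSucc) p) = K p * mfun φ j p := by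
    intro j
    have h1 : Tendsto (fun p => (σ j (Φmap (φ j.castSucc) p), p)) (𝓝 p1) (𝓝 (p1, p1)) := by
      have h2 : Tendsto (fun p => σ j (Φmap (φ j.castSucc) p)) (𝓝 p1) (𝓝 p1) := by
        have h3 : Tendsto (σ j) (𝓝 (Φmap (φ j.castSucc) p1)) (𝓝 p1) := by
          have := (hσa j).continuousAt.tendsto; rwa [hσ1] at this
        exact h3.comp (hΦc j)
      exact h2.prodMk_nhds tendsto_id
    filter_upwards [h1.eventually (hcon j), (hΦc j).eventually (hσ j)] with p h2 h3
    exact h2 h3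
  have hall : ∀ᶠ p in 𝓝 p1, p.1 ∈ B ∧ ∀ j : Fin 3, g j (Φmap (φ j.castSucc) p) = K p * mfun φ j p ∧
      AnalyticAt ℝ (g j) (Φmap (φ j.castSucc) p) := by
    have hB : ∀ᶠ p in 𝓝 p1, p.1 ∈ B :=
      (continuous_fst.tendsto p1).eventually (G.B_open.mem_nhds hp1)
    refine hB.and (eventually_all.2 fun j => (hgK j).and ?_)
    exact (hΦc j).eventually (hga j).eventually_analyticAt
  obtain ⟨U, hU, hUo, hU1⟩ := _root_.eventually_nhds_iff.1 hall
  have := hnosol U hUo ⟨p1, hU1⟩ (fun p hp => (hU p hp).1) g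
    (by rintro j _ ⟨p, hp, rfl⟩; exact ((hU p hp).2 j).2)
    (by
      intro p hp
      have h2 : ∀ j : Fin 3, g j (Φmap (φ j.castSucc) p) • fderiv ℝ (φ j.castSucc) p.1 =
          K p • (mfun φ j p • fderiv ℝ (φ j.castSucc) p.1) := by
        intro j; rw [((hU p hp).2 j).1, mul_smul]
      rw [Finset.sum_congr rfl fun j _ => h2 j, ← Finset.smul_sum, mfun_sum, smul_zero])
    0 p1 hU1
  rw [((hU p1 hU1).2 0).1] at this
  exact mul_ne_zero hK0 (G.mfun_ne 0 p1 hp1) this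

end Geo


def badset (φ : Fin 4 → Vec2 → ℝ) (B : Set Vec2) (f : Fin 3 → Vec2 → ℝ) (i : Fin 3) (ε : ℝ) : Set X3 :=
  {p | p.1 ∈ B ∧ 1 ≤ |f i (Φmap (φ i.castSucc) p)| ∧
    |∑ j : Fin 3, f j (Φmap (φ j.castSucc) p) * fderiv ℝ (φ j.castSucc) p.1 (1,0)| ≤ ε ∧
    |∑ j : Fin 3, f j (Φmap (φ j.castSucc) p) * fderiv ℝ (φ j.castSucc) p.1 (0,1)| ≤ ε}

lemma wedge (f a b m : Fin 3 → ℝ) (hm : ∀ j, m j = a (j+1) * b (j+2) - b (j+1) * a (j+2))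
    (M ε : ℝ) (ha : ∀ j, |a j| ≤ M) (hb : ∀ j, |b j| ≤ M)
    (h1 : |∑ j, f j * a j| ≤ ε) (h2 : |∑ j, f j * b j| ≤ ε) (j l : Fin 3) :
    |f j * m l - f l * m j| ≤ 2 * M * ε := by
  have hε : 0 ≤ ε := (abs_nonneg _).trans h1
  have hM : 0 ≤ M := (abs_nonneg _).trans (ha 0)
  have key : ∀ k, |(∑ j, f j * a j) * b k - (∑ j, f j * b j) * a k| ≤ 2 * M * ε := by
    intro k
    calc _ ≤ |(∑ j, f j * a j) * b k| + |(∑ j, f j * b j) * a k| := abs_sub _ _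
      _ ≤ ε * M + ε * M := by
        rw [abs_mul, abs_mul]
        exact add_le_add (mul_le_mul h1 (hb k) (abs_nonneg _) hε)
          (mul_le_mul h2 (ha k) (abs_nonneg _) hε)
      _ = _ := by ring
  have m0 : m 0 = a 1 * b 2 - b 1 * a 2 := hm 0
  have m1 : m 1 = a 2 * b 0 - b 2 * a 0 := hm 1
  have m2 : m 2 = a 0 * b 1 - b 0 * a 1 := hm 2
  have k0 := key 0
  have k1 := key 1
  have k2 := key 2
  simp only [Fin.sum_univ_three] at k0 k1 k2
  have e0 : |f 2 * m 1 - f 1 * m 2| ≤ 2 * M * ε := by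
    convert k0 using 2; rw [m1, m2]; ring
  have e1 : |f 0 * m 2 - f 2 * m 0| ≤ 2 * M * ε := by
    convert k1 using 2; rw [m0, m2]; ring
  have e2 : |f 1 * m 0 - f 0 * m 1| ≤ 2 * M * ε := by
    convert k2 using 2; rw [m0, m1]; ring
  have e3 : (0:ℝ) ≤ 2 * M * ε := by positivity
  fin_cases j <;> fin_cases l <;> simp only [Fin.zero_eta, Fin.mk_one, Fin.reduceFinMk, sub_self, abs_zero] <;>
    first | assumption | (rw [abs_sub_comm]; assumption)

namespace Geo
variable {c₀ : Vec2} {r₀ : ℝ} {B Bt : Set Vec2} {φ : Fin 4 → Vec2 → ℝ}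
    {V : Fin 4 → Vec2 → Vec2} {W : Fin 4 → Fin 4 → (Vec2 × ℝ) → (Vec2 × ℝ)}

lemma badset_meas (G : Geo c₀ r₀ B Bt φ V W) (f : Fin 3 → Vec2 → ℝ) (hf : ∀ j, Measurable (f j))
    (i : Fin 3) (ε : ℝ) : MeasurableSet (badset φ B f i ε) := by
  have hBm : MeasurableSet B := G.B_open.measurableSet
  have hφm : ∀ j, Measurable (B.indicator (φ j)) := by
    intro j
    have hc : ContinuousOn (φ j) B := fun x hx => (G.hφ_an j x (G.BBt hx)).continuousAt.continuousWithinAt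
    classical
    have := hc.measurable_piecewise (g := (0 : Vec2 → ℝ)) continuousOn_const hBm
    rwa [piecewise_eq_indicator] at this
  have hd : ∀ j (v : Vec2), Measurable (fun p : X3 => fderiv ℝ (φ j) p.1 v) := fun j v =>
    (measurable_fderiv_apply_const ℝ (φ j) v).comp measurable_fst
  have hg : ∀ j : Fin 3, Measurable (fun p : X3 =>
      f j (B.indicator (φ j.castSucc) p.1, p.2 * fderiv ℝ (φ j.castSucc) p.1 (0,1))) := fun j =>
    (hf j).comp (((hφm _).comp measurable_fst).prodMk (measurable_snd.mul (hd _ _)))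
  have : badset φ B f i ε = {p : X3 | p.1 ∈ B ∧
      1 ≤ |f i (B.indicator (φ i.castSucc) p.1, p.2 * fderiv ℝ (φ i.castSucc) p.1 (0,1))| ∧
    |∑ j : Fin 3, f j (B.indicator (φ j.castSucc) p.1, p.2 * fderiv ℝ (φ j.castSucc) p.1 (0,1)) * fderiv ℝ (φ j.castSucc) p.1 (1,0)| ≤ ε ∧
    |∑ j : Fin 3, f j (B.indicator (φ j.castSucc) p.1, p.2 * fderiv ℝ (φ j.castSucc) p.1 (0,1)) * fderiv ℝ (φ j.castSucc) p.1 (0,1)| ≤ ε} := by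
    ext p
    simp only [badset, mem_ofPred_eq]
    refine and_congr_right fun hp => ?_
    simp only [Φmap, Dder, indicator_of_mem hp]
  rw [this]
  have m1 : Measurable (fun p : X3 => |∑ j : Fin 3, f j (B.indicator (φ j.castSucc) p.1,
      p.2 * fderiv ℝ (φ j.castSucc) p.1 (0,1)) * fderiv ℝ (φ j.castSucc) p.1 (1,0)|) :=
    (Finset.measurable_fun_sum _ fun j _ => (hg j).mul (hd _ _)).norm
  have m2 : Measurable (fun p : X3 => |∑ j : Fin 3, f j (B.indicator (φ j.castSucc) p.1,
      p.2 * fderiv ℝ (φ j.castSucc) p.1 (0,1)) * fderiv ℝ (φ j.castSucc) p.1 (0,1)|) :=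
    (Finset.measurable_fun_sum _ fun j _ => (hg j).mul (hd _ _)).norm
  have m0 := (hg i).norm
  have s0 : MeasurableSet {p : X3 | p.1 ∈ B} := measurable_fst hBm
  have s1 := measurableSet_le (measurable_const (a := (1:ℝ))) m0
  have s2 := measurableSet_le m1 (measurable_const (a := ε))
  have s3 := measurableSet_le m2 (measurable_const (a := ε))
  exact s0.inter (s1.inter (s2.inter s3))

lemma mfun_meas (φ : Fin 4 → Vec2 → ℝ) (j : Fin 3) : Measurable (mfun φ j) := by
  have hd : ∀ j (v : Vec2), Measurable (fun p : X3 => fderiv ℝ (φ j) p.1 v) := fun j v =>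
    (measurable_fderiv_apply_const ℝ (φ j) v).comp measurable_fst
  exact ((hd _ _).mul (hd _ _)).sub ((hd _ _).mul (hd _ _))

lemma mem_closure_O (x : Vec2) (s : ℝ) (hx : x ∈ closure B) :
    ((x, s) : X3) ∈ closure {p : X3 | p.1 ∈ B} := by
  have : {p : X3 | p.1 ∈ B} = B ×ˢ (univ : Set ℝ) := by ext; simp
  rw [this, closure_prod_eq]
  exact ⟨hx, by simp⟩

lemma main_part (G : Geo c₀ r₀ B Bt φ V W)
    (hnosol : ∀ U : Set (Vec2 × ℝ), IsOpen U → U.Nonempty → U ⊆ {p : Vec2 × ℝ | p.1 ∈ B} →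
      ∀ g : Fin 3 → Vec2 → ℝ,
      (∀ j : Fin 3, AnalyticOnNhd ℝ (g j) (Φmap (φ j.castSucc) '' U)) →
      (∀ p ∈ U, ∑ j : Fin 3, g j (Φmap (φ j.castSucc) p) • fderiv ℝ (φ j.castSucc) p.1 = 0) →
      ∀ j : Fin 3, ∀ p ∈ U, g j (Φmap (φ j.castSucc) p) = 0)
    (x) (hx : x ∈ closure B) (s : ℝ) (hs : s ≠ 0) :
    ∃ N ∈ 𝓝 ((x, s) : X3), ∃ C κ : ℝ, 0 < κ ∧ 0 ≤ C ∧ ∀ ε : ℝ, 0 < ε → ε ≤ 1 → ∀ E ⊆ N,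
      MeasurableSet E → (∀ p ∈ E, p.1 ∈ B) → ∀ K : X3 → ℝ, (∀ p ∈ E, K p ≠ 0) →
      (∀ j : Fin 3, ∀ p ∈ E, ∀ p' ∈ E, Φmap (φ j.castSucc) p = Φmap (φ j.castSucc) p' →
        |K p * mfun φ j p - K p' * mfun φ j p'| ≤ ε * |K p' * mfun φ j p'|) →
      volume E ≤ ENNReal.ofReal (C * ε ^ κ) := by
  have hxt := G.hBBt hx
  obtain ⟨Q, w, hQ, hQs, hw, hli, heq⟩ := G.local_geo x hx s hs
  obtain ⟨N, hN, C, κ, hκ, hC, h⟩ := thmA (x,s) Q hQ hQs w hw hli (mfun φ)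
    (fun j => G.mfun_analytic j (x,s) hxt) {p : X3 | p.1 ∈ B} (mem_closure_O x s hx)
    (Eventually.of_forall fun p hp j => G.mfun_ne j p hp) (by
      have h1 : ∀ j, ∀ᶠ p1 in 𝓝 ((x,s) : X3), ∀ᶠ pp in 𝓝 ((p1, p1) : X3 × X3), pp.1.1 ∈ B → pp.2.1 ∈ B →
        (Q j pp.1 = Q j pp.2 ↔ Φmap (φ j.castSucc) pp.1 = Φmap (φ j.castSucc) pp.2) := by
        intro j
        have ht : Tendsto (fun p1 : X3 => (p1, p1)) (𝓝 (x,s)) (𝓝 ((x,s),(x,s))) :=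
          Continuous.tendsto (by fun_prop) _
        exact ht.eventually (heq j).eventually_nhds
      filter_upwards [eventually_all.2 h1] with p1 h2 hp1 K hK hK0 hcon
      refine G.no_sol hnosol p1 hp1 K hK hK0 fun j => ?_
      have hp1' : p1.1 ∈ B := hp1
      have b1 : ∀ᶠ pp in 𝓝 ((p1, p1) : X3 × X3), pp.1.1 ∈ B :=
        (Continuous.tendsto (f := fun pp : X3 × X3 => pp.1.1) (by fun_prop) (p1,p1)).eventually
          (G.B_open.mem_nhds hp1')
      have b2 : ∀ᶠ pp in 𝓝 ((p1, p1) : X3 × X3), pp.2.1 ∈ B :=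
        (Continuous.tendsto (f := fun pp : X3 × X3 => pp.2.1) (by fun_prop) (p1,p1)).eventually
          (G.B_open.mem_nhds hp1')
      filter_upwards [h2 j, hcon j, b1, b2] with pp h3 h4 h5 h6 h7
      exact h4 ((h3 h5 h6).2 h7))
  obtain ⟨N1, hN1, hN1p⟩ : ∃ N1 ∈ 𝓝 ((x,s) : X3), ∀ p ∈ N1, ∀ p' ∈ N1, ∀ j : Fin 3, p.1 ∈ B → p'.1 ∈ B →
      (Q j p = Q j p' ↔ Φmap (φ j.castSucc) p = Φmap (φ j.castSucc) p') := by
    have h2 := eventually_all.2 heq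
    rw [nhds_prod_eq, eventually_prod_self_iff'] at h2
    obtain ⟨t, ht, h3⟩ := h2
    exact ⟨t, ht, fun p hp p' hp' j => h3 p hp p' hp' j⟩
  refine ⟨N ∩ N1, inter_mem hN hN1, C, κ, hκ, hC, ?_⟩
  intro ε hε hε1 E hE hEm hEB K hK hKE
  apply h ε hε hε1 E (hE.trans inter_subset_left) hEm K hK
  intro j p hp p' hp' hq
  exact hKE j p hp p' hp' ((hN1p p (hE hp).2 p' (hE hp').2 j (hEB p hp) (hEB p' hp')).1 hq)

end Geo


/-- pure algebra: comparison of `K m` at two points -/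
lemma K_compare (M M2 ε η : ℝ) (hM2 : 0 < M2) (hη : 0 < η)
    (F f f' mi mi' m m' : ℝ) (hmi : η < |mi|) (hmi' : η < |mi'|)
    (hm' : η < |m'|) (hM2' : |mi'| ≤ M2)
    (h1 : |F * mi - f * m| ≤ 2 * M * ε) (h2 : |F * mi' - f' * m'| ≤ 2 * M * ε) (hf' : 1 ≤ |f'|) :
    |f / mi * m - f' / mi' * m'| ≤ (4 * M * M2 * (ε / η ^ 2)) * |f' / mi' * m'| := by
  have a0 : mi ≠ 0 := by intro h; rw [h, abs_zero] at hmi; linarith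
  have a0' : mi' ≠ 0 := by intro h; rw [h, abs_zero] at hmi'; linarith
  have hMε : 0 ≤ 2 * M * ε := (abs_nonneg _).trans h1
  have e1 : |f / mi * m - F| ≤ 2 * M * ε / η := by
    have : f / mi * m - F = -((F * mi - f * m) / mi) := by field_simp; ring
    rw [this, abs_neg, abs_div]
    exact div_le_div₀ hMε h1 hη hmi.le
  have e2 : |f' / mi' * m' - F| ≤ 2 * M * ε / η := by
    have : f' / mi' * m' - F = -((F * mi' - f' * m') / mi') := by field_simp; ring
    rw [this, abs_neg, abs_div]
    exact div_le_div₀ hMε h2 hη hmi'.le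
  have e3 : |f / mi * m - f' / mi' * m'| ≤ 4 * M * ε / η := by
    calc _ ≤ |f / mi * m - F| + |F - f' / mi' * m'| := abs_sub_le _ _ _
      _ ≤ 2 * M * ε / η + 2 * M * ε / η := by
        rw [abs_sub_comm F]; exact add_le_add e1 e2
      _ = _ := by ring
  have e4 : η / M2 ≤ |f' / mi' * m'| := by
    rw [abs_mul, abs_div]
    calc η / M2 = 1 / M2 * η := by ring
      _ ≤ |f'| / |mi'| * |m'| := by
        apply mul_le_mul _ hm'.le hη.le (by positivity)
        exact div_le_div₀ (abs_nonneg _) hf' (abs_pos.2 a0') hM2'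
  calc _ ≤ 4 * M * ε / η := e3
    _ = (4 * M * M2 * (ε / η ^ 2)) * (η / M2) := by field_simp
    _ ≤ _ := by
      apply mul_le_mul_of_nonneg_left e4
      have : 4 * M * M2 * (ε / η ^ 2) = 2 * (2 * M * ε) * M2 / η ^ 2 := by ring
      rw [this]; positivity

namespace Geo
variable {c₀ : Vec2} {r₀ : ℝ} {B Bt : Set Vec2} {φ : Fin 4 → Vec2 → ℝ}
    {V : Fin 4 → Vec2 → Vec2} {W : Fin 4 → Fin 4 → (Vec2 × ℝ) → (Vec2 × ℝ)}

lemma bounds (G : Geo c₀ r₀ B Bt φ V W) (x) (hx : x ∈ Bt) (s : ℝ) :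
    ∃ M : ℝ, 0 < M ∧ ∀ᶠ p in 𝓝 ((x,s) : X3), ∀ j : Fin 3,
      |fderiv ℝ (φ j.castSucc) p.1 (1,0)| ≤ M ∧ |fderiv ℝ (φ j.castSucc) p.1 (0,1)| ≤ M ∧
      |mfun φ j p| ≤ M := by
  have hb : ∀ g : X3 → ℝ, ContinuousAt g (x,s) → ∃ M : ℝ, 0 < M ∧ ∀ M' ≥ M, ∀ᶠ p in 𝓝 ((x,s):X3), |g p| ≤ M' := by
    intro g hg
    refine ⟨|g (x,s)| + 1, by positivity, fun M' hM' => ?_⟩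
    filter_upwards [hg.abs.eventually_lt (continuousAt_const (y := |g (x,s)| + 1)) (by linarith)] with p hp
    linarith
  have hd : ∀ (j : Fin 3) (v : Vec2), ContinuousAt (fun p : X3 => fderiv ℝ (φ j.castSucc) p.1 v) (x,s) :=
    fun j v => ContinuousAt.comp (g := fun y => fderiv ℝ (φ j.castSucc) y v) (f := Prod.fst)
      (fderiv_dir_analytic (φ j.castSucc) v x (G.hφ_an _ x hx)).continuousAt continuousAt_fst
  choose M1 hM1 h1 using fun j => hb _ (hd j (1,0))
  choose M2 hM2 h2 using fun j => hb _ (hd j (0,1))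
  choose M3 hM3 h3 using fun j => hb _ (G.mfun_analytic j (x,s) hx).continuousAt
  refine ⟨∑ j, (M1 j + M2 j + M3 j), Finset.sum_pos (fun j _ => by linarith [hM1 j, hM2 j, hM3 j]) ⟨0, by simp⟩, ?_⟩
  rw [eventually_all]
  intro j
  have hle : M1 j + M2 j + M3 j ≤ ∑ j, (M1 j + M2 j + M3 j) :=
    Finset.single_le_sum (f := fun j => M1 j + M2 j + M3 j)
      (fun j _ => by linarith [hM1 j, hM2 j, hM3 j]) (Finset.mem_univ j)
  have := hM1 j; have := hM2 j; have := hM3 j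
  exact (h1 j _ (by linarith)).and ((h2 j _ (by linarith)).and (h3 j _ (by linarith)))

lemma loc (G : Geo c₀ r₀ B Bt φ V W)
    (hnosol : ∀ U : Set (Vec2 × ℝ), IsOpen U → U.Nonempty → U ⊆ {p : Vec2 × ℝ | p.1 ∈ B} →
      ∀ g : Fin 3 → Vec2 → ℝ,
      (∀ j : Fin 3, AnalyticOnNhd ℝ (g j) (Φmap (φ j.castSucc) '' U)) →
      (∀ p ∈ U, ∑ j : Fin 3, g j (Φmap (φ j.castSucc) p) • fderiv ℝ (φ j.castSucc) p.1 = 0) →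
      ∀ j : Fin 3, ∀ p ∈ U, g j (Φmap (φ j.castSucc) p) = 0)
    (x) (hx : x ∈ closure B) (s : ℝ) (hs : s ≠ 0) :
    ∃ N ∈ 𝓝 ((x, s) : X3), ∃ C κ : ℝ, 0 < κ ∧ 0 ≤ C ∧ ∀ ε : ℝ, 0 < ε → ε ≤ 1 →
      ∀ f : Fin 3 → Vec2 → ℝ, (∀ j, Measurable (f j)) → ∀ i,
      volume (N ∩ badset φ B f i ε) ≤ ENNReal.ofReal (C * ε ^ κ) := by
  have hxt := G.hBBt hx
  obtain ⟨N1, hN1, C1, κ1, hκ1, hC1, h1⟩ := G.main_part hnosol x hx s hs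
  have hsub := fun j : Fin 3 => analytic_sublevel (volume : Measure X3) (mfun φ j) (x,s)
    (G.mfun_analytic j (x,s) hxt) (by
      intro h0
      obtain ⟨p, hp, hpB⟩ := mem_closure_iff_nhds.1 (mem_closure_O x s hx) _ h0
      exact G.mfun_ne j p hpB hp)
  choose N2 hN2 C2 κ2 hκ2 hC2 h2 using hsub
  obtain ⟨M, hM, hMb⟩ := G.bounds x hxt s
  set N0 : Set X3 := (N1 ∩ ball ((x,s):X3) 1) ∩ ((⋂ j, N2 j) ∩ {p | ∀ j : Fin 3,
      |fderiv ℝ (φ j.castSucc) p.1 (1,0)| ≤ M ∧ |fderiv ℝ (φ j.castSucc) p.1 (0,1)| ≤ M ∧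
      |mfun φ j p| ≤ M}) with hN0
  have hN0n : N0 ∈ 𝓝 ((x,s):X3) := inter_mem (inter_mem hN1 (ball_mem_nhds _ one_pos))
    (inter_mem (iInter_mem.2 hN2) hMb)
  set V0 : ℝ := (volume (ball ((x,s):X3) 1)).toReal with hV0
  set A : ℝ := 4 * M * M with hA
  have hApos : 0 < A := by positivity
  set κ : ℝ := min (κ1/2) (min (κ2 0/4) (min (κ2 1/4) (κ2 2/4))) with hκ
  have hκle : ∀ j, κ ≤ κ2 j / 4 := by
    intro j
    have a1 : κ ≤ min (κ2 0/4) (min (κ2 1/4) (κ2 2/4)) := min_le_right _ _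
    have a2 : κ ≤ min (κ2 1/4) (κ2 2/4) := a1.trans (min_le_right _ _)
    fin_cases j
    · exact a1.trans (min_le_left _ _)
    · exact a2.trans (min_le_left _ _)
    · exact a2.trans (min_le_right _ _)
  have hκpos : 0 < κ := by
    refine lt_min (by positivity) (lt_min ?_ (lt_min ?_ ?_))
    · linarith [hκ2 0]
    · linarith [hκ2 1]
    · linarith [hκ2 2]
  have hV0n : 0 ≤ V0 := ENNReal.toReal_nonneg
  refine ⟨interior N0, interior_mem_nhds.2 hN0n, (C1 + V0) * A ^ κ1 + ∑ j, C2 j, κ, hκpos,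
    add_nonneg (by positivity) (Finset.sum_nonneg fun j _ => hC2 j), ?_⟩
  intro ε hε hε1 f hf i
  set η : ℝ := ε ^ (1/4:ℝ) with hη
  have hηpos : 0 < η := rpow_pos_of_pos hε _
  have hη2 : ε / η ^ 2 = ε ^ (1/2:ℝ) := by
    rw [hη, ← rpow_natCast, ← rpow_mul hε.le]
    nth_rewrite 1 [← rpow_one ε]
    rw [← rpow_sub hε]; norm_num
  set E : Set X3 := (interior N0 ∩ badset φ B f i ε) ∩ {p | ∀ j, η < |mfun φ j p|} with hE
  have hEm : MeasurableSet E := by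
    refine (isOpen_interior.measurableSet.inter (G.badset_meas f hf i ε)).inter ?_
    rw [ofPred_forall]
    exact MeasurableSet.iInter fun j => measurableSet_lt measurable_const (mfun_meas φ j).norm
  have hEN0 : ∀ p ∈ E, p ∈ N0 := fun p hp => interior_subset hp.1.1
  set ε' : ℝ := A * ε ^ (1/2:ℝ) with hε'
  have hε'pos : 0 < ε' := mul_pos hApos (rpow_pos_of_pos hε _)
  have hEvol : volume E ≤ ENNReal.ofReal ((C1 + V0) * ε' ^ κ1) := by
    rcases le_or_gt ε' 1 with hle | hgt
    · have hw : ∀ p ∈ E, ∀ j l : Fin 3, |f j (Φmap (φ j.castSucc) p) * mfun φ l p -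
          f l (Φmap (φ l.castSucc) p) * mfun φ j p| ≤ 2 * M * ε := by
        intro p hp j l
        have hb := (hEN0 p hp).2.2
        exact wedge (fun j => f j (Φmap (φ j.castSucc) p))
          (fun j => fderiv ℝ (φ j.castSucc) p.1 (1,0)) (fun j => fderiv ℝ (φ j.castSucc) p.1 (0,1))
          (fun j => mfun φ j p) (fun j => rfl) M ε (fun j => (hb j).1) (fun j => (hb j).2.1)
          hp.1.2.2.2.1 hp.1.2.2.2.2 j l
      have hnz : ∀ p ∈ E, mfun φ i p ≠ 0 := fun p hp => G.mfun_ne i p hp.1.2.1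
      have := h1 ε' hε'pos hle E (fun p hp => (hEN0 p hp).1.1) hEm (fun p hp => hp.1.2.1)
        (fun p => f i (Φmap (φ i.castSucc) p) / mfun φ i p)
        (fun p hp => by
          refine div_ne_zero ?_ (hnz p hp)
          intro h0
          have := hp.1.2.2.1
          rw [h0, abs_zero] at this; linarith)
        (by
          intro j p hp p' hp' hpp
          have e1 := hw p hp j i
          have e2 := hw p' hp' j i
          rw [← hpp] at e2
          have := K_compare M M ε η hM hηpos _ _ _ _ _ _ _ (hp.2 i) (hp'.2 i) (hp'.2 j)
            ((hEN0 p' hp').2.2 i).2.2 e1 e2 hp'.1.2.2.1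
          rwa [hη2] at this)
      refine this.trans (ENNReal.ofReal_le_ofReal ?_)
      apply mul_le_mul_of_nonneg_right _ (by positivity)
      linarith
    · calc volume E ≤ volume (ball ((x,s):X3) 1) := measure_mono fun p hp => (hEN0 p hp).1.2
        _ = ENNReal.ofReal V0 := by
          rw [hV0, ENNReal.ofReal_toReal]; exact measure_ball_lt_top.ne
        _ ≤ _ := by
          apply ENNReal.ofReal_le_ofReal
          calc V0 ≤ (C1 + V0) * 1 := by linarith
            _ ≤ _ := by
              apply mul_le_mul_of_nonneg_left _ (by linarith)
              exact one_le_rpow hgt.le hκ1.le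
  have hcover : interior N0 ∩ badset φ B f i ε ⊆ E ∪ ⋃ j, (N2 j ∩ {p | |mfun φ j p| ≤ η}) := by
    intro p hp
    by_cases h : ∀ j, η < |mfun φ j p|
    · exact Or.inl ⟨hp, h⟩
    · push Not at h
      obtain ⟨j, hj⟩ := h
      refine Or.inr (mem_iUnion.2 ⟨j, ?_, hj⟩)
      exact mem_iInter.1 (interior_subset hp.1).2.1 j
  have hpow : ∀ a, κ ≤ a → ε ^ a ≤ ε ^ κ := fun a ha =>
    rpow_le_rpow_of_exponent_ge hε hε1 ha
  calc volume (interior N0 ∩ badset φ B f i ε)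
      ≤ volume E + volume (⋃ j, (N2 j ∩ {p | |mfun φ j p| ≤ η})) :=
        (measure_mono hcover).trans (measure_union_le _ _)
    _ ≤ ENNReal.ofReal ((C1 + V0) * ε' ^ κ1) + ∑ j, ENNReal.ofReal (C2 j * η ^ κ2 j) := by
        apply add_le_add hEvol
        refine (measure_iUnion_fintype_le _ _).trans ?_
        exact Finset.sum_le_sum fun j _ => h2 j η hηpos
    _ = ENNReal.ofReal ((C1 + V0) * ε' ^ κ1 + ∑ j, C2 j * η ^ κ2 j) := by
        have : ∀ j, 0 ≤ C2 j * η ^ κ2 j := fun j => mul_nonneg (hC2 j) (by positivity)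
        rw [ENNReal.ofReal_add (by positivity) (Finset.sum_nonneg fun j _ => this j),
          ENNReal.ofReal_sum_of_nonneg fun j _ => this j]
    _ ≤ _ := by
        apply ENNReal.ofReal_le_ofReal
        rw [add_mul _ (∑ j, C2 j), Finset.sum_mul]
        apply add_le_add
        · rw [hε', mul_rpow hApos.le (by positivity), ← rpow_mul hε.le, mul_assoc (C1 + V0)]
          apply mul_le_mul_of_nonneg_left _ (by positivity)
          apply mul_le_mul_of_nonneg_left _ (by positivity)
          apply hpow
          have : κ ≤ κ1/2 := min_le_left _ _
          linarith
        · apply Finset.sum_le_sum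
          intro j _
          apply mul_le_mul_of_nonneg_left _ (hC2 j)
          rw [hη, ← rpow_mul hε.le]
          apply hpow
          linarith [hκle j]

end Geo


lemma pow_combine (C1 C2 κ1 κ2 ε : ℝ) (hC1 : 0 ≤ C1) (hC2 : 0 ≤ C2) (hε : 0 < ε) (hε1 : ε ≤ 1)  :
    ENNReal.ofReal (C1 * ε ^ κ1) + ENNReal.ofReal (C2 * ε ^ κ2) ≤
      ENNReal.ofReal ((C1 + C2) * ε ^ (min κ1 κ2)) := by
  rw [← ENNReal.ofReal_add (by positivity) (by positivity)]
  apply ENNReal.ofReal_le_ofReal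
  rw [add_mul]
  exact add_le_add
    (mul_le_mul_of_nonneg_left (rpow_le_rpow_of_exponent_ge hε hε1 (min_le_left _ _)) hC1)
    (mul_le_mul_of_nonneg_left (rpow_le_rpow_of_exponent_ge hε hε1 (min_le_right _ _)) hC2)

/-- scaling in the last variable -/
def scaleS (a : ℝ) : X3 →ₗ[ℝ] X3 := LinearMap.prodMap LinearMap.id (a • LinearMap.id)

lemma scaleS_apply (a : ℝ) (p : X3) : scaleS a p = (p.1, a * p.2) := rfl

lemma scaleS_vol (a : ℝ) (ha : 0 < a) (S : Set X3) :
    volume (scaleS a '' S) = ENNReal.ofReal a * volume S := by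
  rw [Measure.addHaar_image_linearMap, scaleS, LinearMap.det_prodMap]
  simp [abs_of_pos ha]

namespace Geo
variable {c₀ : Vec2} {r₀ : ℝ} {B Bt : Set Vec2} {φ : Fin 4 → Vec2 → ℝ}
    {V : Fin 4 → Vec2 → Vec2} {W : Fin 4 → Fin 4 → (Vec2 × ℝ) → (Vec2 × ℝ)}

lemma shell (G : Geo c₀ r₀ B Bt φ V W)
    (hnosol : ∀ U : Set (Vec2 × ℝ), IsOpen U → U.Nonempty → U ⊆ {p : Vec2 × ℝ | p.1 ∈ B} →
      ∀ g : Fin 3 → Vec2 → ℝ,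
      (∀ j : Fin 3, AnalyticOnNhd ℝ (g j) (Φmap (φ j.castSucc) '' U)) →
      (∀ p ∈ U, ∑ j : Fin 3, g j (Φmap (φ j.castSucc) p) • fderiv ℝ (φ j.castSucc) p.1 = 0) →
      ∀ j : Fin 3, ∀ p ∈ U, g j (Φmap (φ j.castSucc) p) = 0) :
    ∃ C κ : ℝ, 0 < κ ∧ 0 ≤ C ∧ ∀ ε : ℝ, 0 < ε → ε ≤ 1 →
      ∀ f : Fin 3 → Vec2 → ℝ, (∀ j, Measurable (f j)) → ∀ i,
      volume ({p : X3 | 1/2 ≤ |p.2| ∧ |p.2| ≤ 1} ∩ badset φ B f i ε) ≤ ENNReal.ofReal (C * ε ^ κ) := by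
  have hcB : IsCompact (closure B) := by
    rw [G.hB]; exact isBounded_ball.isCompact_closure
  have hcs : IsCompact {s : ℝ | 1/2 ≤ |s| ∧ |s| ≤ 1} := by
    refine Metric.isCompact_of_isClosed_isBounded ?_ ?_
    · exact (isClosed_le continuous_const continuous_abs).inter (isClosed_le continuous_abs continuous_const)
    · refine (isBounded_closedBall (x := (0:ℝ)) (r := 1)).subset fun s hs => ?_
      simpa using hs.2
  have key := (hcB.prod hcs).induction_on (p := fun S : Set X3 => ∃ C κ : ℝ, 0 < κ ∧ 0 ≤ C ∧
      ∀ ε : ℝ, 0 < ε → ε ≤ 1 →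
      ∀ f : Fin 3 → Vec2 → ℝ, (∀ j, Measurable (f j)) → ∀ i,
      volume (S ∩ badset φ B f i ε) ≤ ENNReal.ofReal (C * ε ^ κ))
    ⟨0, 1, one_pos, le_rfl, by simp⟩
    (by
      rintro s t hst ⟨C, κ, h1, h2, h3⟩
      exact ⟨C, κ, h1, h2, fun ε hε hε1 f hf i =>
        (measure_mono (inter_subset_inter_left _ hst)).trans (h3 ε hε hε1 f hf i)⟩)
    (by
      rintro s t ⟨C, κ, h1, h2, h3⟩ ⟨C', κ', h1', h2', h3'⟩
      refine ⟨C + C', min κ κ', lt_min h1 h1', add_nonneg h2 h2', fun ε hε hε1 f hf i => ?_⟩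
      rw [union_inter_distrib_right]
      exact (measure_union_le _ _).trans ((add_le_add (h3 ε hε hε1 f hf i)
        (h3' ε hε hε1 f hf i)).trans (pow_combine _ _ _ _ _ h2 h2' hε hε1)))
    (by
      rintro ⟨x, s⟩ ⟨hx, hs⟩
      have hs0 : s ≠ 0 := by
        rintro rfl
        have := hs.1
        norm_num at this
      obtain ⟨N, hN, h⟩ := G.loc hnosol x hx s hs0
      exact ⟨N, mem_nhdsWithin_of_mem_nhds hN, h⟩)
  obtain ⟨C, κ, h1, h2, h3⟩ := key
  refine ⟨C, κ, h1, h2, fun ε hε hε1 f hf i => (measure_mono ?_).trans (h3 ε hε hε1 f hf i)⟩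
  rintro p ⟨hp, hb⟩
  exact ⟨⟨subset_closure hb.1, hp⟩, hb⟩

lemma Phi_scale (φ : Vec2 → ℝ) (a : ℝ) (p : X3) :
    Φmap φ (p.1, a * p.2) = ((Φmap φ p).1, a * (Φmap φ p).2) := by
  simp [Φmap, mul_assoc]

lemma shell_scaled (C κ : ℝ)
    (h : ∀ ε : ℝ, 0 < ε → ε ≤ 1 →
      ∀ f : Fin 3 → Vec2 → ℝ, (∀ j, Measurable (f j)) → ∀ i,
      volume ({p : X3 | 1/2 ≤ |p.2| ∧ |p.2| ≤ 1} ∩ badset φ B f i ε) ≤ ENNReal.ofReal (C * ε ^ κ))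
    (a : ℝ) (ha : 0 < a) (ε : ℝ) (hε : 0 < ε) (hε1 : ε ≤ 1) (f : Fin 3 → Vec2 → ℝ)
    (hf : ∀ j, Measurable (f j)) (i : Fin 3) :
    volume ({p : X3 | a/2 ≤ |p.2| ∧ |p.2| ≤ a} ∩ badset φ B f i ε) ≤ ENNReal.ofReal (a * (C * ε ^ κ)) := by
  have h1 := h ε hε hε1 (fun j y => f j (y.1, a * y.2))
    (fun j => (hf j).comp (measurable_fst.prodMk (measurable_const.mul measurable_snd))) i
  rw [ENNReal.ofReal_mul ha.le]
  refine le_trans (measure_mono ?_) ((scaleS_vol a ha _).le.trans (by gcongr))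
  rintro p ⟨⟨hp1, hp2⟩, hb⟩
  have hps : (p.1, a * (p.2 / a)) = p := by
    rw [mul_div_cancel₀ _ ha.ne']
  have hpΦ : ∀ j : Fin 3, ((Φmap (φ j.castSucc) (p.1, p.2 / a)).1, a * (Φmap (φ j.castSucc) (p.1, p.2 / a)).2) =
      Φmap (φ j.castSucc) p := by
    intro j
    rw [← Phi_scale (φ j.castSucc) a (p.1, p.2/a)]; simp only [hps]
  refine ⟨(p.1, p.2 / a), ⟨⟨?_, ?_⟩, ?_⟩, hps⟩
  · simp only [abs_div, abs_of_pos ha]; rw [le_div_iff₀ ha]; linarith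
  · simp only [abs_div, abs_of_pos ha]; rw [div_le_iff₀ ha]; linarith
  · simp only [badset, mem_ofPred_eq, hpΦ]
    exact hb

end Geo

lemma null_s : volume {p : X3 | p.2 = 0} = 0 := by
  have : {p : X3 | p.2 = 0} = (univ : Set Vec2) ×ˢ ({0} : Set ℝ) := by ext; simp
  rw [this, Measure.volume_eq_prod, Measure.prod_prod]; simp

lemma dyadic_sum (S : Set X3) (r A : ℝ) (hr : 0 < r) (hA : 0 ≤ A) (hS : ∀ p ∈ S, |p.2| ≤ r)
    (h : ∀ a, 0 < a → a ≤ r → volume ({p : X3 | a/2 ≤ |p.2| ∧ |p.2| ≤ a} ∩ S) ≤ ENNReal.ofReal (a * A)) :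
    volume S ≤ ENNReal.ofReal (2 * A * r) := by
  have hcov : S ⊆ {p : X3 | p.2 = 0} ∪ ⋃ k : ℕ,
      ({p : X3 | (r * (1/2)^k)/2 ≤ |p.2| ∧ |p.2| ≤ r * (1/2)^k} ∩ S) := by
    intro p hp
    by_cases h0 : p.2 = 0
    · exact Or.inl h0
    · right
      obtain ⟨n, hn1, hn2⟩ := exists_nat_pow_near_of_lt_one (x := |p.2| / r) (y := (1/2:ℝ))
        (by positivity) ((div_le_one hr).2 (hS p hp)) (by norm_num) (by norm_num)
      rw [lt_div_iff₀ hr] at hn1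
      rw [div_le_iff₀ hr] at hn2
      refine mem_iUnion.2 ⟨n, ⟨?_, ?_⟩, hp⟩
      · rw [pow_succ] at hn1; linarith
      · linarith
  calc volume S ≤ volume {p : X3 | p.2 = 0} + volume (⋃ k : ℕ,
      ({p : X3 | (r * (1/2)^k)/2 ≤ |p.2| ∧ |p.2| ≤ r * (1/2)^k} ∩ S)) :=
        (measure_mono hcov).trans (measure_union_le _ _)
    _ ≤ 0 + ∑' k : ℕ, ENNReal.ofReal (r * (1/2)^k * A) := by
        rw [null_s]
        gcongr
        refine (measure_iUnion_le _).trans (ENNReal.tsum_le_tsum fun k => ?_)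
        apply h _ (by positivity)
        have : ((1:ℝ)/2)^k ≤ 1 := pow_le_one₀ (by norm_num) (by norm_num)
        nlinarith
    _ = ENNReal.ofReal (2 * A * r) := by
        have hs : Summable (fun k : ℕ => r * ((1:ℝ)/2)^k * A) :=
          (summable_geometric_two.mul_left r).mul_right A
        rw [zero_add, ← ENNReal.ofReal_tsum_of_nonneg (fun k => by positivity) hs, tsum_mul_right,
          tsum_mul_left, tsum_geometric_two]
        ring_nf

/-- scaled sublevel set bound over `B × [-r,r]`, with bound `C ε^κ r`. -/
theorem stmt15
    -- `B` is a nonempty open ball of finite radius, `Bt` a connected open neighborhood of its closure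
    (c₀ : Vec2) (r₀ : ℝ) (hr₀ : 0 < r₀)
    (B Bt : Set Vec2) (hB : B = Metric.ball c₀ r₀)
    (hBt_open : IsOpen Bt) (hBt_conn : IsConnected Bt) (hBBt : closure B ⊆ Bt)
    -- the φⱼ are real analytic submersions on `Bt`
    (φ : Fin 4 → Vec2 → ℝ)
    (hφ_an : ∀ j, AnalyticOnNhd ℝ (φ j) Bt)
    (hφ_sub : ∀ j, ∀ x ∈ Bt, fderiv ℝ (φ j) x ≠ 0)
    -- transversality hypothesis
    (htrans : ∀ x ∈ B, ∀ j k : Fin 4, j ≠ k →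
      LinearIndependent ℝ ![fderiv ℝ (φ j) x, fderiv ℝ (φ k) x])
    -- Vⱼ : nowhere vanishing real analytic vector fields with Vⱼ φⱼ ≡ 0
    (V : Fin 4 → Vec2 → Vec2)
    (hV_an : ∀ j, AnalyticOnNhd ℝ (V j) Bt)
    (hV_ne : ∀ j, ∀ x ∈ Bt, V j x ≠ 0)
    (hV_ker : ∀ j, ∀ x ∈ Bt, fderiv ℝ (φ j) x (V j x) = 0)
    -- auxiliary hypothesis 2
    (W : Fin 4 → Fin 4 → (Vec2 × ℝ) → (Vec2 × ℝ))
    (hW_an : ∀ j k, AnalyticOnNhd ℝ (W j k) (Bt ×ˢ (univ : Set ℝ)))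
    (hW_ne : ∀ j k, ∀ p ∈ Bt ×ˢ (univ : Set ℝ), W j k p ≠ 0)
    (hW_ker : ∀ j k, ∀ p ∈ Bt ×ˢ (univ : Set ℝ),
      fderiv ℝ (fun q : Vec2 × ℝ => ((φ j q.1, q.2 * fderiv ℝ (φ j) q.1 (V k q.1)) : Vec2))
        p (W j k p) = 0)
    (haux2 : ∀ k : Fin 4, ∀ p : Vec2 × ℝ, p.1 ∈ Bt → p.2 ≠ 0 →
      LinearIndependent ℝ (fun j : {j : Fin 4 // j ≠ k} => W j.1 k p))
    -- coordinates are chosen so that φ₄(x₁,x₂) = x₁ on B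
    (hφ4 : ∀ x ∈ B, φ 3 x = x.1)
    -- there is no nonzero real analytic solution of the functional equation on any
    -- nonempty open set
    (hnosol : ∀ U : Set (Vec2 × ℝ), IsOpen U → U.Nonempty → U ⊆ {p : Vec2 × ℝ | p.1 ∈ B} →
      ∀ g : Fin 3 → Vec2 → ℝ,
      (∀ j : Fin 3, AnalyticOnNhd ℝ (g j) (Φmap (φ j.castSucc) '' U)) →
      (∀ p ∈ U, ∑ j : Fin 3, g j (Φmap (φ j.castSucc) p) • fderiv ℝ (φ j.castSucc) p.1 = 0) →
      ∀ j : Fin 3, ∀ p ∈ U, g j (Φmap (φ j.castSucc) p) = 0)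
    : ∃ κ : ℝ, 0 < κ ∧ ∃ C : ℝ, ∀ r : ℝ, 0 < r → ∀ ε : ℝ, 0 < ε → ε ≤ 1 →
      ∀ f : Fin 3 → Vec2 → ℝ, (∀ j, Measurable (f j)) →
      (∃ i : Fin 3, ∀ p : Vec2 × ℝ, p.1 ∈ B → p.2 ∈ Set.Icc (-r) r →
        1 ≤ |f i (Φmap (φ i.castSucc) p)|) →
      volume {p : Vec2 × ℝ | p.1 ∈ B ∧ p.2 ∈ Set.Icc (-r) r ∧
          ‖∑ j : Fin 3, f j (Φmap (φ j.castSucc) p) • fderiv ℝ (φ j.castSucc) p.1‖ ≤ ε}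
        ≤ ENNReal.ofReal (C * ε ^ κ * r) := by
  have G : Geo c₀ r₀ B Bt φ V W := ⟨hr₀, hB, hBt_open, hBt_conn, hBBt, hφ_an, hφ_sub, htrans, hV_an,
    hV_ne, hV_ker, hW_an, hW_ne, hW_ker, haux2, hφ4⟩
  obtain ⟨C, κ, hκ, hC, h⟩ := G.shell hnosol
  refine ⟨κ, hκ, 2 * C, ?_⟩
  rintro r hr ε hε hε1 f hf ⟨i, hi⟩
  have h0 : 0 ≤ C * ε ^ κ := by positivity
  have := dyadic_sum {p : Vec2 × ℝ | p.1 ∈ B ∧ p.2 ∈ Set.Icc (-r) r ∧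
      ‖∑ j : Fin 3, f j (Φmap (φ j.castSucc) p) • fderiv ℝ (φ j.castSucc) p.1‖ ≤ ε} r (C * ε ^ κ)
      hr h0 (fun p hp => abs_le.2 hp.2.1) (by
        intro a ha _
        refine (measure_mono (inter_subset_inter_right _ ?_)).trans
          (Geo.shell_scaled C κ h a ha ε hε hε1 f hf i)
        rintro p ⟨hp1, hp2, hp3⟩
        have hv : ∀ v : Vec2, ‖v‖ ≤ 1 →
            |∑ j : Fin 3, f j (Φmap (φ j.castSucc) p) * fderiv ℝ (φ j.castSucc) p.1 v| ≤ ε := by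
          intro v hv
          have e1 := (∑ j : Fin 3, f j (Φmap (φ j.castSucc) p) • fderiv ℝ (φ j.castSucc) p.1).le_opNorm v
          have e2 : (∑ j : Fin 3, f j (Φmap (φ j.castSucc) p) • fderiv ℝ (φ j.castSucc) p.1) v =
              ∑ j : Fin 3, f j (Φmap (φ j.castSucc) p) * fderiv ℝ (φ j.castSucc) p.1 v := by
            simp
          rw [e2, Real.norm_eq_abs] at e1
          calc _ ≤ _ := e1
            _ ≤ ε * 1 := mul_le_mul hp3 hv (norm_nonneg _) hε.le
            _ = ε := mul_one _
        exact ⟨hp1, hi p hp1 hp2, hv _ (by simp [Prod.norm_def]), hv _ (by simp [Prod.norm_def])⟩)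
  convert this using 2
  ring
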